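/- Let d₁, d₂ ≥ 1 and n = d₁ + d₂. For i < d₁ let αᵢ(x,y) = pᵢx + qᵢy + cᵢ and for j < d₂ let βⱼ(x,y) = rⱼx + sⱼy + eⱼ be degree-one polynomials on ℂ² with (pᵢ, qᵢ) ≠ (0,0) and (rⱼ, sⱼ) ≠ (0,0), whose coefficient triples (pᵢ, qᵢ, cᵢ) and (rⱼ, sⱼ, eⱼ) are pairwise non-proportional (so the n affine lines they define are pairwise distinct). Assume that for every pair (i, j) the vectors (pᵢ, qᵢ) and (rⱼ, sⱼ) are linearly independent over ℂ, so that {αᵢ = 0} and {βⱼ = 0} meet in exactly one point m(i,j) ∈ ℂ², and that the d₁·d₂ points m(i,j) are pairwise distinct (the two subarrangements intersect in general position). Let Q(x,y,z) = z · ∏_{i<d₁} (pᵢx + qᵢy + cᵢz) · ∏_{j<d₂} (rⱼx + sⱼy + eⱼz) be the defining polynomial of the cone over the arrangement, and let F = {w ∈ ℂ³ : Q(w) = 1} with the subspace topology (the Milnor fiber of the cone), with basepoint w₀ ∈ F. Then the abelianization of π₁(F, w₀) is isomorphic to the free abelian group ℤⁿ. -/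

import Mathlib

noncomputable section

open scoped unitInterval Topology

namespace MF

variable {X Y Z : Type*} [TopologicalSpace X] [TopologicalSpace Y] [TopologicalSpace Z]

/-- Path classes. -/
abbrev PQ (x y : X) := Path.Homotopic.Quotient x y

/-- The class of a path. -/
abbrev cls {x y : X} (p : Path x y) : PQ x y := Path.Homotopic.Quotient.mk p

notation:70 a:70 "⬝" b:71 => Path.Homotopic.Quotient.trans a b

lemma square (F : I × I → X) (hF : Continuous F) {a b c d : X}
    (p : Path a b) (q : Path b d) (r : Path a c) (s : Path c d)
    (hp : ∀ t, F (t, 0) = p t) (hq : ∀ t, F (1, t) = q t)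
    (hr : ∀ t, F (0, t) = r t) (hs : ∀ t, F (t, 1) = s t) :
    cls p ⬝ cls q = cls r ⬝ cls s := by
  have ha : a = F (0, 0) := by rw [hp]; simp
  have hb : b = F (1, 0) := by rw [hp]; simp
  have hc : c = F (0, 1) := by rw [hr]; simp
  have hd : d = F (1, 1) := by rw [hq]; simp
  subst ha hb hc hd
  let f : C(I, X) := ⟨fun s => F (s, 0), by fun_prop⟩
  let g : C(I, X) := ⟨fun s => F (s, 1), by fun_prop⟩
  let H : f.Homotopy g := ⟨⟨fun z => F (z.2, z.1), by fun_prop⟩, fun _ => rfl, fun _ => rfl⟩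
  have := Path.Homotopic.map_trans_evalAt H (Path.id)
  have h1 : p = (Path.id).map (map_continuous f) := by ext t; exact (hp t).symm
  have h2 : q = H.evalAt 1 := by ext t; exact (hq t).symm
  have h3 : r = H.evalAt 0 := by ext t; exact (hr t).symm
  have h4 : s = (Path.id).map (map_continuous g) := by ext t; exact (hs t).symm
  rw [h1, h2, h3, h4, ← Path.Homotopic.Quotient.mk_trans, ← Path.Homotopic.Quotient.mk_trans]
  exact Path.Homotopic.Quotient.eq.2 this

section simplemmas
variable {x y z w : X}
@[simp] lemma refl_t (p : PQ x y) : Path.Homotopic.Quotient.refl x ⬝ p = p :=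
  Path.Homotopic.Quotient.refl_trans p
@[simp] lemma t_refl (p : PQ x y) : p ⬝ Path.Homotopic.Quotient.refl y = p :=
  Path.Homotopic.Quotient.trans_refl p
@[simp] lemma t_symm (p : PQ x y) : p ⬝ p.symm = Path.Homotopic.Quotient.refl x :=
  Path.Homotopic.Quotient.trans_symm p
@[simp] lemma symm_t (p : PQ x y) : p.symm ⬝ p = Path.Homotopic.Quotient.refl y :=
  Path.Homotopic.Quotient.symm_trans p
lemma t_assoc (p : PQ x y) (q : PQ y z) (r : PQ z w) : p ⬝ q ⬝ r = p ⬝ (q ⬝ r) :=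
  Path.Homotopic.Quotient.trans_assoc p q r
@[simp] lemma t_symm_assoc (p : PQ x y) (q : PQ x z) : p ⬝ (p.symm ⬝ q) = q := by
  rw [← t_assoc]; simp
@[simp] lemma symm_t_assoc (p : PQ x y) (q : PQ y z) : p.symm ⬝ (p ⬝ q) = q := by
  rw [← t_assoc]; simp
lemma t_cancel_left {p : PQ x y} {q r : PQ y z} (h : p ⬝ q = p ⬝ r) : q = r := by
  have := congrArg (fun s => p.symm ⬝ s) h
  simpa using this
lemma t_cancel_right {p : PQ y z} {q r : PQ x y} (h : q ⬝ p = r ⬝ p) : q = r := by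
  have := congrArg (fun s => s ⬝ p.symm) h
  simpa [t_assoc] using this
@[simp] lemma symm_trans' (p : PQ x y) (q : PQ y z) : (p ⬝ q).symm = q.symm ⬝ p.symm := by
  apply t_cancel_left (p := p ⬝ q)
  rw [t_symm, t_assoc, ← t_assoc q]; simp
@[simp] lemma symm_symm' (p : PQ x y) : p.symm.symm = p := by
  apply t_cancel_left (p := p.symm); simp
@[simp] lemma symm_refl' : (Path.Homotopic.Quotient.refl x).symm = Path.Homotopic.Quotient.refl x := by
  apply t_cancel_left (p := Path.Homotopic.Quotient.refl x); simp
lemma cls_refl : cls (Path.refl x) = Path.Homotopic.Quotient.refl x := rfl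
lemma cls_symm (p : Path x y) : cls p.symm = (cls p).symm := rfl
lemma cls_trans (p : Path x y) (q : Path y z) : cls (p.trans q) = cls p ⬝ cls q := rfl
lemma cls_surj (p : PQ x y) : ∃ γ : Path x y, cls γ = p := Path.Homotopic.Quotient.mk_surjective p
end simplemmas

lemma homot (F : I × I → X) (hF : Continuous F) {a b : X}
    (p q : Path a b) (hp : ∀ t, F (t, 0) = p t) (hq : ∀ t, F (t, 1) = q t)
    (h0 : ∀ t, F (0, t) = a) (h1 : ∀ t, F (1, t) = b) : cls p = cls q := by
  have := square F hF p (Path.refl b) (Path.refl a) q hp (by simpa using h1) (by simpa using h0) hq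
  rwa [cls_refl, cls_refl, t_refl, refl_t] at this

/-- Image of a path class with prescribed endpoints. -/
def pm (f : C(X, Y)) {x y : X} {x' y' : Y} (q : PQ x y) (hx : x' = f x) (hy : y' = f y) : PQ x' y' :=
  (q.map f).cast hx hy

section pm
variable {x y z : X} {x' y' z' : Y} (f : C(X, Y))
lemma pm_cls (p : Path x y) (hx : x' = f x) (hy : y' = f y) :
    pm f (cls p) hx hy = cls ((p.map f.continuous).cast hx hy) := rfl
lemma pm_trans (p : PQ x y) (q : PQ y z) (hx : x' = f x) (hy : y' = f y) (hz : z' = f z) :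
    pm f (p ⬝ q) hx hz = pm f p hx hy ⬝ pm f q hy hz := by
  subst hx hy hz
  obtain ⟨p, rfl⟩ := cls_surj p
  obtain ⟨q, rfl⟩ := cls_surj q
  rw [← cls_trans, pm_cls, pm_cls, pm_cls, ← cls_trans]
  congr 1
  ext t
  simp [Path.map_trans]
lemma pm_refl (hx : x' = f x) : pm f (Path.Homotopic.Quotient.refl x) hx hx =
    Path.Homotopic.Quotient.refl x' := by
  subst hx; rfl
lemma pm_symm (p : PQ x y) (hx : x' = f x) (hy : y' = f y) :
    pm f p.symm hy hx = (pm f p hx hy).symm := by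
  apply t_cancel_left (p := pm f p hx hy)
  rw [← pm_trans, t_symm, t_symm, pm_refl]
lemma pm_pm (g : C(Y, Z)) (p : PQ x y) {x'' y'' : Z} (hx : x' = f x) (hy : y' = f y)
    (hx' : x'' = g x') (hy' : y'' = g y') :
    pm g (pm f p hx hy) hx' hy' = pm (g.comp f) p (by subst hx; exact hx') (by subst hy; exact hy') := by
  subst hx hy hx' hy'
  obtain ⟨p, rfl⟩ := cls_surj p
  rfl
lemma pm_congr (g : C(X, Y)) (h : ∀ x, f x = g x) (p : PQ x y) (hx : x' = f x) (hy : y' = f y) :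
    pm f p hx hy = pm g p (by rw [← h]; exact hx) (by rw [← h]; exact hy) := by
  have : f = g := ContinuousMap.ext h
  subst this; rfl
end pm

/-- The loop group with multiplication in path order. -/
abbrev Lp (x : X) := PQ x x

namespace Lp
variable {x : X}
instance : Group (Lp x) where
  mul p q := Path.Homotopic.Quotient.trans p q
  one := Path.Homotopic.Quotient.refl x
  inv p := Path.Homotopic.Quotient.symm p
  mul_assoc p q r := t_assoc (x := x) (y := x) (z := x) (w := x) p q r
  one_mul p := refl_t (x := x) (y := x) p
  mul_one p := t_refl (x := x) (y := x) p
  inv_mul_cancel p := symm_t (x := x) (y := x) p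
lemma mul_def (p q : Lp x) : p * q = Path.Homotopic.Quotient.trans p q := rfl
lemma one_def : (1 : Lp x) = Path.Homotopic.Quotient.refl x := rfl
lemma inv_def (p : Lp x) : p⁻¹ = Path.Homotopic.Quotient.symm p := rfl

/-- induced hom -/
def map (f : C(X, Y)) {x : X} {x' : Y} (hx : x' = f x) : Lp x →* Lp x' where
  toFun p := pm f p hx hx
  map_one' := pm_refl f hx
  map_mul' p q := pm_trans f p q hx hx hx

lemma map_apply (f : C(X, Y)) {x : X} {x' : Y} (hx : x' = f x) (p : Lp x) :
    map f hx p = pm f p hx hx := rfl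

end Lp

/-- the fundamental group as a loop group -/
def fgEquiv (x : X) : FundamentalGroup X x ≃* Lp x where
  toFun p := Path.Homotopic.Quotient.symm p
  invFun p := Path.Homotopic.Quotient.symm p
  left_inv p := symm_symm' (x := x) (y := x) p
  right_inv p := symm_symm' (x := x) (y := x) p
  map_mul' p q := symm_trans' (x := x) (y := x) (z := x) q p

lemma loc {x₀ : X} (C : ∀ x, Set (PQ x₀ x)) (h0 : Path.Homotopic.Quotient.refl x₀ ∈ C x₀)
    (hloc : ∀ x, ∃ U : Set X, IsOpen U ∧ x ∈ U ∧ ∀ x1 x2 (δ : Path x1 x2), (∀ s, δ s ∈ U) →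
      ∀ q ∈ C x1, q ⬝ cls δ ∈ C x2) : ∀ x (q : PQ x₀ x), q ∈ C x := by
  intro x q
  obtain ⟨γ, rfl⟩ := cls_surj q
  choose U hUo hU hC using hloc
  obtain ⟨t, ht0, htm, ⟨n, htn⟩, hcov⟩ := exists_monotone_Icc_subset_open_cover_unitInterval
    (c := fun x => γ ⁻¹' (U x)) (fun x => (hUo x).preimage γ.continuous)
    (by intro s _; simp only [Set.mem_iUnion]; exact ⟨γ s, hU _⟩)
  have key : ∀ n, cls ((γ.subpath 0 (t n)).cast γ.source.symm rfl) ∈ C (γ (t n)) := by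
    intro n
    induction n with
    | zero =>
      have h : ∀ y (hy : y = 0), cls ((γ.subpath 0 y).cast γ.source.symm rfl) ∈ C (γ y) := by
        rintro y rfl
        have : ∀ z (hz : z = x₀) (p : Path x₀ z), (∀ s, p s = x₀) → cls p ∈ C z := by
          rintro z rfl p hp
          have : p = Path.refl z := by ext s; exact hp s
          rw [this]; exact h0
        apply this _ γ.source
        intro s
        simp
      exact h _ ht0
    | succ n ih =>
      obtain ⟨i, hi⟩ := hcov n
      have h2 := hC i _ _ (γ.subpath (t n) (t (n+1))) (by
        intro s
        have : γ.subpath (t n) (t (n+1)) s ∈ γ '' Set.Icc (t n) (t (n+1)) := by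
          rw [← Path.range_subpath_of_le _ _ _ (htm n.le_succ)]; exact ⟨s, rfl⟩
        obtain ⟨r, hr, hr'⟩ := this
        rw [← hr']; exact hi hr) _ ih
      convert h2 using 1
      rw [← cls_trans]
      apply Path.Homotopic.Quotient.eq.2
      have := (Path.Homotopic.pathCast (⟨Path.Homotopy.subpathTransSubpath γ 0 (t n) (t (n+1))⟩ : Path.Homotopic _ _) γ.source.symm rfl).symm
      convert this using 1
      ext s
      simp [Path.trans_apply]
  have h1 := key n
  have h : ∀ y (hy : y = 1), cls ((γ.subpath 0 y).cast γ.source.symm rfl) ∈ C (γ y) → cls γ ∈ C x := by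
    rintro y rfl h
    have : ∀ z (hz : z = x) (p : Path x₀ z), (∀ s, p s = γ s) → cls p ∈ C z → cls γ ∈ C x := by
      rintro z rfl p hp h
      have : p = γ := by ext s; exact hp s
      rwa [← this]
    apply this _ γ.target _ _ h
    intro s
    simp [Path.subpath]
  exact h _ (htn n le_rfl) h1

/-- multiplicative cocycles on path classes -/
structure Coc (X : Type*) [TopologicalSpace X] (A : Type*) [Group A] where
  toF : ∀ {x y : X}, PQ x y → A
  map_t : ∀ {x y z : X} (p : PQ x y) (q : PQ y z), toF (p ⬝ q) = toF p * toF q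

namespace Coc
variable {A : Type*} [Group A] (Φ : Coc X A)
@[simp] lemma map_refl (x : X) : Φ.toF (Path.Homotopic.Quotient.refl x) = 1 := by
  have := Φ.map_t (Path.Homotopic.Quotient.refl x) (Path.Homotopic.Quotient.refl x)
  rw [refl_t] at this
  simpa using this
@[simp] lemma map_symm {x y : X} (p : PQ x y) : Φ.toF p.symm = (Φ.toF p)⁻¹ := by
  have := Φ.map_t p p.symm
  rw [t_symm, map_refl] at this
  exact (inv_eq_of_mul_eq_one_right this.symm).symm

/-- restriction to the loop group -/
def hom (x : X) : Lp x →* A where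
  toFun p := Φ.toF (x := x) (y := x) p
  map_one' := Φ.map_refl x
  map_mul' p q := Φ.map_t (x := x) (y := x) (z := x) p q

/-- extension of a homomorphism along tails -/
def ext {x₀ : X} (R : Lp x₀ →* A) (tail : ∀ x, PQ x₀ x) : Coc X A where
  toF {x y} q := R (tail x ⬝ q ⬝ (tail y).symm : PQ x₀ x₀)
  map_t {x y z} p q := by
    rw [← R.map_mul, Lp.mul_def]
    simp [t_assoc]
end Coc

/-- Surjectivity part of van Kampen. -/
lemma vks {ι : Type*} (U : ι → Set X) (hU : ∀ i, IsOpen (U i)) (hcov : ∀ x, ∃ i, x ∈ U i)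
    (x₀ : X) (hx₀ : ∀ i, x₀ ∈ U i)
    (hconn : ∀ i j x, x ∈ U i → x ∈ U j → ∃ γ : Path x₀ x, (∀ s, γ s ∈ U i ∧ γ s ∈ U j))
    (H : Subgroup (Lp x₀)) (hH : ∀ i (γ : Path x₀ x₀), (∀ s, γ s ∈ U i) → (cls γ : Lp x₀) ∈ H) :
    H = ⊤ := by
  rw [Subgroup.eq_top_iff']
  let C : ∀ x, Set (PQ x₀ x) := fun x => {q | ∃ i, x ∈ U i ∧ ∀ γ : Path x₀ x, (∀ s, γ s ∈ U i) →
    (q ⬝ (cls γ).symm : Lp x₀) ∈ H}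
  obtain ⟨i0, -⟩ := hcov x₀
  have hC : ∀ x (q : PQ x₀ x), q ∈ C x → ∀ j, x ∈ U j → ∀ γ : Path x₀ x, (∀ s, γ s ∈ U j) →
      (q ⬝ (cls γ).symm : Lp x₀) ∈ H := by
    rintro x q ⟨i, hi, h⟩ j hj γ hγ
    obtain ⟨c, hc⟩ := hconn i j x hi hj
    have h1 := h c (fun s => (hc s).1)
    have h2 := hH j (c.trans γ.symm) (by
      intro s
      rw [Path.trans_apply]
      split_ifs
      · exact (hc _).2
      · exact hγ _)
    have := H.mul_mem h1 h2
    rw [Lp.mul_def, cls_trans, cls_symm] at this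
    simpa [t_assoc] using this
  have := loc C ⟨i0, hx₀ i0, fun γ hγ => by
    rw [refl_t, ← cls_symm]
    exact hH i0 γ.symm (fun s => hγ _)⟩ (by
    intro x
    obtain ⟨i, hi⟩ := hcov x
    refine ⟨U i, hU i, hi, fun x1 x2 δ hδ q hq => ?_⟩
    have hx1 : x1 ∈ U i := by simpa using hδ 0
    have hx2 : x2 ∈ U i := by simpa using hδ 1
    obtain ⟨c, hc⟩ := hconn i i x1 hx1 hx1
    have h1 := hC x1 q hq i hx1 c (fun s => (hc s).1)
    refine ⟨i, hx2, fun γ hγ => ?_⟩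
    have h2 := hH i ((c.trans δ).trans γ.symm) (by
      intro s
      rw [Path.trans_apply]
      split_ifs
      · rw [Path.trans_apply]
        split_ifs
        · exact (hc _).1
        · exact hδ _
      · exact hγ _)
    have := H.mul_mem h1 h2
    rw [Lp.mul_def, cls_trans, cls_trans, cls_symm] at this
    simpa [t_assoc] using this)
  intro g
  have h := hC x₀ g (this x₀ g) i0 (hx₀ i0) (Path.refl x₀) (fun s => hx₀ i0)
  rw [cls_refl, symm_refl', t_refl] at h
  exact h

end MF

end

noncomputable section

open scoped unitInterval Topology

namespace MF

variable {X Y Z : Type*} [TopologicalSpace X] [TopologicalSpace Y] [TopologicalSpace Z]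

lemma loglift2 (f : I × I → ℂ) (hf : Continuous f) (h0 : ∀ a, f a ≠ 0) :
    ∃ L : I × I → ℂ, Continuous L ∧ ∀ a, Complex.exp (L a) = f a := by
  let pr : ℝ → I := Set.projIcc 0 1 zero_le_one
  have hpr : Continuous pr := continuous_projIcc
  let F : C(ℝ × ℝ, {z : ℂ // z ≠ 0}) := ⟨fun a => ⟨f (pr a.1, pr a.2), h0 _⟩, by fun_prop⟩
  obtain ⟨L, ⟨-, hL⟩, -⟩ := Complex.isCoveringMap_exp.existsUnique_continuousMap_lifts F (0, 0)
    (Complex.log (F (0, 0)).1) (Subtype.ext (Complex.exp_log (F (0, 0)).2))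
  refine ⟨fun a => L (a.1, a.2), by fun_prop, fun a => ?_⟩
  have := congrArg Subtype.val (congrFun hL ((a.1 : ℝ), (a.2 : ℝ)))
  simpa [F, pr, Set.projIcc_val] using this

lemma loglift1 (f : I → ℂ) (hf : Continuous f) (h0 : ∀ a, f a ≠ 0) :
    ∃ L : I → ℂ, Continuous L ∧ ∀ a, Complex.exp (L a) = f a := by
  obtain ⟨L, hL, h⟩ := loglift2 (fun a => f a.1) (by fun_prop) (fun a => h0 _)
  exact ⟨fun s => L (s, 0), by fun_prop, fun a => h _⟩

lemma log_unique {A : Type*} [TopologicalSpace A] [PreconnectedSpace A] {L L' : A → ℂ}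
    (hL : Continuous L) (hL' : Continuous L') (h : ∀ a, Complex.exp (L a) = Complex.exp (L' a))
    (a b : A) : L a - L' a = L b - L' b := by
  have hc : Continuous (fun a => L a - L' a) := hL.sub hL'
  refine Complex.isCoveringMap_exp.const_of_comp hc (fun a a' => ?_) a b
  apply Subtype.ext
  simp [Complex.exp_sub, h]

lemma wnd_aux (f : C(X, ℂ)) (hf : ∀ x, f x ≠ 0) {x y : X} (γ γ' : Path x y)
    (h : Path.Homotopic γ γ') (L L' : I → ℂ) (hL : Continuous L) (hL' : Continuous L')
    (hγ : ∀ s, Complex.exp (L s) = f (γ s)) (hγ' : ∀ s, Complex.exp (L' s) = f (γ' s)) :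
    L 1 - L 0 = L' 1 - L' 0 := by
  obtain ⟨H⟩ := h
  obtain ⟨M, hM, hM'⟩ := loglift2 (fun a => f (H a)) (by fun_prop) (fun a => hf _)
  have e0 := log_unique (L := L) (L' := fun s => M (0, s)) hL (by fun_prop)
    (fun s => by rw [hγ, hM']; simp) 1 0
  have e1 := log_unique (L := L') (L' := fun s => M (1, s)) hL' (by fun_prop)
    (fun s => by rw [hγ', hM']; simp) 1 0
  have e2 := log_unique (L := fun _ : I => M (0, 0)) (L' := fun s => M (s, 0)) (by fun_prop) (by fun_prop)
    (fun s => by rw [hM', hM']; simp) 1 0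
  have e3 := log_unique (L := fun _ : I => M (0, 1)) (L' := fun s => M (s, 1)) (by fun_prop) (by fun_prop)
    (fun s => by rw [hM', hM']; simp) 1 0
  linear_combination e0 - e1 - e2 + e3

/-- winding (increment of the logarithm) of a nonvanishing function along a path class -/
def wnd (f : C(X, ℂ)) (hf : ∀ x, f x ≠ 0) {x y : X} (q : PQ x y) : ℂ :=
  Quotient.lift (s := Path.Homotopic.setoid x y) (fun γ : Path x y =>
    (loglift1 (fun s => f (γ s)) (by fun_prop) (fun s => hf _)).choose 1 -
    (loglift1 (fun s => f (γ s)) (by fun_prop) (fun s => hf _)).choose 0) (by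
    intro γ γ' h
    exact wnd_aux f hf γ γ' h _ _ (loglift1 (fun s => f (γ s)) (by fun_prop) (fun s => hf _)).choose_spec.1
      (loglift1 (fun s => f (γ' s)) (by fun_prop) (fun s => hf _)).choose_spec.1
      (loglift1 (fun s => f (γ s)) (by fun_prop) (fun s => hf _)).choose_spec.2
      (loglift1 (fun s => f (γ' s)) (by fun_prop) (fun s => hf _)).choose_spec.2) q

section wnd
variable (f : C(X, ℂ)) (hf : ∀ x, f x ≠ 0) {x y z : X}

lemma wnd_cls (γ : Path x y) (L : I → ℂ) (hL : Continuous L)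
    (h : ∀ s, Complex.exp (L s) = f (γ s)) : wnd f hf (cls γ) = L 1 - L 0 :=
  wnd_aux f hf γ γ (Path.Homotopic.refl γ) _ _
    (loglift1 (fun s => f (γ s)) (by fun_prop) (fun s => hf _)).choose_spec.1 hL
    (loglift1 (fun s => f (γ s)) (by fun_prop) (fun s => hf _)).choose_spec.2 h

lemma exists_lift (f : C(X, ℂ)) (hf : ∀ x, f x ≠ 0) (γ : Path x y) : ∃ L : I → ℂ, Continuous L ∧ ∀ s, Complex.exp (L s) = f (γ s) :=
  loglift1 (fun s => f (γ s)) (by fun_prop) (fun s => hf _)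

lemma wnd_trans (p : PQ x y) (q : PQ y z) : wnd f hf (p ⬝ q) = wnd f hf p + wnd f hf q := by
  obtain ⟨p, rfl⟩ := cls_surj p
  obtain ⟨q, rfl⟩ := cls_surj q
  obtain ⟨L, hL, hp⟩ := exists_lift f hf p
  obtain ⟨M, hM, hq⟩ := exists_lift f hf q
  rw [wnd_cls f hf p L hL hp, wnd_cls f hf q M hM hq, ← cls_trans]
  let P : Path (L 0) (L 1) := ⟨⟨L, hL⟩, rfl, rfl⟩
  let Q : Path (L 1) (M 1 + (L 1 - M 0)) :=
    ⟨⟨fun s => M s + (L 1 - M 0), by fun_prop⟩, by simp, by simp⟩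
  have hLM : Complex.exp (L 1 - M 0) = 1 := by
    rw [Complex.exp_sub, hp, hq]; simp [hf]
  rw [wnd_cls f hf (p.trans q) (P.trans Q) (by fun_prop)]
  · simp; ring
  · intro s
    rw [Path.trans_apply, Path.trans_apply]
    split_ifs
    · exact hp _
    · simp only [Q, Path.coe_mk_mk, Complex.exp_add, hLM, hq, mul_one]

/-- winding as a multiplicative cocycle -/
def wCoc : Coc X (Multiplicative ℂ) where
  toF q := Multiplicative.ofAdd (wnd f hf q)
  map_t p q := by rw [wnd_trans]; rfl

@[simp] lemma wnd_refl : wnd f hf (Path.Homotopic.Quotient.refl x) = 0 :=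
  (wCoc f hf).map_refl x
@[simp] lemma wnd_symm (p : PQ x y) : wnd f hf p.symm = - wnd f hf p :=
  (wCoc f hf).map_symm p
@[simp] lemma wnd_one : wnd f hf (1 : Lp x) = 0 := wnd_refl f hf
@[simp] lemma wnd_mul (p q : Lp x) : wnd f hf (p * q) = wnd f hf p + wnd f hf q :=
  wnd_trans f hf p q
@[simp] lemma wnd_inv (p : Lp x) : wnd f hf p⁻¹ = - wnd f hf p := wnd_symm f hf p
@[simp] lemma wnd_zpow (p : Lp x) (m : ℤ) : wnd f hf (p ^ m) = m * wnd f hf p := by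
  have := map_zpow ((wCoc f hf).hom x) p m
  have h2 := congrArg Multiplicative.toAdd this
  rw [toAdd_zpow, zsmul_eq_mul] at h2
  exact h2

lemma wnd_int (p : Lp x) : ∃ m : ℤ, wnd f hf p = m * (2 * Real.pi * Complex.I) := by
  obtain ⟨γ, rfl⟩ := cls_surj p
  obtain ⟨L, hL, h⟩ := exists_lift f hf γ
  rw [wnd_cls f hf γ L hL h]
  have : Complex.exp (L 1) = Complex.exp (L 0) := by rw [h, h]; simp
  obtain ⟨m, hm⟩ := Complex.exp_eq_exp_iff_exists_int.1 this
  exact ⟨m, by rw [hm]; ring⟩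

lemma wnd_pm (g : C(Y, X)) {a b : Y} {x y : X} (p : PQ a b) (hx : x = g a) (hy : y = g b)
    (f' : C(Y, ℂ)) (hf' : ∀ y, f' y ≠ 0) (hff : ∀ a, f' a = f (g a)) :
    wnd f hf (pm g p hx hy) = wnd f' hf' p := by
  obtain ⟨γ, rfl⟩ := cls_surj p
  obtain ⟨L, hL, h⟩ := exists_lift f' hf' γ
  rw [wnd_cls f' hf' γ L hL h, pm_cls]
  exact wnd_cls _ _ _ L hL (fun s => by rw [h, hff]; rfl)

end wnd

section convex
variable {C : Set ℂ} (hC : Convex ℝ C) (hCo : IsOpen C) {p : ℂ} (hp : p ∈ C)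
include hC hCo hp

omit hCo in
lemma star_exp {L : ℂ} (h : p + Complex.exp L ∈ C) {N : ℝ} (hN : 0 ≤ N) :
    p + Complex.exp (L - N) ∈ C := by
  have := hC.add_smul_sub_mem hp h (t := Real.exp (-N)) ⟨(Real.exp_pos _).le, by simpa using hN⟩
  convert this using 2
  rw [sub_eq_add_neg, Complex.exp_add, Complex.real_smul]
  push_cast
  ring

omit hC in
lemma exists_depth (R : ℝ) : ∃ N : ℝ, 0 ≤ N ∧ ∀ L : ℂ, L.re ≤ R → p + Complex.exp (L - N) ∈ C := by
  obtain ⟨ε, hε, hb⟩ := Metric.isOpen_iff.1 hCo p hp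
  refine ⟨max 0 (R - Real.log (ε / 2)), le_max_left _ _, fun L hL => hb ?_⟩
  rw [Metric.mem_ball, dist_eq_norm, add_sub_cancel_left, Complex.norm_exp]
  have : (L - (max 0 (R - Real.log (ε / 2)) : ℝ)).re ≤ Real.log (ε / 2) := by
    rw [Complex.sub_re, Complex.ofReal_re]
    have := le_max_right 0 (R - Real.log (ε / 2))
    linarith
  calc _ ≤ Real.exp (Real.log (ε/2)) := Real.exp_le_exp.2 this
    _ = ε / 2 := Real.exp_log (by positivity)
    _ < ε := by linarith

/-- punctured convex set -/
abbrev PC (C : Set ℂ) (p : ℂ) := {x : ℂ // x ∈ C ∧ x ≠ p}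

/-- coordinate centred at the puncture -/
def pcf (C : Set ℂ) (p : ℂ) : C(PC C p, ℂ) := ⟨fun x => x.1 - p, by fun_prop⟩

omit hC hCo hp in
lemma pcf_ne (x : PC C p) : pcf C p x ≠ 0 := sub_ne_zero.2 x.2.2

lemma pc_trivial {x₀ : PC C p} (g : Lp x₀) (hg : wnd (pcf C p) pcf_ne g = 0) : g = 1 := by
  obtain ⟨γ, rfl⟩ := cls_surj g
  obtain ⟨L, hL, h⟩ := exists_lift (pcf C p) pcf_ne γ
  rw [wnd_cls _ _ γ L hL h, sub_eq_zero] at hg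
  have hγ : ∀ s, p + Complex.exp (L s) = (γ s).1 := fun s => by rw [h]; simp [pcf]
  obtain ⟨R, hR⟩ : ∃ R, ∀ s, (L s).re ≤ R := by
    obtain ⟨R, hR⟩ := (isCompact_range (f := fun s => (L s).re) (by fun_prop)).bddAbove
    exact ⟨R, fun s => hR ⟨s, rfl⟩⟩
  obtain ⟨N, hN, hd⟩ := exists_depth hCo hp R
  have hmem : ∀ (a : ℂ), p + Complex.exp a ∈ C → p + Complex.exp a ∈ C ∧ p + Complex.exp a ≠ p :=
    fun a h => ⟨h, by simp⟩
  have hst : ∀ s (τ : I), p + Complex.exp (L s - (τ * N : ℝ)) ∈ C := fun s τ =>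
    star_exp hC hp (by rw [hγ]; exact (γ s).2.1) (mul_nonneg τ.2.1 hN)
  let F : I × I → PC C p := fun a => ⟨_, hmem _ (hst a.1 a.2)⟩
  have hF : Continuous F := by
    apply Continuous.subtype_mk
    fun_prop
  have h01 : ∀ τ, F (0, τ) = F (1, τ) := fun τ => Subtype.ext (by simp [F, hg])
  have hF0 : ∀ s, F (s, 0) = γ s := fun s => Subtype.ext (by simp [F, hγ])
  let v : Path x₀ (F (0, 1)) := ⟨⟨fun τ => F (0, τ), by fun_prop⟩, (hF0 0).trans γ.source, rfl⟩
  let γ' : Path (F (0, 1)) (F (0, 1)) := ⟨⟨fun s => F (s, 1), by fun_prop⟩, rfl, (h01 1).symm⟩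
  have e1 := square F hF γ v v γ' hF0 (fun t => (h01 t).symm) (fun t => rfl) (fun t => rfl)
  have e2 : cls γ' = Path.Homotopic.Quotient.refl _ := by
    have hd' : ∀ a : I × I, p + Complex.exp (L a.1 + (a.2 : ℝ) * (L 0 - L a.1) - N) ∈ C := by
      intro a
      apply hd
      have h1 := hR a.1
      have h2 := hR 0
      have h3 := a.2.2.1
      have h4 := a.2.2.2
      simp only [Complex.add_re, Complex.re_ofReal_mul, Complex.sub_re]
      nlinarith
    refine homot (fun a => ⟨_, hmem _ (hd' a)⟩) (by
      apply Continuous.subtype_mk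
      fun_prop) γ' (Path.refl _) ?_ ?_ ?_ ?_
    · intro t; apply Subtype.ext; simp [γ', F]
    · intro t; apply Subtype.ext; simp [F]
    · intro t; apply Subtype.ext; simp [F]
    · intro t; apply Subtype.ext; simp [F, hg]
  rw [e2, t_refl] at e1
  have := t_cancel_right (p := cls v) (q := cls γ) (r := Path.Homotopic.Quotient.refl _) (by rw [e1, refl_t])
  exact this

lemma pc_cyclic {x₀ : PC C p} (a : Lp x₀) (ha : wnd (pcf C p) pcf_ne a = 2 * Real.pi * Complex.I)
    (g : Lp x₀) : ∃ m : ℤ, g = a ^ m := by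
  obtain ⟨m, hm⟩ := wnd_int (pcf C p) pcf_ne g
  refine ⟨m, ?_⟩
  rw [← mul_inv_eq_one]
  apply pc_trivial hC hCo hp
  rw [wnd_mul, wnd_inv, wnd_zpow, ha, hm]
  ring

lemma pc_path (x y : PC C p) : Nonempty (Path x y) := by
  have hx : p + Complex.exp (Complex.log (x.1 - p)) = x.1 := by
    rw [Complex.exp_log (sub_ne_zero.2 x.2.2)]; ring
  have hy : p + Complex.exp (Complex.log (y.1 - p)) = y.1 := by
    rw [Complex.exp_log (sub_ne_zero.2 y.2.2)]; ring
  set L := Complex.log (x.1 - p)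
  set M := Complex.log (y.1 - p)
  obtain ⟨N, hN, hd⟩ := exists_depth hCo hp (max L.re M.re)
  have hmem : ∀ (a : ℂ), p + Complex.exp a ∈ C → p + Complex.exp a ∈ C ∧ p + Complex.exp a ≠ p :=
    fun a h => ⟨h, by simp⟩
  have hdown : ∀ (x : PC C p) (L : ℂ), p + Complex.exp L = x.1 →
      ∀ (h : p + Complex.exp (L - N) ∈ C), Joined x ⟨_, hmem _ h⟩ := by
    intro x L hx h
    refine ⟨⟨⟨fun τ => ⟨p + Complex.exp (L - (τ * N : ℝ)), hmem _ (star_exp hC hp (by rw [hx]; exact x.2.1) (mul_nonneg τ.2.1 hN))⟩,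
      by apply Continuous.subtype_mk; fun_prop⟩, ?_, ?_⟩⟩
    · apply Subtype.ext; simp [hx]
    · apply Subtype.ext; simp
  have j1 := hdown x L hx (hd _ (le_max_left _ _))
  have j2 := hdown y M hy (hd _ (le_max_right _ _))
  have j3 : Joined (⟨_, hmem _ (hd _ (le_max_left L.re M.re))⟩ : PC C p)
      ⟨_, hmem _ (hd _ (le_max_right L.re M.re))⟩ := by
    refine ⟨⟨⟨fun τ => ⟨p + Complex.exp (L + (τ : ℝ) * (M - L) - N), hmem _ (hd _ ?_)⟩,
      by apply Continuous.subtype_mk; fun_prop⟩, ?_, ?_⟩⟩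
    · have h1 := le_max_left L.re M.re
      have h2 := le_max_right L.re M.re
      have h3 := τ.2.1
      have h4 := τ.2.2
      simp only [Complex.add_re, Complex.re_ofReal_mul, Complex.sub_re]
      nlinarith
    · apply Subtype.ext; simp
    · apply Subtype.ext; simp
  exact (j1.trans j3).trans j2.symm

end convex

/-- complement of finitely many points -/
abbrev Fib {K : Type*} (z : K → ℂ) := {x : ℂ // ∀ k, x ≠ z k}

/-- coordinate centred at a puncture -/
def fbf {K : Type*} (z : K → ℂ) (k : K) : C(Fib z, ℂ) := ⟨fun x => x.1 - z k, by fun_prop⟩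

lemma fbf_ne {K : Type*} (z : K → ℂ) (k : K) (x : Fib z) : fbf z k x ≠ 0 := sub_ne_zero.2 (x.2 k)

lemma gen_cells {K : Type*} (z : K → ℂ) (C : K → Set ℂ) (hC : ∀ k, Convex ℝ (C k))
    (hCo : ∀ k, IsOpen (C k)) (hz : ∀ k, z k ∈ C k) (hz' : ∀ k k', k ≠ k' → z k ∉ C k')
    (hcov : ∀ x, ∃ k, x ∈ C k) (x₀ : Fib z) (hx₀ : ∀ k, x₀.1 ∈ C k)
    (a : K → Path x₀ x₀) (haC : ∀ k s, (a k s).1 ∈ C k)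
    (haw : ∀ k, wnd (fbf z k) (fbf_ne z k) (cls (a k)) = 2 * Real.pi * Complex.I) :
    Subgroup.closure (Set.range fun k => (cls (a k) : Lp x₀)) = ⊤ := by
  apply vks (fun k => {x : Fib z | x.1 ∈ C k}) (fun k => (hCo k).preimage continuous_subtype_val)
    (fun x => hcov x.1) x₀ hx₀
  · intro i j x hi hj
    by_cases hij : i = j
    · subst hij
      obtain ⟨γ⟩ := pc_path (hC i) (hCo i) (hz i) ⟨x₀.1, hx₀ i, x₀.2 i⟩ ⟨x.1, hi, x.2 i⟩
      refine ⟨⟨⟨fun s => ⟨(γ s).1, fun k => ?_⟩, by apply Continuous.subtype_mk; fun_prop⟩, ?_, ?_⟩, ?_⟩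
      · by_cases hk : k = i
        · subst hk; exact (γ s).2.2
        · intro h; exact hz' k i hk (h ▸ (γ s).2.1)
      · apply Subtype.ext; simp
      · apply Subtype.ext; simp
      · intro s; exact ⟨(γ s).2.1, (γ s).2.1⟩
    · have hm : ∀ (k) (s : I), x.1 ∈ C k → x₀.1 + (s : ℝ) • (x.1 - x₀.1) ∈ C k := fun k s h =>
        (hC k).add_smul_sub_mem (hx₀ k) h s.2
      refine ⟨⟨⟨fun s => ⟨x₀.1 + (s : ℝ) • (x.1 - x₀.1), fun k => ?_⟩,
        by apply Continuous.subtype_mk; fun_prop⟩, ?_, ?_⟩, ?_⟩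
      · by_cases hk : k = i
        · intro h; exact hz' k j (hk ▸ hij) (h ▸ hm j s hj)
        · intro h; exact hz' k i hk (h ▸ hm i s hi)
      · apply Subtype.ext; simp
      · apply Subtype.ext; simp
      · intro s; exact ⟨hm i s hi, hm j s hj⟩
  · intro k γ hγ
    let ι : C(PC (C k) (z k), Fib z) := ⟨fun y => ⟨y.1, fun k' => by
      by_cases hk : k' = k
      · subst hk; exact y.2.2
      · intro h; exact hz' k' k hk (h ▸ y.2.1)⟩, by apply Continuous.subtype_mk; fun_prop⟩
    let y₀ : PC (C k) (z k) := ⟨x₀.1, hx₀ k, x₀.2 k⟩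
    let res : ∀ γ : Path x₀ x₀, (∀ s, (γ s).1 ∈ C k) → Path y₀ y₀ := fun γ hγ =>
      ⟨⟨fun s => ⟨(γ s).1, hγ s, (γ s).2 k⟩, by apply Continuous.subtype_mk; fun_prop⟩,
        by apply Subtype.ext; simp [y₀], by apply Subtype.ext; simp [y₀]⟩
    have hres : ∀ γ hγ, Lp.map ι (x' := x₀) rfl (cls (res γ hγ)) = cls γ := fun γ hγ => rfl
    have hw : wnd (pcf (C k) (z k)) pcf_ne (cls (res (a k) (haC k))) = 2 * Real.pi * Complex.I := by
      rw [← haw k, ← hres (a k) (haC k), Lp.map_apply]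
      exact (wnd_pm (fbf z k) (fbf_ne z k) ι _ rfl rfl _ _ (fun _ => rfl)).symm
    obtain ⟨m, hm⟩ := pc_cyclic (hC k) (hCo k) (hz k) _ hw (cls (res γ hγ))
    rw [← hres γ hγ, hm, map_zpow, hres (a k) (haC k)]
    exact Subgroup.zpow_mem _ (Subgroup.subset_closure (Set.mem_range_self k)) m

end MF

end

noncomputable section

open scoped unitInterval Topology

namespace MF

section triv
variable {K : Type*} [Fintype K]

/-- a map moving each `c k` to `c k + d k`. -/
def nudge (r : ℝ) (c d : K → ℂ) (x : ℂ) : ℂ :=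
  x + ∑ k, (max 0 (1 - ‖x - c k‖ / r) : ℝ) • d k

lemma nudge_lip {r : ℝ} (hr : 0 < r) (c d : K → ℂ)
    (hd : ∀ k, ‖d k‖ ≤ r / (2 * (Fintype.card K + 1))) : Function.Injective (nudge r c d) := by
  intro x y h
  unfold nudge at h
  have h1 : x - y = ∑ k, ((max 0 (1 - ‖y - c k‖ / r) : ℝ) - (max 0 (1 - ‖x - c k‖ / r) : ℝ)) • d k := by
    simp only [sub_smul, Finset.sum_sub_distrib]
    linear_combination h
  have hb : ∀ k, ‖((max 0 (1 - ‖y - c k‖ / r) : ℝ) - (max 0 (1 - ‖x - c k‖ / r) : ℝ)) • d k‖ ≤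
      ‖x - y‖ / (2 * (Fintype.card K + 1)) := by
    intro k
    rw [norm_smul]
    have e1 : ‖(max 0 (1 - ‖y - c k‖ / r) : ℝ) - (max 0 (1 - ‖x - c k‖ / r) : ℝ)‖ ≤ ‖x - y‖ / r := by
      rw [Real.norm_eq_abs]
      calc _ ≤ |(1 - ‖y - c k‖ / r) - (1 - ‖x - c k‖ / r)| := by
            rw [max_comm 0, max_comm 0]; exact abs_max_sub_max_le_abs _ _ _
        _ = |‖x - c k‖ - ‖y - c k‖| / r := by
          rw [← abs_of_pos hr, ← abs_div, abs_of_pos hr]; congr 1; ring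
        _ ≤ _ := by
          gcongr
          calc _ ≤ ‖(x - c k) - (y - c k)‖ := abs_norm_sub_norm_le _ _
            _ = _ := by congr 1; ring
    calc _ ≤ (‖x - y‖ / r) * (r / (2 * (Fintype.card K + 1))) := by
          gcongr
          exact hd k
      _ = _ := by field_simp
  have h2 : ‖x - y‖ ≤ ∑ _k : K, ‖x - y‖ / (2 * (Fintype.card K + 1)) := by
    conv_lhs => rw [h1]
    exact norm_sum_le_of_le _ (fun k _ => hb k)
  rw [Finset.sum_const, Finset.card_univ, nsmul_eq_mul] at h2
  have h3 : (Fintype.card K : ℝ) * (‖x - y‖ / (2 * (Fintype.card K + 1))) ≤ ‖x - y‖ / 2 := by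
    rw [← mul_div_assoc, div_le_div_iff₀ (by positivity) (by positivity)]
    nlinarith [norm_nonneg (x - y)]
  have h4 : ‖x - y‖ = 0 := le_antisymm (by linarith) (norm_nonneg _)
  exact sub_eq_zero.1 (norm_eq_zero.1 h4)

lemma nudge_pt {r : ℝ} (hr : 0 < r) (c d : K → ℂ) (hc : ∀ k k', k ≠ k' → r ≤ ‖c k - c k'‖) (k : K) :
    nudge r c d (c k) = c k + d k := by
  unfold nudge
  rw [Finset.sum_eq_single k]
  · simp
  · intro k' _ hk
    have : (max 0 (1 - ‖c k - c k'‖ / r) : ℝ) = 0 := by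
      apply max_eq_left
      have := hc k k' hk.symm
      rw [sub_nonpos, le_div_iff₀ hr]; linarith
    rw [this, zero_smul]
  · simp

variable {X : Type*} [PseudoMetricSpace X] [CompactSpace X]

lemma sep_pos (z : X → K → ℂ) (hz : Continuous z) (hinj : ∀ a, Function.Injective (z a)) :
    ∃ r : ℝ, 0 < r ∧ ∀ a k k', k ≠ k' → r ≤ ‖z a k - z a k'‖ := by
  have h : ∀ kk : K × K, ∀ᶠ r : ℝ in 𝓝[>] 0, kk.1 ≠ kk.2 → ∀ a, r ≤ ‖z a kk.1 - z a kk.2‖ := by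
    rintro ⟨k, k'⟩
    by_cases hk : k = k'
    · exact Filter.Eventually.of_forall (fun r h => absurd hk h)
    · rcases isEmpty_or_nonempty X with he | hne
      · exact Filter.Eventually.of_forall (fun r h a => (he.false a).elim)
      · obtain ⟨a0, -, ha0⟩ := isCompact_univ.exists_isMinOn (s := (Set.univ : Set X)) Set.univ_nonempty
          (f := fun a => ‖z a k - z a k'‖) (by fun_prop)
        have hpos : 0 < ‖z a0 k - z a0 k'‖ := norm_pos_iff.2 (sub_ne_zero.2 (fun h => hk (hinj a0 h)))
        filter_upwards [Ioo_mem_nhdsGT hpos] with r hr _ a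
        exact hr.2.le.trans (ha0 (Set.mem_univ a))
  have := (Filter.eventually_all.2 h).and self_mem_nhdsWithin
  obtain ⟨r, hr, hr0⟩ := this.exists
  exact ⟨r, hr0, fun a k k' hk => hr (k, k') hk a⟩

lemma triv (z : I × X → K → ℂ) (hz : Continuous z) (hinj : ∀ a, Function.Injective (z a)) :
    ∃ r : X → ℂ → ℂ, Continuous (fun p : X × ℂ => r p.1 p.2) ∧ (∀ o, Function.Injective (r o)) ∧
      (∀ o k, r o (z (1, o) k) = z (0, o) k) ∧
      (∀ o, (∀ τ, z (τ, o) = z (0, o)) → ∀ x, r o x = x) := by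
  obtain ⟨r, hr, hsep⟩ := sep_pos z hz hinj
  have huc := CompactSpace.uniformContinuous_of_continuous hz
  obtain ⟨δ, hδ, hη⟩ := Metric.uniformContinuous_iff.1 huc (r / (2 * (Fintype.card K + 1))) (by positivity)
  obtain ⟨N, hN⟩ := exists_nat_one_div_lt hδ
  let tm : ℕ → I := fun m => Set.projIcc 0 1 zero_le_one ((m : ℝ) / (N + 1))
  have htm0 : tm 0 = 0 := by simp [tm]
  have htm1 : tm (N + 1) = 1 := by
    have : ((N + 1 : ℕ) : ℝ) / (N + 1) = 1 := by push_cast; field_simp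
    simp only [tm, this]; simp
  have hstep : ∀ m o k, ‖z (tm m, o) k - z (tm (m + 1), o) k‖ ≤ r / (2 * (Fintype.card K + 1)) := by
    intro m o k
    have h1 : dist (tm m) (tm (m + 1)) < δ := by
      refine lt_of_le_of_lt ?_ hN
      have := LipschitzWith.projIcc (zero_le_one' ℝ) |>.dist_le_mul ((m : ℝ) / (N + 1)) (((m + 1 : ℕ) : ℝ) / (N + 1))
      refine this.trans ?_
      rw [Real.dist_eq, ← sub_div]
      push_cast
      simp [abs_div]
      rw [abs_of_pos (by positivity)]
    have h2 : dist (tm m, o) (tm (m + 1), o) < δ := by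
      rw [Prod.dist_eq]; simpa using h1
    have h3 := (dist_le_pi_dist _ _ k).trans (hη h2).le
    rwa [dist_eq_norm] at h3
  have key : ∀ m, ∃ R : X → ℂ → ℂ, Continuous (fun p : X × ℂ => R p.1 p.2) ∧ (∀ o, Function.Injective (R o)) ∧
      (∀ o k, R o (z (tm m, o) k) = z (0, o) k) ∧
      (∀ o, (∀ τ, z (τ, o) = z (0, o)) → ∀ x, R o x = x) := by
    intro m
    induction m with
    | zero =>
      exact ⟨fun _ x => x, by fun_prop, fun o => Function.injective_id, fun o k => by rw [htm0], fun o _ x => rfl⟩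
    | succ m ih =>
      obtain ⟨R, hRc, hRi, hRz, hRid⟩ := ih
      refine ⟨fun o x => R o (nudge r (z (tm (m + 1), o)) (z (tm m, o) - z (tm (m + 1), o)) x), ?_, ?_, ?_, ?_⟩
      · have : Continuous (fun p : X × ℂ => nudge r (z (tm (m + 1), p.1)) (z (tm m, p.1) - z (tm (m + 1), p.1)) p.2) := by
          unfold nudge
          simp only [Pi.sub_apply]
          fun_prop
        exact hRc.comp (continuous_fst.prodMk this)
      · intro o
        exact (hRi o).comp (nudge_lip hr _ _ (fun k => hstep m o k))
      · intro o k
        simp only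
        rw [nudge_pt hr _ _ (hsep _)]
        simp [hRz]
      · intro o h x
        simp only [h, sub_self]
        rw [hRid o h]
        simp [nudge]
  obtain ⟨R, h1, h2, h3, h4⟩ := key (N + 1)
  rw [htm1] at h3
  exact ⟨R, h1, h2, h3, h4⟩
end triv

section tot
variable {B K : Type*} [TopologicalSpace B]

/-- total space of a family of punctured lines -/
abbrev Tot (z : B → K → ℂ) := {p : B × ℂ // ∀ k, p.2 ≠ z p.1 k}

/-- inclusion of a fibre -/
def inc (z : B → K → ℂ) (b : B) : C(Fib (z b), Tot z) :=
  ⟨fun x => ⟨(b, x.1), x.2⟩, by apply Continuous.subtype_mk; fun_prop⟩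

/-- projection -/
def prj (z : B → K → ℂ) : C(Tot z, B) := ⟨fun x => x.1.1, by fun_prop⟩

/-- a section of the family -/
structure Sect (z : B → K → ℂ) where
  S : C(B, ℂ)
  ne : ∀ b k, S b ≠ z b k

namespace Sect
variable {z : B → K → ℂ} (S : Sect z)
/-- the point of the fibre -/
def pt (b : B) : Fib (z b) := ⟨S.S b, S.ne b⟩
/-- the section as a map -/
def map : C(B, Tot z) := ⟨fun b => ⟨(b, S.S b), S.ne b⟩, by apply Continuous.subtype_mk; fun_prop⟩
/-- image of a path under the section -/
def im {b b' : B} (q : PQ b b') : PQ (S.map b) (S.map b') := pm S.map q rfl rfl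
/-- image of a loop of a fibre -/
def fi (b : B) : Lp (S.pt b) →* Lp (S.map b) := Lp.map (inc z b) rfl
/-- projection of a path -/
def pr {b b' : B} (q : PQ (S.map b) (S.map b')) : PQ b b' := pm (prj z) q rfl rfl

lemma im_trans {b b' b'' : B} (q : PQ b b') (q' : PQ b' b'') : S.im (q ⬝ q') = S.im q ⬝ S.im q' :=
  pm_trans _ _ _ _ _ _
lemma im_symm {b b' : B} (q : PQ b b') : S.im q.symm = (S.im q).symm := pm_symm _ _ _ _
lemma pr_trans {b b' b'' : B} (q : PQ (S.map b) (S.map b')) (q' : PQ (S.map b') (S.map b'')) :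
    S.pr (q ⬝ q') = S.pr q ⬝ S.pr q' :=
  pm_trans _ _ _ _ _ _
lemma pr_im {b b' : B} (q : PQ b b') : S.pr (S.im q) = q := by
  obtain ⟨γ, rfl⟩ := cls_surj q
  rfl
lemma pr_fi {b : B} (g : Lp (S.pt b)) : S.pr (S.fi b g) = Path.Homotopic.Quotient.refl b := by
  obtain ⟨γ, rfl⟩ := cls_surj g
  rfl
end Sect

variable [Fintype K] {X : Type*} [PseudoMetricSpace X] [CompactSpace X]
variable {z : B → K → ℂ} (hz : Continuous z) (hinj : ∀ b, Function.Injective (z b)) (S : Sect z)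
include hz hinj

lemma triv2 (β : I × X → B) (hβ : Continuous β) :
    ∃ r : X → ℂ → ℂ, Continuous (fun p : X × ℂ => r p.1 p.2) ∧
      (∀ o x, (∀ k, x ≠ z (β (1, o)) k) → ∀ k, r o x ≠ z (β (0, o)) k) ∧
      (∀ o, r o (S.S (β (1, o))) = S.S (β (0, o))) ∧
      (∀ o, (∀ τ, β (τ, o) = β (0, o)) → ∀ x, r o x = x) := by
  obtain ⟨r, h1, h2, h3, h4⟩ := triv (K := Option K) (X := X)
    (fun a o => o.elim (S.S (β a)) (z (β a))) (by
      apply continuous_pi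
      rintro (_ | k)
      · simp only [Option.elim]; fun_prop
      · simp only [Option.elim]; fun_prop) (by
      rintro a (_ | k) (_ | k') h
      · rfl
      · exact absurd h (S.ne _ _)
      · exact absurd h.symm (S.ne _ _)
      · exact congrArg _ (hinj _ h))
  refine ⟨r, h1, ?_, fun o => h3 o none, ?_⟩
  · intro o x hx k h
    rw [show z (β (0, o)) k = r o (z (β (1, o)) k) from (h3 o (some k)).symm] at h
    exact hx k (h2 o h)
  · intro o h x
    exact h4 o (fun τ => by simp only [h]) x

lemma decomp {b0 b1 : B} (q : PQ (S.map b0) (S.map b1)) :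
    ∃ g : Lp (S.pt b0), q = Path.Homotopic.Quotient.trans (S.fi b0 g) (S.im (S.pr q)) := by
  obtain ⟨e, rfl⟩ := cls_surj q
  let b : I → B := fun s => (e s).1.1
  have hb : Continuous b := by fun_prop
  have hb0 : b 0 = b0 := by simp [b]; rfl
  have hb1 : b 1 = b1 := by simp [b]; rfl
  have hx0 : (e 0).1.2 = S.S b0 := by simp; rfl
  have hx1 : (e 1).1.2 = S.S b1 := by simp; rfl
  let u : I × (I × I) → I := fun a => Set.projIcc 0 1 zero_le_one
    ((1 - (a.1 : ℝ)) * (a.2.2 * a.2.1) + a.1 * a.2.1)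
  have hu : Continuous u := by
    apply continuous_projIcc.comp; fun_prop
  have hu1 : ∀ o, u (1, o) = o.1 := fun o => by simp [u, Set.projIcc_val]
  have hu0 : ∀ o : I × I, u (0, o) = o.2 * o.1 := fun o => by
    simp only [u, ← Set.Icc.coe_mul, Set.Icc.coe_zero, zero_mul, add_zero, sub_zero, one_mul, Set.projIcc_val]
  have hus : ∀ a τ, u (a, (0, τ)) = 0 := fun a τ => by simp [u]
  have hut : ∀ a s, u (a, (s, 1)) = s := fun a s => by
    simp only [u, Set.Icc.coe_one, one_mul]
    rw [show (1 - (a : ℝ)) * s + a * s = s by ring, Set.projIcc_val]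
  obtain ⟨r, h1, h2, h3, h4⟩ := triv2 hz hinj S (fun a => b (u a)) (by fun_prop)
  have hne : ∀ o : I × I, ∀ k, r o (e o.1).1.2 ≠ z (b (u (0, o))) k := fun o =>
    h2 o _ (by rw [hu1]; exact (e o.1).2)
  let H : I × I → Tot z := fun o => ⟨(b (u (0, o)), r o (e o.1).1.2), hne o⟩
  have hH : Continuous H := by
    apply Continuous.subtype_mk
    exact (hb.comp (hu.comp (by fun_prop))).prodMk (h1.comp (continuous_id.prodMk (by fun_prop)))
  have hub0 : ∀ s, b (u (0, (s, 0))) = b0 := fun s => by rw [hu0]; simp [hb0]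
  let g : Path (S.pt b0) (S.pt b0) :=
    ⟨⟨fun s => ⟨r (s, 0) (e s).1.2, by have := hne (s, 0); rwa [hub0] at this⟩, by
      apply Continuous.subtype_mk
      exact h1.comp (g := fun p : (I × I) × ℂ => r p.1 p.2) (f := fun s : I => ((s, 0), (e s).1.2)) (by fun_prop)⟩, by
      apply Subtype.ext
      change r (0, 0) (e 0).1.2 = S.S b0
      rw [h4 _ (fun τ => by rw [hus, hus]), hx0], by
      apply Subtype.ext
      change r (1, 0) (e 1).1.2 = S.S b0
      have := h3 (1, 0)
      simp only [hu1, hub0] at this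
      rw [← this, hx1, hb1]⟩
  refine ⟨cls g, ?_⟩
  have := square H hH ((g.map (inc z b0).continuous).cast rfl rfl)
    (((e.map (prj z).continuous).map S.map.continuous).cast rfl rfl) (Path.refl _) e ?_ ?_ ?_ ?_
  · rw [cls_refl, refl_t] at this
    exact this.symm
  · intro t
    apply Subtype.ext
    apply Prod.ext
    · exact hub0 t
    · rfl
  · intro t
    have h5 := h3 (1, t)
    simp only [hu1, hu0, hb1, mul_one] at h5
    apply Subtype.ext
    apply Prod.ext
    · change b (u (0, (1, t))) = b t
      rw [hu0]; simp
    · change r (1, t) (e 1).1.2 = S.S (b t)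
      rw [hx1, h5]
  · intro t
    apply Subtype.ext
    apply Prod.ext
    · change b (u (0, (0, t))) = b0
      rw [hus, hb0]
    · change r (0, t) (e 0).1.2 = S.S b0
      rw [h4 _ (fun τ => by rw [hus, hus]), hx0]
  · intro t
    apply Subtype.ext
    apply Prod.ext
    · change b (u (0, (t, 1))) = b t
      rw [hut]
    · change r (t, 1) (e t).1.2 = (e t).1.2
      rw [h4 _ (fun τ => by rw [hut, hut])]

lemma fi_inj (b0 : B) : Function.Injective (S.fi b0) := by
  intro g g' hgg
  obtain ⟨γ, rfl⟩ := cls_surj g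
  obtain ⟨γ', rfl⟩ := cls_surj g'
  have hgg' : Path.Homotopic ((γ.map (inc z b0).continuous).cast rfl rfl) ((γ'.map (inc z b0).continuous).cast rfl rfl) :=
    Path.Homotopic.Quotient.eq.1 hgg
  obtain ⟨H⟩ := hgg'
  let h : I × I → B := fun o => (H (o.2, o.1)).1.1
  have hh : Continuous h := by fun_prop
  let x : I × I → ℂ := fun o => (H (o.2, o.1)).1.2
  have hx : Continuous x := by fun_prop
  have hH0 : ∀ s, H (0, s) = inc z b0 (γ s) := fun s => H.apply_zero s
  have hH1 : ∀ s, H (1, s) = inc z b0 (γ' s) := fun s => H.apply_one s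
  have hHs0 : ∀ t, H (t, 0) = inc z b0 (S.pt b0) := fun s => H.source s
  have hHs1 : ∀ t, H (t, 1) = inc z b0 (S.pt b0) := fun s => H.target s
  have e0 : ∀ s, h (s, 0) = b0 := fun s => by simp only [h, hH0]; rfl
  have e1 : ∀ s, h (s, 1) = b0 := fun s => by simp only [h, hH1]; rfl
  have es0 : ∀ s, h (0, s) = b0 := fun s => by simp only [h, hHs0]; rfl
  have es1 : ∀ s, h (1, s) = b0 := fun s => by simp only [h, hHs1]; rfl
  have x0 : ∀ s, x (s, 0) = (γ s).1 := fun s => by simp only [x, hH0]; rfl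
  have x1 : ∀ s, x (s, 1) = (γ' s).1 := fun s => by simp only [x, hH1]; rfl
  have xs0 : ∀ s, x (0, s) = S.S b0 := fun s => by simp only [x, hHs0]; rfl
  have xs1 : ∀ s, x (1, s) = S.S b0 := fun s => by simp only [x, hHs1]; rfl
  obtain ⟨r, h1, h2, h3, h4⟩ := triv2 hz hinj S (X := I × I) (fun a => h (a.2.1, a.1 * a.2.2)) (by fun_prop)
  simp only [one_mul, zero_mul, e0] at h2 h3 h4
  have hr : ∀ o : I × I, ∀ k, r o (x o) ≠ z b0 k := fun o => h2 o _ (H (o.2, o.1)).2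
  have hr' : ∀ o : I × I, ∀ k, r (o.2 * o.1, 1) (γ' o.1).1 ≠ z b0 k := fun o =>
    h2 _ _ (by simp only [e1]; exact (γ' o.1).2)
  let m : Path (S.pt b0) (S.pt b0) := ⟨⟨fun s => ⟨r (s, 1) (γ' s).1, by simpa using hr' (s, 1)⟩, by
    apply Continuous.subtype_mk
    exact h1.comp (g := fun p : (I × I) × ℂ => r p.1 p.2) (f := fun s : I => ((s, 1), (γ' s).1)) (by fun_prop)⟩, by
      apply Subtype.ext
      change r (0, 1) (γ' 0).1 = S.S b0
      rw [h4 _ (fun τ => by simp [es0])]; simp; rfl, by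
      apply Subtype.ext
      change r (1, 1) (γ' 1).1 = S.S b0
      rw [h4 _ (fun τ => by simp [es1])]; simp; rfl⟩
  have a1 : cls γ = cls m := by
    refine homot (fun o => ⟨r o (x o), hr o⟩) ?_ _ _ ?_ ?_ ?_ ?_
    · apply Continuous.subtype_mk
      exact h1.comp (continuous_id.prodMk hx)
    · intro t
      apply Subtype.ext
      change r (t, 0) (x (t, 0)) = _
      rw [h4 _ (fun τ => by simp [e0]), x0]
    · intro t
      apply Subtype.ext
      change r (t, 1) (x (t, 1)) = r (t, 1) (γ' t).1
      rw [x1]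
    · intro t
      apply Subtype.ext
      change r (0, t) (x (0, t)) = S.S b0
      rw [h4 _ (fun τ => by simp [es0]), xs0]
    · intro t
      apply Subtype.ext
      change r (1, t) (x (1, t)) = S.S b0
      rw [h4 _ (fun τ => by simp [es1]), xs1]
  have a2 : cls γ' = cls m := by
    refine homot (fun o => ⟨r (o.2 * o.1, 1) (γ' o.1).1, hr' o⟩) ?_ _ _ ?_ ?_ ?_ ?_
    · apply Continuous.subtype_mk
      exact h1.comp (g := fun p : (I × I) × ℂ => r p.1 p.2) (f := fun o : I × I => ((o.2 * o.1, 1), (γ' o.1).1)) (by fun_prop)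
    · intro t
      apply Subtype.ext
      change r (0 * t, 1) (γ' t).1 = _
      rw [zero_mul, h4 _ (fun τ => by simp [es0])]
    · intro t
      apply Subtype.ext
      change r (1 * t, 1) (γ' t).1 = r (t, 1) (γ' t).1
      rw [one_mul]
    · intro t
      apply Subtype.ext
      change r (t * 0, 1) (γ' 0).1 = S.S b0
      rw [mul_zero, h4 _ (fun τ => by simp [es0])]; simp; rfl
    · intro t
      apply Subtype.ext
      change r (t * 1, 1) (γ' 1).1 = S.S b0
      have := h3 (t, 1)
      rw [e1] at this
      rw [mul_one]
      convert this using 2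
      simp; rfl
  rw [a1, a2]

end tot

end MF

end

noncomputable section

open scoped unitInterval Topology

namespace MF

lemma drag {B K : Type*} [TopologicalSpace B] [Fintype K] {z : B → K → ℂ} (hz : Continuous z)
    (hinj : ∀ b, Function.Injective (z b)) (S : Sect z) {b b' : B} (δ : PQ b b') (g : Lp (S.pt b')) :
    ∃ g' : Lp (S.pt b), S.im δ ⬝ S.fi b' g ⬝ (S.im δ).symm = S.fi b g' := by
  obtain ⟨g', h⟩ := decomp hz hinj S (S.im δ ⬝ S.fi b' g ⬝ (S.im δ).symm)
  refine ⟨g', ?_⟩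
  rw [h]
  have : S.pr (S.im δ ⬝ S.fi b' g ⬝ (S.im δ).symm) = Path.Homotopic.Quotient.refl b := by
    rw [S.pr_trans, S.pr_trans, ← S.im_symm, S.pr_im, S.pr_im, S.pr_fi, t_refl, t_symm]
  rw [this]
  have h2 : S.im (Path.Homotopic.Quotient.refl b) = Path.Homotopic.Quotient.refl _ := pm_refl _ _
  rw [h2, t_refl]

lemma pm_conj {X Y : Type*} [TopologicalSpace X] [TopologicalSpace Y] (f : C(X, Y)) {x y : X} {x' y' : Y}
    (p : PQ x y) (q : Lp y) (hx : x' = f x) (hy : y' = f y) :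
    pm f (p ⬝ q ⬝ p.symm) hx hx = pm f p hx hy ⬝ pm f q hy hy ⬝ (pm f p hx hy).symm := by
  rw [pm_trans f _ _ hx hy hx, pm_trans f _ _ hx hy hy, pm_symm]

lemma triv_aux {X : Type*} [TopologicalSpace X] {x : X} (q a b : PQ x x)
    (ha : a = Path.Homotopic.Quotient.refl x) (hb : b = Path.Homotopic.Quotient.refl x) :
    q ⬝ a.symm ⬝ b.symm = q := by
  subst ha hb; simp

/-- the fibre point of a point of the total space -/
def fp {B K : Type*} [TopologicalSpace B] {z : B → K → ℂ} (a : Tot z) : Fib (z a.1.1) := ⟨a.1.2, a.2⟩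

lemma fib_path {K : Type*} [Finite K] (z : K → ℂ) (x y : Fib z) : Nonempty (Path x y) := by
  have h : (Set.range z).Countable := (Set.finite_range z).countable
  have h2 := h.isPathConnected_compl_of_one_lt_rank (E := ℂ) (by simp [Complex.rank_real_complex])
  have hm : ∀ x : Fib z, x.1 ∈ (Set.range z)ᶜ := by
    rintro x ⟨k, hk⟩; exact x.2 k hk.symm
  obtain ⟨γ, hγ⟩ := h2.joinedIn _ (hm x) _ (hm y)
  refine ⟨⟨⟨fun s => ⟨γ s, fun k hk => hγ s ⟨k, hk.symm⟩⟩, by apply Continuous.subtype_mk; fun_prop⟩, ?_, ?_⟩⟩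
  · apply Subtype.ext; simp
  · apply Subtype.ext; simp

lemma Sect.map_eq {B K : Type*} [TopologicalSpace B] {z : B → K → ℂ} (S : Sect z) (b : B) :
    S.map b = inc z b (S.pt b) := rfl
lemma fp_eq {B K : Type*} [TopologicalSpace B] {z : B → K → ℂ} (a : Tot z) : a = inc z a.1.1 (fp a) := rfl

/-- a path inside a fibre starting at the section -/
def Sect.tl {B K : Type*} [TopologicalSpace B] {z : B → K → ℂ} (S : Sect z) (a : Tot z)
    (c : PQ (S.pt a.1.1) (fp a)) : PQ (S.map a.1.1) a :=
  pm (inc z a.1.1) c (S.map_eq _) (fp_eq a)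

lemma Sect.tl_symm {B K : Type*} [TopologicalSpace B] {z : B → K → ℂ} (S : Sect z) (a : Tot z)
    (c c' : PQ (S.pt a.1.1) (fp a)) : S.fi a.1.1 (c ⬝ c'.symm) = S.tl a c ⬝ (S.tl a c').symm := by
  unfold Sect.tl
  rw [← pm_symm]
  exact pm_trans _ _ _ _ _ _

lemma Sect.im_refl {B K : Type*} [TopologicalSpace B] {z : B → K → ℂ} (S : Sect z) (b : B) :
    S.im (Path.Homotopic.Quotient.refl b) = Path.Homotopic.Quotient.refl (S.map b) := pm_refl _ _

/-- projection of a general path -/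
def prt {B K : Type*} [TopologicalSpace B] {z : B → K → ℂ} {a a' : Tot z} (q : PQ a a') : PQ a.1.1 a'.1.1 :=
  pm (prj z) q rfl rfl

section Z
variable {K : Type*} [Fintype K] {z : ℂ → K → ℂ} (S : Sect z)

/-- pushing a path to nearby fibres -/
def psh (S : Sect z) {t1 : ℂ} {x1 : Fib (z t1)} (c : Path (S.pt t1) x1) (a : ℂ × ℂ) (s : I) : ℂ :=
  (c s).1 + (1 - s : ℝ) * (S.S a.1 - S.S t1) + (s : ℝ) * (a.2 - x1.1)

lemma psh_cont {t1 : ℂ} {x1 : Fib (z t1)} (c : Path (S.pt t1) x1) :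
    Continuous (fun p : (ℂ × ℂ) × I => psh S c p.1 p.2) := by
  unfold psh; fun_prop

lemma psh_nhds (hz : Continuous z) {t1 : ℂ} {x1 : Fib (z t1)} (c : Path (S.pt t1) x1) :
    ∃ U : Set (ℂ × ℂ), IsOpen U ∧ (t1, x1.1) ∈ U ∧ ∀ a ∈ U, ∀ s k, psh S c a s ≠ z a.1 k := by
  let N : Set ((ℂ × ℂ) × I) := {p | ∀ k, psh S c p.1 p.2 ≠ z p.1.1 k}
  have hN : IsOpen N := by
    rw [show N = ⋂ k, {p | psh S c p.1 p.2 ≠ z p.1.1 k} by ext; simp [N]]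
    refine isOpen_iInter_of_finite (fun k => isOpen_ne_fun (psh_cont S c) (by fun_prop))
  obtain ⟨u, v, hu, hv, hau, hsv, huv⟩ := generalized_tube_lemma (s := {((t1, x1.1) : ℂ × ℂ)}) isCompact_singleton (t := (Set.univ : Set I))
    isCompact_univ hN (by
      rintro ⟨a, s⟩ ⟨ha, -⟩ k
      simp only [Set.mem_singleton_iff] at ha
      subst ha
      simpa [psh] using (c s).2 k)
  exact ⟨u, hu, hau rfl, fun a ha s k => huv (a := (a, s)) ⟨ha, hsv (Set.mem_univ s)⟩ k⟩

/-- the pushed path -/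
def pshP {t1 : ℂ} {x1 : Fib (z t1)} (c : Path (S.pt t1) x1) (a : Tot z)
    (h : ∀ s k, psh S c a.1 s ≠ z a.1.1 k) : Path (S.pt a.1.1) (fp a) :=
  ⟨⟨fun s => ⟨psh S c a.1 s, h s⟩, by
    apply Continuous.subtype_mk
    exact (psh_cont S c).comp (f := fun s => (a.1, s)) (by fun_prop)⟩, by
    have hc : (c 0).1 = S.S t1 := congrArg Subtype.val c.source
    apply Subtype.ext
    change psh S c a.1 0 = S.S a.1.1
    unfold psh
    rw [hc]; simp, by apply Subtype.ext; simp [psh, fp]⟩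

lemma psh_square {t1 : ℂ} {x1 : Fib (z t1)} (c : Path (S.pt t1) x1) {a a' : Tot z} (δ : Path a a')
    (hδ : ∀ τ s k, psh S c (δ τ).1 s ≠ z (δ τ).1.1 k)
    (h : ∀ s k, psh S c a.1 s ≠ z a.1.1 k) (h' : ∀ s k, psh S c a'.1 s ≠ z a'.1.1 k) :
    S.tl a (cls (pshP S c a h)) ⬝ cls δ =
    S.im (prt (cls δ)) ⬝ S.tl a' (cls (pshP S c a' h')) := by
  refine square (fun o => ⟨((δ o.2).1.1, psh S c (δ o.2).1 o.1), hδ o.2 o.1⟩) ?_ _ _ _ _ ?_ ?_ ?_ ?_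
  · apply Continuous.subtype_mk
    refine Continuous.prodMk (by fun_prop) ?_
    exact (psh_cont S c).comp (f := fun o : I × I => ((δ o.2).1, o.1)) (by fun_prop)
  · intro t
    simp only [Path.source]
    rfl
  · intro t
    apply Subtype.ext
    apply Prod.ext
    · rfl
    · simp [psh]
  · intro t
    apply Subtype.ext
    apply Prod.ext
    · rfl
    · have hc : (c 0).1 = S.S t1 := congrArg Subtype.val c.source
      change psh S c (δ t).1 0 = S.S (δ t).1.1
      unfold psh
      rw [hc]; simp
  · intro t
    simp only [Path.target]
    rfl

lemma Zsurj (hz : Continuous z) (hbad : {t | ¬ Function.Injective (z t)}.Countable) (t0 : ℂ)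
    (ht0 : Function.Injective (z t0)) : Function.Surjective (S.fi t0) := by
  set H := (S.fi t0).range with hH
  obtain ⟨p, -⟩ : ∃ _p : (∀ t, PQ t0 t), True := ⟨fun t => cls (PathConnectedSpace.somePath t0 t), trivial⟩
  have hsub : ∀ {t t' : ℂ} (q q' : PQ t t'), q = q' := fun q q' => Subsingleton.elim q q'
  have hrank : 1 < Module.rank ℝ ℂ := by simp [Complex.rank_real_complex]
  -- good fibres
  have good : ∀ t, Function.Injective (z t) → ∀ g : Lp (S.pt t),
      (S.im (p t) ⬝ S.fi t g ⬝ (S.im (p t)).symm : Lp (S.map t0)) ∈ H := by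
    intro t ht g
    have h2 := hbad.isPathConnected_compl_of_one_lt_rank hrank
    obtain ⟨γ, hγ⟩ := h2.joinedIn t0 (by simpa using ht0) t (by simpa using ht)
    let zG : {t : ℂ // Function.Injective (z t)} → K → ℂ := fun t => z t.1
    let SG : Sect zG := ⟨⟨fun t => S.S t.1, by fun_prop⟩, fun b => S.ne b.1⟩
    let j : C(Tot zG, Tot z) := ⟨fun x => ⟨(x.1.1.1, x.1.2), x.2⟩, by
      apply Continuous.subtype_mk; fun_prop⟩
    let v : C({t : ℂ // Function.Injective (z t)}, ℂ) := ⟨fun t => t.1, by fun_prop⟩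
    let γG : Path (⟨t0, ht0⟩ : {t : ℂ // Function.Injective (z t)}) ⟨t, ht⟩ := ⟨⟨fun s => ⟨γ s, by simpa using hγ s⟩, by
      apply Continuous.subtype_mk; fun_prop⟩, by apply Subtype.ext; simp, by apply Subtype.ext; simp⟩
    obtain ⟨g', hg'⟩ := drag (z := zG) (by fun_prop) (fun b => b.2) SG (cls γG) g
    have h3 : Lp.map j (x := SG.map ⟨t0, ht0⟩) (x' := S.map t0) rfl (SG.im (cls γG) ⬝ SG.fi ⟨t, ht⟩ g ⬝ (SG.im (cls γG)).symm : Lp _) =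
      (S.im (p t) ⬝ S.fi t g ⬝ (S.im (p t)).symm : Lp (S.map t0)) := by
      rw [hsub (p t) (cls γ)]
      obtain ⟨g, rfl⟩ := cls_surj g
      exact pm_conj j (x := SG.map ⟨t0, ht0⟩) (y := SG.map ⟨t, ht⟩) (x' := S.map t0) (y' := S.map t) (SG.im (cls γG)) (SG.fi ⟨t, ht⟩ (cls g)) rfl rfl
    rw [← h3, hg']
    refine ⟨g', ?_⟩
    obtain ⟨g', rfl⟩ := cls_surj g'
    rfl
  have all : ∀ t, ∀ g : Lp (S.pt t),
      (S.im (p t) ⬝ S.fi t g ⬝ (S.im (p t)).symm : Lp (S.map t0)) ∈ H := by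
    intro t g
    obtain ⟨γ, rfl⟩ := cls_surj g
    obtain ⟨U, hU, htU, hne⟩ := psh_nhds S hz γ
    have hV : IsOpen {t : ℂ | (t, S.S t) ∈ U} := hU.preimage (by fun_prop)
    obtain ⟨ε, hε, hb⟩ := Metric.isOpen_iff.1 hV t htU
    obtain ⟨t', ht', hb'⟩ := (hbad.dense_compl ℝ).exists_mem_open Metric.isOpen_ball ⟨t, Metric.mem_ball_self hε⟩
    have hseg : ∀ s : I, t + (s : ℝ) • (t' - t) ∈ Metric.ball t ε := fun s =>
      (convex_ball t ε).add_smul_sub_mem (Metric.mem_ball_self hε) hb' s.2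
    let δ : Path t t' := ⟨⟨fun s => t + (s : ℝ) • (t' - t), by fun_prop⟩, by simp, by simp⟩
    have h0 : ∀ s k, psh S γ (S.map t).1 s ≠ z (S.map t).1.1 k := hne _ htU
    have hsq := psh_square S γ (a := S.map t) (a' := S.map t') (δ.map S.map.continuous)
      (fun τ s k => hne _ (hb (hseg τ)) s k) h0 (hne _ (hb hb'))
    have e1 : cls (pshP S γ (S.map t) h0) = cls γ := by
      congr 1
      ext s
      change (psh S γ (S.map t).1 s) = (γ s).1
      simp [psh, Sect.map, Sect.pt]
    rw [e1] at hsq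
    have e2 := good t' (by simpa using ht') (cls (pshP S γ (S.map t') (hne _ (hb hb'))))
    rw [hsub (p t') (p t ⬝ cls δ), S.im_trans] at e2
    have hsq' : S.fi t (cls γ) ⬝ S.im (cls δ) = S.im (cls δ) ⬝ S.fi t' (cls (pshP S γ (S.map t') (hne _ (hb hb')))) := hsq
    convert e2 using 1
    simp only [symm_trans', t_assoc]
    rw [← t_assoc (S.im (cls δ)) (S.fi t' _), ← hsq']
    simp [t_assoc]
  let C : ∀ a : Tot z, Set (PQ (S.map t0) a) := fun a => {q | ∃ c : PQ (S.pt a.1.1) (fp a),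
    (q ⬝ (S.tl a c).symm ⬝ (S.im (p a.1.1)).symm : Lp (S.map t0)) ∈ H}
  have hC : ∀ a q, q ∈ C a → ∀ c : PQ (S.pt a.1.1) (fp a),
    (q ⬝ (S.tl a c).symm ⬝ (S.im (p a.1.1)).symm : Lp (S.map t0)) ∈ H := by
    rintro a q ⟨c, hc⟩ c'
    have h1 := all a.1.1 (c ⬝ c'.symm)
    have h2 := H.mul_mem hc h1
    rw [Lp.mul_def] at h2
    have h3 := S.tl_symm a c c'
    rw [h3] at h2
    simpa [t_assoc] using h2
  have htl : S.tl (S.map t0) (Path.Homotopic.Quotient.refl (S.pt t0)) = Path.Homotopic.Quotient.refl (S.map t0) :=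
    pm_refl _ _
  have hpp : S.im (p t0) = Path.Homotopic.Quotient.refl (S.map t0) := by
    rw [hsub (p t0) (Path.Homotopic.Quotient.refl t0), S.im_refl]
  have hend : ∀ q : Lp (S.map t0), (q ⬝ (S.tl (S.map t0) (Path.Homotopic.Quotient.refl (S.pt t0))).symm ⬝
      (S.im (p t0)).symm : Lp (S.map t0)) = q := by
    intro q
    exact triv_aux q _ _ htl hpp
  have main := loc C ⟨Path.Homotopic.Quotient.refl (S.pt t0), (hend 1).symm ▸ H.one_mem⟩ (by
    intro a1
    obtain ⟨c⟩ := fib_path (z a1.1.1) (S.pt a1.1.1) (fp a1)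
    obtain ⟨U, hU, hU1, hne⟩ := psh_nhds S hz c
    refine ⟨{a | a.1 ∈ U}, hU.preimage continuous_subtype_val, hU1, ?_⟩
    intro a a' δ hδ q hq
    have ha : a.1 ∈ U := by simpa using hδ 0
    have ha' : a'.1 ∈ U := by simpa using hδ 1
    have h1 := hC a q hq (cls (pshP S c a (hne _ ha)))
    refine ⟨cls (pshP S c a' (hne _ ha')), ?_⟩
    have hsq := psh_square S c δ (fun τ s k => hne _ (hδ τ) s k) (hne _ ha) (hne _ ha')
    convert h1 using 1
    rw [hsub (p a'.1.1) (p a.1.1 ⬝ prt (cls δ)), S.im_trans, symm_trans']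
    have hsq2 := congrArg (fun w => (S.tl a (cls (pshP S c a (hne _ ha)))).symm ⬝ w ⬝
      (S.tl a' (cls (pshP S c a' (hne _ ha')))).symm) hsq
    simp only [t_assoc, symm_t_assoc, t_symm, t_refl] at hsq2
    simp only [t_assoc]
    rw [← t_assoc (cls δ), hsq2]
    simp only [t_assoc, t_symm_assoc])
  intro q
  have h := hC _ _ (main _ q) (Path.Homotopic.Quotient.refl (S.pt t0))
  exact (hend q) ▸ h
end Z

end MF

end

noncomputable section

open scoped unitInterval Topology

namespace MF

section tw
variable {B K : Type*} [TopologicalSpace B] {z : B → K → ℂ} (hz : Continuous z)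

/-- coordinate centred at a strand -/
def tof (hz : Continuous z) (k : K) : C(Tot z, ℂ) := ⟨fun x => x.1.2 - z x.1.1 k, by fun_prop⟩

lemma tof_ne (k : K) (x : Tot z) : tof hz k x ≠ 0 := sub_ne_zero.2 (x.2 k)

/-- winding about a strand -/
def tw (k : K) {x y : Tot z} (q : PQ x y) : ℂ := wnd (tof hz k) (tof_ne hz k) q

lemma tw_trans (k : K) {x y w : Tot z} (q : PQ x y) (q' : PQ y w) : tw hz k (q ⬝ q') = tw hz k q + tw hz k q' :=
  wnd_trans _ _ _ _
lemma tw_symm (k : K) {x y : Tot z} (q : PQ x y) : tw hz k q.symm = - tw hz k q := wnd_symm _ _ _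
lemma tw_inc (k : K) (b : B) {x : Fib (z b)} (ℓ : Lp x) :
    tw hz k (Lp.map (inc z b) rfl ℓ) = wnd (fbf (z b) k) (fbf_ne _ k) ℓ := by
  exact wnd_pm _ _ (inc z b) _ _ _ _ _ (fun _ => rfl)
end tw

lemma tot_path {B K : Type*} [TopologicalSpace B] [Finite K] {z : B → K → ℂ} (S : Sect z)
    (b : B) (x : Tot z) (h : Nonempty (PQ b x.1.1)) : Nonempty (PQ (S.map b) x) := by
  obtain ⟨p⟩ := h
  obtain ⟨c⟩ := fib_path (z x.1.1) (S.pt x.1.1) (fp x)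
  exact ⟨S.im p ⬝ S.tl x (cls c)⟩

section R
variable {L K : Type*} [Fintype L] [Fintype K] {zz : ℂ → L → ℂ} (hzz : Continuous zz)
  (hzzb : {t | ¬ Function.Injective (zz t)}.Countable) (hzz0 : Function.Injective (zz 0))
  (Sl : Sect zz) {Z : ℂ × ℂ → K → ℂ} (hZ : Continuous Z)
  (hinj : ∀ b : Tot zz, Function.Injective (Z b.1))
  (hZb : {y | ¬ Function.Injective (Z (0, y))}.Countable)
  (S : Sect Z)

/-- restricted family over the good base -/
abbrev zB (zz : ℂ → L → ℂ) (Z : ℂ × ℂ → K → ℂ) : Tot zz → K → ℂ := fun b => Z b.1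
/-- slice family -/
abbrev z0 (Z : ℂ × ℂ → K → ℂ) : ℂ → K → ℂ := fun y => Z (0, y)
/-- slice family over good part -/
abbrev zs (zz : ℂ → L → ℂ) (Z : ℂ × ℂ → K → ℂ) : Fib (zz 0) → K → ℂ := fun y => Z (0, y.1)
/-- restricted section -/
def SB (zz : ℂ → L → ℂ) (S : Sect Z) : Sect (zB zz Z) := ⟨⟨fun b => S.S b.1, by fun_prop⟩, fun b => S.ne b.1⟩
/-- restricted section -/
def S0 (S : Sect Z) : Sect (z0 Z) := ⟨⟨fun b => S.S (0, b), by fun_prop⟩, fun b => S.ne (0, b)⟩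
/-- restricted section -/
def Ss (zz : ℂ → L → ℂ) (S : Sect Z) : Sect (zs zz Z) :=
  ⟨⟨fun b => S.S (0, b.1), by fun_prop⟩, fun b => S.ne (0, b.1)⟩

/-- map from the slice to the whole -/
def jB (zz : ℂ → L → ℂ) (Z : ℂ × ℂ → K → ℂ) : C(Tot (zs zz Z), Tot (zB zz Z)) :=
  ⟨fun x => ⟨(⟨(0, x.1.1.1), x.1.1.2⟩, x.1.2), x.2⟩, by
    apply Continuous.subtype_mk
    refine Continuous.prodMk ?_ (by fun_prop)
    apply Continuous.subtype_mk; fun_prop⟩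
/-- map from the slice to the plane -/
def j0 (zz : ℂ → L → ℂ) (Z : ℂ × ℂ → K → ℂ) : C(Tot (zs zz Z), Tot (z0 Z)) :=
  ⟨fun x => ⟨(x.1.1.1, x.1.2), x.2⟩, by apply Continuous.subtype_mk; fun_prop⟩

/-- fibre inclusion with the type read off from the big family -/
def thH (Sl : Sect zz) (S : Sect Z) : Lp ((SB zz S).pt (Sl.map 0)) →* Lp ((S0 S).map (Sl.S 0)) := (S0 S).fi (Sl.S 0)

include hzz hzzb hzz0 hZ hinj

lemma monod (γ : Lp (Sl.map 0)) (g g' : Lp ((SB zz S).pt (Sl.map 0)))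
    (h : (SB zz S).im γ ⬝ (SB zz S).fi _ g ⬝ ((SB zz S).im γ).symm = (SB zz S).fi _ g') :
    thH Sl S g' = thH Sl S g := by
  obtain ⟨c, rfl⟩ := Zsurj Sl hzz hzzb 0 hzz0 γ
  have hzB : Continuous (zB zz Z) := by fun_prop
  have hzs : Continuous (zs zz Z) := by fun_prop
  obtain ⟨g'', hg''⟩ := drag hzs (fun y => hinj ⟨(0, y.1), y.2⟩) (Ss zz S) (b := Sl.pt 0) (b' := Sl.pt 0) c g
  have h1 : g'' = g' := by
    apply fi_inj hzB hinj (SB zz S) (Sl.map 0)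
    rw [← h]
    have e := congrArg (fun q => pm (jB zz Z) q (x' := (SB zz S).map (Sl.map 0)) (y' := (SB zz S).map (Sl.map 0)) rfl rfl) hg''
    obtain ⟨c, rfl⟩ := cls_surj c
    obtain ⟨g, rfl⟩ := cls_surj g
    obtain ⟨g'', rfl⟩ := cls_surj g''
    exact e.symm.trans (pm_conj (jB zz Z) (x := (Ss zz S).map (Sl.pt 0)) (y := (Ss zz S).map (Sl.pt 0)) 
      (x' := (SB zz S).map (Sl.map 0)) (y' := (SB zz S).map (Sl.map 0)) ((Ss zz S).im (cls c)) ((Ss zz S).fi (Sl.pt 0) (cls g)) rfl rfl)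
  rw [← h1]
  have e := congrArg (fun q => pm (j0 zz Z) q (x' := (S0 S).map (Sl.S 0)) (y' := (S0 S).map (Sl.S 0)) rfl rfl) hg''
  have e2 := (pm_conj (j0 zz Z) (x := (Ss zz S).map (Sl.pt 0)) (y := (Ss zz S).map (Sl.pt 0)) 
      (x' := (S0 S).map (Sl.S 0)) (y' := (S0 S).map (Sl.S 0)) ((Ss zz S).im c) ((Ss zz S).fi (Sl.pt 0) g) rfl rfl)
  have e3 : pm (j0 zz Z) ((Ss zz S).im c) (x' := (S0 S).map (Sl.S 0)) (y' := (S0 S).map (Sl.S 0)) rfl rfl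
    = Path.Homotopic.Quotient.refl ((S0 S).map (Sl.S 0)) := by
    obtain ⟨c, rfl⟩ := cls_surj c
    have : (cls (c.map continuous_subtype_val) : PQ (Sl.S 0) (Sl.S 0)) = Path.Homotopic.Quotient.refl (Sl.S 0) :=
      Subsingleton.elim _ _
    have h4 : (S0 S).im (cls (c.map continuous_subtype_val) : PQ (Sl.S 0) (Sl.S 0)) =
      (S0 S).im (Path.Homotopic.Quotient.refl (Sl.S 0)) := congrArg _ this
    rw [(S0 S).im_refl] at h4
    exact h4
  rw [e3] at e2
  have e4 : pm (j0 zz Z) ((Ss zz S).fi (Sl.pt 0) g) (x' := (S0 S).map (Sl.S 0)) (y' := (S0 S).map (Sl.S 0)) rfl rfl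
    = thH Sl S g := by
    obtain ⟨g, rfl⟩ := cls_surj g
    rfl
  have e5 : pm (j0 zz Z) ((Ss zz S).fi (Sl.pt 0) g'') (x' := (S0 S).map (Sl.S 0)) (y' := (S0 S).map (Sl.S 0)) rfl rfl
    = thH Sl S g'' := by
    obtain ⟨g, rfl⟩ := cls_surj g''
    rfl
  have e6 := e5.symm.trans (e.symm.trans e2)
  simp only [refl_t, symm_refl'] at e6
  rw [e6, t_refl]
  exact e4

lemma thmR0 : ∃ R : Lp ((SB zz S).map (Sl.map 0)) →* Lp ((S0 S).map (Sl.S 0)),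
    (∀ γ : Lp (Sl.map 0), R ((SB zz S).im γ) = 1) ∧
    (∀ g, R ((SB zz S).fi (Sl.map 0) g) = thH Sl S g) := by
  have hzB : Continuous (zB zz Z) := by fun_prop
  have hd := fun q : Lp ((SB zz S).map (Sl.map 0)) => decomp hzB hinj (SB zz S) q
  choose D hD using hd
  have huniq : ∀ q g, q = Path.Homotopic.Quotient.trans ((SB zz S).fi _ g) ((SB zz S).im ((SB zz S).pr q)) → D q = g := by
    intro q g hg
    apply fi_inj hzB hinj (SB zz S) (Sl.map 0)
    have := (hD q).symm.trans hg
    exact t_cancel_right this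
  refine ⟨⟨⟨fun q => thH Sl S (D q), ?_⟩, ?_⟩, ?_, ?_⟩
  · rw [huniq 1 1, map_one]
    rw [map_one]
    have : (SB zz S).pr (1 : Lp ((SB zz S).map (Sl.map 0))) = Path.Homotopic.Quotient.refl _ := pm_refl _ _
    rw [this, Sect.im_refl]
    exact (one_mul (1 : Lp ((SB zz S).map (Sl.map 0)))).symm
  · intro q q'
    change thH Sl S (D (q * q')) = thH Sl S (D q) * thH Sl S (D q')
    obtain ⟨g'', hg''⟩ := drag hzB hinj (SB zz S) ((SB zz S).pr q) (D q')
    have hm := monod hzz hzzb hzz0 Sl hZ hinj S _ _ _ hg''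
    rw [← hm, ← map_mul]
    congr 1
    apply huniq
    rw [map_mul, ← hg'']
    have h1 := hD q
    have h2 := hD q'
    rw [Lp.mul_def, Lp.mul_def, (SB zz S).pr_trans, (SB zz S).im_trans]
    conv_lhs => rw [h1, h2]
    simp only [t_assoc, symm_t_assoc]
  · intro γ
    change thH Sl S (D ((SB zz S).im γ)) = 1
    rw [huniq _ 1, map_one]
    rw [map_one, (SB zz S).pr_im]
    exact (one_mul (M := Lp ((SB zz S).map (Sl.map 0))) _).symm
  · intro g
    change thH Sl S (D ((SB zz S).fi (Sl.map 0) g)) = _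
    rw [huniq _ g]
    rw [(SB zz S).pr_fi, Sect.im_refl]
    exact (mul_one (M := Lp ((SB zz S).map (Sl.map 0))) _).symm

include hZb
theorem thmR : ∃ Φ : Coc (Tot (zB zz Z)) (Lp ((S0 S).map (Sl.S 0))),
    (∀ {b b'} (P : PQ b b'), Φ.toF ((SB zz S).im P) = 1) ∧
    (∀ (b : Tot zz) (x : Fib (Z b.1)), Function.Surjective (fun ℓ : Lp x => Φ.toF (x := inc (zB zz Z) b x)
      (y := inc (zB zz Z) b x) (Lp.map (inc (zB zz Z) b) rfl ℓ))) ∧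
    (∀ (b : Tot zz) (x : Fib (Z b.1)) (ℓ : Lp x) (k : K) (h0 : Continuous (z0 Z)),
      tw h0 k (Φ.toF (x := inc (zB zz Z) b x)
      (y := inc (zB zz Z) b x) (Lp.map (inc (zB zz Z) b) rfl ℓ)) = wnd (fbf (Z b.1) k) (fbf_ne _ k) ℓ) := by
  have hzB : Continuous (zB zz Z) := by fun_prop
  obtain ⟨R, hR1, hR2⟩ := thmR0 hzz hzzb hzz0 Sl hZ hinj S
  have hpB : ∀ b : Tot zz, Nonempty (PQ (Sl.map 0) b) := fun b => tot_path Sl 0 b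
    ⟨cls (PathConnectedSpace.somePath _ _)⟩
  have htail : ∀ x : Tot (zB zz Z), ∃ c : PQ ((SB zz S).map (Sl.map 0)) x, ∀ b (h : (SB zz S).map b = x), ∃ P : PQ (Sl.map 0) b,
      c = h ▸ (SB zz S).im P := by
    intro x
    by_cases hx : ∃ b, (SB zz S).map b = x
    · obtain ⟨b, rfl⟩ := hx
      obtain ⟨P⟩ := hpB b
      refine ⟨(SB zz S).im P, fun b' h => ?_⟩
      have : b' = b := congrArg (fun y : Tot (zB zz Z) => y.1.1) h
      subst this
      exact ⟨P, rfl⟩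
    · obtain ⟨c⟩ := tot_path (SB zz S) (Sl.map 0) x (hpB _)
      exact ⟨c, fun b h => absurd ⟨b, h⟩ hx⟩
  choose tail ht using htail
  have ht' : ∀ b, ∃ P : PQ (Sl.map 0) b, tail ((SB zz S).map b) = (SB zz S).im P := fun b => ht _ b rfl
  let Φ := Coc.ext R tail
  have hΦ : ∀ {x y} (q : PQ x y), Φ.toF q = R (tail x ⬝ q ⬝ (tail y).symm : PQ _ _) := fun q => rfl
  have h1 : ∀ {b b'} (P : PQ b b'), Φ.toF ((SB zz S).im P) = 1 := by
    intro b b' P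
    obtain ⟨P1, h1⟩ := ht' b
    obtain ⟨P2, h2⟩ := ht' b'
    rw [hΦ, h1, h2, ← (SB zz S).im_symm, ← (SB zz S).im_trans, ← (SB zz S).im_trans]
    exact hR1 _
  have h2 : ∀ g, Φ.toF (x := (SB zz S).map (Sl.map 0)) (y := (SB zz S).map (Sl.map 0)) ((SB zz S).fi (Sl.map 0) g) = thH Sl S g := by
    intro g
    obtain ⟨P1, h1⟩ := ht' (Sl.map 0)
    rw [hΦ, h1]
    change R ((((SB zz S).im P1 : Lp _) * (SB zz S).fi (Sl.map 0) g) * ((SB zz S).im P1 : Lp _)⁻¹) = _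
    rw [map_mul, map_mul, map_inv, hR1, hR2]
    simp
  -- every fibre loop is conjugate to a loop in the base fibre
  have key : ∀ (b : Tot zz) (x : Fib (Z b.1)), ∃ q : PQ ((SB zz S).map (Sl.map 0)) (inc (zB zz Z) b x),
      (∀ ℓ : Lp x, ∃ g : Lp ((SB zz S).pt (Sl.map 0)), Lp.map (inc (zB zz Z) b) rfl ℓ = q.symm ⬝ (SB zz S).fi (Sl.map 0) g ⬝ q) ∧
      (∀ g : Lp ((SB zz S).pt (Sl.map 0)), ∃ ℓ : Lp x, Lp.map (inc (zB zz Z) b) rfl ℓ = q.symm ⬝ (SB zz S).fi (Sl.map 0) g ⬝ q) := by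
    intro b x
    obtain ⟨P⟩ := hpB b
    obtain ⟨c⟩ := fib_path (Z b.1) ((SB zz S).pt b) x
    set c' : PQ ((SB zz S).map b) (inc (zB zz Z) b x) := pm (inc (zB zz Z) b) (cls c) rfl rfl with hc'
    have hconj : ∀ ℓ : Lp x, ((SB zz S).fi b (cls c ⬝ ℓ ⬝ (cls c).symm) : PQ ((SB zz S).map b) ((SB zz S).map b)) =
        c' ⬝ Lp.map (inc (zB zz Z) b) rfl ℓ ⬝ c'.symm := by
      intro ℓ
      exact pm_conj (inc (zB zz Z) b) (x := (SB zz S).pt b) (y := x) (x' := (SB zz S).map b) (y' := inc (zB zz Z) b x) _ _ rfl rfl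
    refine ⟨(SB zz S).im P ⬝ c', fun ℓ => ?_, fun g => ?_⟩
    · obtain ⟨g, hg⟩ := drag hzB hinj (SB zz S) P (cls c ⬝ ℓ ⬝ (cls c).symm)
      refine ⟨g, ?_⟩
      rw [← hg, hconj]
      simp [t_assoc]
    · obtain ⟨g', hg'⟩ := drag hzB hinj (SB zz S) P.symm g
      rw [(SB zz S).im_symm, symm_symm'] at hg'
      refine ⟨(cls c).symm ⬝ g' ⬝ cls c, ?_⟩
      have h3 := hconj ((cls c).symm ⬝ g' ⬝ cls c)
      have h4 : (cls c ⬝ ((cls c).symm ⬝ g' ⬝ cls c) ⬝ (cls c).symm : PQ _ _) = g' := by simp [t_assoc]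
      rw [h4, ← hg'] at h3
      have h5 := congrArg (fun w => c'.symm ⬝ w ⬝ c') h3
      simp only [t_assoc, symm_t_assoc, symm_t, t_refl] at h5
      rw [symm_trans', t_assoc, t_assoc, ← h5]
      simp only [t_assoc]
  refine ⟨Φ, h1, ?_, ?_⟩
  · intro b x g
    obtain ⟨q, -, hq⟩ := key b x
    have hsur : Function.Surjective (thH Sl S) := Zsurj (S0 S) (by fun_prop) hZb (Sl.S 0) (hinj (Sl.map 0))
    obtain ⟨g0, hg0⟩ := hsur (Φ.toF q * g * (Φ.toF q)⁻¹)
    obtain ⟨ℓ, hℓ⟩ := hq g0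
    refine ⟨ℓ, ?_⟩
    change Φ.toF _ = g
    rw [hℓ, Φ.map_t, Φ.map_t, h2, hg0, Φ.map_symm]
    group
  · intro b x ℓ k h0
    obtain ⟨q, hq, -⟩ := key b x
    obtain ⟨g, hg⟩ := hq ℓ
    have e1 := tw_inc hzB k b ℓ
    rw [← e1, hg, Φ.map_t, Φ.map_t, Φ.map_symm, h2, tw_trans, tw_trans, tw_symm]
    have e2 : tw h0 k ((Φ.toF q)⁻¹ * thH Sl S g * (Φ.toF q)) = tw h0 k (thH Sl S g) := by
      simp only [tw, wnd_mul, wnd_inv]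
      ring
    rw [e2]
    have e3 := tw_inc h0 k (Sl.S 0) (x := (S0 S).pt (Sl.S 0)) g
    have e4 := tw_inc hzB k (Sl.map 0) g
    have e5 : tw hzB k (((SB zz S).fi (Sl.map 0)) g) = tw h0 k (thH Sl S g) := e4.trans e3.symm
    rw [e5]
    ring
end R

end MF

end

noncomputable section

open scoped unitInterval Topology

namespace MF

lemma wnd_half {K : Type*} (z : K → ℂ) (k : K) {x₀ : Fib z} (a : Path x₀ x₀) (c : ℂ)
    (h : ∀ s, 0 < (((a s).1 - z k) * c).re) : wnd (fbf z k) (fbf_ne z k) (cls a) = 0 := by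
  have hc : c ≠ 0 := by
    rintro rfl
    simpa using h 0
  rw [wnd_cls (fbf z k) (fbf_ne z k) a (fun s => Complex.log (((a s).1 - z k) * c) - Complex.log c) ?_ ?_]
  · simp
  · apply Continuous.sub _ continuous_const
    apply Continuous.clog
    · fun_prop
    · intro s; exact Or.inl (h s)
  · intro s
    have h1 : ((a s).1 - z k) * c ≠ 0 := by
      intro h0
      have := h s
      simp [h0] at this
    rw [Complex.exp_sub, Complex.exp_log h1, Complex.exp_log hc]
    field_simp
    rfl

lemma gen_dir {K : Type*} [Finite K] [Nonempty K] (P : K → ℂ) (X0 : ℂ) (hP : ∀ k, P k ≠ X0)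
    (hd : ∀ k k', k ≠ k' → ∀ r : ℝ, 0 < r → P k - X0 ≠ r * (P k' - X0)) :
    ∃ r : ℝ, 0 < r ∧ ∀ (x₀ : Fib P) (_ : x₀.1 = X0) (a : K → Path x₀ x₀),
      (∀ k s, (a k s).1 ∈ convexHull ℝ ({X0} ∪ Metric.ball (P k) r)) →
      (∀ k, wnd (fbf P k) (fbf_ne P k) (cls (a k)) = 2 * Real.pi * Complex.I) →
      Subgroup.closure (Set.range fun k => (cls (a k) : Lp x₀)) = ⊤ ∧
      ∀ k k', k ≠ k' → wnd (fbf P k') (fbf_ne P k') (cls (a k)) = 0 := by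
  classical
  have hn : ∀ k, 0 < ‖P k - X0‖ := fun k => norm_pos_iff.2 (sub_ne_zero.2 (hP k))
  let θ : K → ℂ := fun k => (P k - X0) / ‖P k - X0‖
  have hθ1 : ∀ k, ‖θ k‖ = 1 := fun k => by
    simp only [θ, norm_div, Complex.norm_real, norm_norm]
    exact div_self (hn k).ne'
  have hPθ : ∀ k, P k - X0 = ‖P k - X0‖ * θ k := fun k => by
    have : (‖P k - X0‖ : ℂ) ≠ 0 := by exact_mod_cast (hn k).ne'
    simp only [θ]; field_simp
  have hθn : ∀ k, (θ k).re ^ 2 + (θ k).im ^ 2 = 1 := fun k => by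
    have := hθ1 k
    rw [← sq_eq_sq₀ (norm_nonneg _) zero_le_one, Complex.sq_norm, Complex.normSq_apply] at this
    linarith
  let cf : K → K → ℝ := fun k k' => 1 - ((θ k).re * (θ k').re + (θ k).im * (θ k').im)
  have hcf : ∀ k k', k ≠ k' → 0 < cf k k' := by
    intro k k' hk
    have hne : θ k ≠ θ k' := by
      intro he
      refine hd k k' hk (‖P k - X0‖ / ‖P k' - X0‖) (div_pos (hn k) (hn k')) ?_
      have : (‖P k' - X0‖ : ℂ) ≠ 0 := by exact_mod_cast (hn k').ne'
      have e1 := hPθ k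
      have e2 := hPθ k'
      rw [he] at e1
      push_cast
      rw [div_mul_eq_mul_div, eq_div_iff this]
      linear_combination (‖P k' - X0‖ : ℂ) * e1 - (‖P k - X0‖ : ℂ) * e2
    have h1 := hθn k
    have h2 := hθn k'
    have : 0 < ((θ k).re - (θ k').re) ^ 2 + ((θ k).im - (θ k').im) ^ 2 := by
      by_contra hc
      apply hne
      apply Complex.ext <;> nlinarith [sq_nonneg ((θ k).re - (θ k').re), sq_nonneg ((θ k).im - (θ k').im)]
    simp only [cf]; nlinarith
  obtain ⟨δ, hδ, hδ'⟩ : ∃ δ : ℝ, 0 < δ ∧ ∀ k k', k ≠ k' → δ ≤ ‖P k - X0‖ * cf k k' := by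
    cases nonempty_fintype K
    by_cases hne : Nonempty {q : K × K // q.1 ≠ q.2}
    · obtain ⟨q, hq⟩ := Finite.exists_min (fun q : {q : K × K // q.1 ≠ q.2} => ‖P q.1.1 - X0‖ * cf q.1.1 q.1.2)
      exact ⟨_, mul_pos (hn _) (hcf _ _ q.2), fun k k' h => hq ⟨(k, k'), h⟩⟩
    · exact ⟨1, one_pos, fun k k' h => absurd ⟨⟨(k, k'), h⟩⟩ hne⟩
  -- linear functionals
  let φ : ℂ → K → ℝ := fun x k => (x - X0).re * (θ k).re + (x - X0).im * (θ k).im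
  have hφP : ∀ k k', φ (P k) k - φ (P k) k' = ‖P k - X0‖ * cf k k' := by
    intro k k'
    have e1 : (P k - X0).re = ‖P k - X0‖ * (θ k).re := by
      rw [← Complex.re_ofReal_mul, ← hPθ k]
    have e2 : (P k - X0).im = ‖P k - X0‖ * (θ k).im := by
      rw [← Complex.im_ofReal_mul, ← hPθ k]
    simp only [φ, e1, e2, cf]
    linear_combination ‖P k - X0‖ * hθn k
  let C : K → Set ℂ := fun k => {x | ∀ k', k' ≠ k → φ x k - φ x k' > -δ}
  have hφ0 : ∀ k, φ X0 k = 0 := fun k => by simp [φ]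
  have hconv : ∀ k, Convex ℝ (C k) := by
    intro k x hx y hy a b ha hb hab k' hk'
    have h1 := hx k' hk'
    have h2 := hy k' hk'
    have e : ∀ l, φ (a • x + b • y) l = a * φ x l + b * φ y l := by
      intro l
      have : a • x + b • y - X0 = a • (x - X0) + b • (y - X0) := by
        rw [smul_sub, smul_sub]
        have : X0 = a • X0 + b • X0 := by rw [← add_smul, hab, one_smul]
        nth_rw 1 [this]; abel
      simp only [φ, this, Complex.add_re, Complex.add_im, Complex.smul_re, Complex.smul_im, smul_eq_mul]
      ring
    rw [e, e]
    have : a * (φ x k - φ x k') + b * (φ y k - φ y k') > -δ := by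
      have ea : b = 1 - a := by linarith
      subst ea
      rcases eq_or_lt_of_le ha with h | h
      · subst h; linarith
      · nlinarith
    linarith
  have hball : ∀ k x, x ∈ Metric.ball (P k) (δ / 4) → x ∈ C k := by
    intro k x hx k' hk'
    rw [Metric.mem_ball, dist_eq_norm] at hx
    have h1 := (Complex.abs_re_le_norm (x - P k)).trans hx.le
    have h2 := (Complex.abs_im_le_norm (x - P k)).trans hx.le
    have e : φ x k - φ x k' = (φ (P k) k - φ (P k) k') +
      ((x - P k).re * ((θ k).re - (θ k').re) + (x - P k).im * ((θ k).im - (θ k').im)) := by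
      simp only [φ, Complex.sub_re, Complex.sub_im]; ring
    rw [e, hφP]
    have h3 := mul_pos (hn k) (hcf k k' hk'.symm)
    have h4 : ‖(x - P k) * (starRingEnd ℂ) (θ k - θ k')‖ < δ / 4 * 2 + δ / 4 := by
      rw [norm_mul, Complex.norm_conj]
      have : ‖θ k - θ k'‖ ≤ 2 := (norm_sub_le _ _).trans (by rw [hθ1, hθ1]; norm_num)
      nlinarith [norm_nonneg (x - P k), norm_nonneg (θ k - θ k')]
    have h5 := (Complex.abs_re_le_norm ((x - P k) * (starRingEnd ℂ) (θ k - θ k')))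
    have h6 : ((x - P k) * (starRingEnd ℂ) (θ k - θ k')).re =
      (x - P k).re * ((θ k).re - (θ k').re) + (x - P k).im * ((θ k).im - (θ k').im) := by
      simp [Complex.mul_re]; ring
    rw [h6] at h5
    have := abs_le.1 (h5.trans h4.le)
    linarith [this.1]
  have hX0 : ∀ k, X0 ∈ C k := fun k k' hk => by rw [hφ0, hφ0]; linarith
  have hhull : ∀ k, convexHull ℝ ({X0} ∪ Metric.ball (P k) (δ / 4)) ⊆ C k := by
    intro k
    apply convexHull_min _ (hconv k)
    rintro x (rfl | hx)
    · exact hX0 k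
    · exact hball k x hx
  refine ⟨δ / 4, by linarith, fun x₀ hx₀ a ha haw => ⟨?_, ?_⟩⟩
  · apply gen_cells P C hconv ?_ (fun k => hball k _ (Metric.mem_ball_self (by linarith))) ?_ ?_ x₀
      (fun k => by rw [hx₀]; exact hX0 k) a (fun k s => hhull k (ha k s)) haw
    · intro k
      have : C k = ⋂ k', {x | k' ≠ k → φ x k - φ x k' > -δ} := by ext x; simp [C]
      rw [this]
      apply isOpen_iInter_of_finite
      intro k'
      by_cases h : k' = k
      · simp [h]
      · simp only [ne_eq, h, not_false_eq_true, true_imp_iff]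
        apply isOpen_lt continuous_const
        simp only [φ]
        fun_prop
    · intro k k' hk h
      have h1 := h k hk
      have h2 := hφP k k'
      have h3 := hδ' k k' hk
      linarith
    · intro x
      obtain ⟨k, hk⟩ := Finite.exists_max (φ x)
      exact ⟨k, fun k' _ => by linarith [hk k']⟩
  · intro k k' hk
    apply wnd_half P k' (a k) ((starRingEnd ℂ) (θ k - θ k'))
    intro s
    have h1 := hhull k (ha k s) k' hk.symm
    have h2 := hφP k' k
    have h3 := hδ' k' k hk.symm
    have e : (((a k s).1 - P k') * (starRingEnd ℂ) (θ k - θ k')).re =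
      (φ (a k s).1 k - φ (a k s).1 k') - (φ (P k') k - φ (P k') k') := by
      simp [φ, Complex.mul_re]; ring
    rw [e]; linarith
end MF

end

noncomputable section

open scoped unitInterval Topology

namespace MF

section Om
variable {ι κ : Type*} (u : ι → ℂ) (w : κ → ℂ)

/-- allowed pairs -/
def Ok (x y : ℂ) : Prop := (∀ i, x ≠ u i) ∧ (∀ j, y ≠ w j) ∧ ∀ i j, x - y ≠ u i - w j

/-- space of allowed pairs -/
abbrev Om := {p : ℂ × ℂ // Ok u w p.1 p.2}

variable {u w} {x0 x1 x2 y0 y1 y2 : ℂ}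

/-- horizontal path -/
def hp (f : Path x0 x1) (y : ℂ) (h : ∀ s, Ok u w (f s) y) :
    Path (⟨(x0, y), by simpa using h 0⟩ : Om u w) ⟨(x1, y), by simpa using h 1⟩ where
  toFun s := ⟨(f s, y), h s⟩
  continuous_toFun := by apply Continuous.subtype_mk; fun_prop
  source' := by apply Subtype.ext; simp
  target' := by apply Subtype.ext; simp

/-- vertical path -/
def vp (x : ℂ) (g : Path y0 y1) (h : ∀ s, Ok u w x (g s)) :
    Path (⟨(x, y0), by simpa using h 0⟩ : Om u w) ⟨(x, y1), by simpa using h 1⟩ where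
  toFun s := ⟨(x, g s), h s⟩
  continuous_toFun := by apply Continuous.subtype_mk; fun_prop
  source' := by apply Subtype.ext; simp
  target' := by apply Subtype.ext; simp

lemma forall_trans_iff {f : Path x0 x1} {g : Path x1 x2} {P : ℂ → Prop} (hf : ∀ s, P (f s)) (hg : ∀ s, P (g s)) :
    ∀ s, P (f.trans g s) := by
  intro s
  rw [Path.trans_apply]
  split_ifs
  · exact hf _
  · exact hg _

lemma forall_symm {f : Path x0 x1} {P : ℂ → Prop} (hf : ∀ s, P (f s)) :
    ∀ s, P (f.symm s) := fun _ => hf _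

lemma hp_trans (f : Path x0 x1) (g : Path x1 x2) (y : ℂ) (h1 : ∀ s, Ok u w (f s) y) (h2 : ∀ s, Ok u w (g s) y) :
    cls (hp (f.trans g) y (forall_trans_iff (P := fun x => Ok u w x y) h1 h2)) = cls (hp f y h1) ⬝ cls (hp g y h2) := by
  rw [← cls_trans]
  congr 1
  apply Path.ext; funext s
  apply Subtype.ext
  change (f.trans g s, y) = _
  rw [Path.trans_apply, Path.trans_apply]
  split_ifs <;> rfl

lemma vp_trans (x : ℂ) (f : Path y0 y1) (g : Path y1 y2) (h1 : ∀ s, Ok u w x (f s)) (h2 : ∀ s, Ok u w x (g s)) :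
    cls (vp x (f.trans g) (forall_trans_iff (P := fun y => Ok u w x y) h1 h2)) = cls (vp x f h1) ⬝ cls (vp x g h2) := by
  rw [← cls_trans]
  congr 1
  apply Path.ext; funext s
  apply Subtype.ext
  change (x, f.trans g s) = _
  rw [Path.trans_apply, Path.trans_apply]
  split_ifs <;> rfl

lemma prodsq (f : Path x0 x1) (g : Path y0 y1) (h : ∀ s t, Ok u w (f s) (g t))
    (ha : ∀ s, Ok u w (f s) y0) (hb : ∀ s, Ok u w (f s) y1) (hc : ∀ s, Ok u w x0 (g s)) (hd : ∀ s, Ok u w x1 (g s)) :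
    cls (hp f y0 ha) ⬝ cls (vp x1 g hd) = cls (vp x0 g hc) ⬝ cls (hp f y1 hb) := by
  refine square (fun a => ⟨(f a.1, g a.2), h _ _⟩) ?_ _ _ _ _ ?_ ?_ ?_ ?_
  · apply Continuous.subtype_mk; fun_prop
  all_goals
    intro t
    apply Subtype.ext
    simp [hp, vp]

variable {A : Type*} [Group A] (Φ : Coc (Om u w) A)

/-- based lasso -/
abbrev las (γ : Path x0 x1) (a : Path x1 x1) : Path x0 x0 := γ.trans (a.trans γ.symm)

lemma forall_las {γ : Path x0 x1} {a : Path x1 x1} {P : ℂ → Prop} (hf : ∀ s, P (γ s)) (hg : ∀ s, P (a s)) :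
    ∀ s, P (las γ a s) := forall_trans_iff hf (forall_trans_iff hg (forall_symm hf))

lemma comm_abs {T x T' y : ℂ} (γa : Path T x) (a : Path x x) (γb : Path T' y) (b C : Path y y)
    (H1 : ∀ s t, Ok u w (γa s) (γb t)) (H2 : ∀ s t, Ok u w (a s) (γb t))
    (H3 : ∀ s t, Ok u w (γa s) (b t)) (H4 : ∀ s t, Ok u w (a s) (C t))
    (hb : ∀ s, Ok u w x (b s)) (hC : ∀ s, Ok u w x (C s))
    (h5 : Φ.toF (cls (vp x C hC)) = Φ.toF (cls (vp x b hb)))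
    (ha : ∀ s, Ok u w (las γa a s) T') (hb' : ∀ s, Ok u w T (las γb b s)) :
    Commute (Φ.toF (cls (hp (las γa a) T' ha))) (Φ.toF (cls (vp T (las γb b) hb'))) := by
  have a1 : ∀ s, Ok u w (γa s) T' := fun s => by simpa using H1 s 0
  have a2 : ∀ s, Ok u w (γa s) y := fun s => by simpa using H1 s 1
  have a3 : ∀ s, Ok u w T (γb s) := fun s => by simpa using H1 0 s
  have a4 : ∀ s, Ok u w x (γb s) := fun s => by simpa using H1 1 s
  have a5 : ∀ s, Ok u w (a s) T' := fun s => by simpa using H2 s 0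
  have a6 : ∀ s, Ok u w (a s) y := fun s => by simpa using H2 s 1
  have a7 : ∀ s, Ok u w T (b s) := fun s => by simpa using H3 0 s
  have e1 := congrArg Φ.toF (prodsq γa γb H1 a1 a2 a3 a4)
  have e2 := congrArg Φ.toF (prodsq a γb H2 a5 a6 a4 a4)
  have e3 := congrArg Φ.toF (prodsq γa b H3 a2 a2 a7 hb)
  have e4 := congrArg Φ.toF (prodsq a C H4 a6 a6 hC hC)
  rw [Φ.map_t, Φ.map_t] at e1 e2 e3 e4
  have f1 : cls (hp (las γa a) T' ha) = cls (hp γa T' a1) ⬝ (cls (hp a T' a5) ⬝ (cls (hp γa T' a1)).symm) := by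
    rw [hp_trans γa _ T' a1 (forall_trans_iff (P := fun x => Ok u w x T') a5 (forall_symm (P := fun x => Ok u w x T') a1)),
      hp_trans a _ T' a5 (forall_symm (P := fun x => Ok u w x T') a1)]
    rfl
  have f2 : cls (vp T (las γb b) hb') = cls (vp T γb a3) ⬝ (cls (vp T b a7) ⬝ (cls (vp T γb a3)).symm) := by
    rw [vp_trans T γb _ a3 (forall_trans_iff (P := fun x => Ok u w T x) a7 (forall_symm (P := fun x => Ok u w T x) a3)),
      vp_trans T b _ a7 (forall_symm (P := fun x => Ok u w T x) a3)]
    rfl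
  rw [f1, f2]
  simp only [Φ.map_t, Φ.map_symm]
  rw [h5] at e4
  generalize Φ.toF (cls (hp γa T' a1)) = p at *
  generalize Φ.toF (cls (vp x γb a4)) = V at *
  generalize Φ.toF (cls (vp T γb a3)) = q at *
  generalize Φ.toF (cls (hp γa y a2)) = H at *
  generalize Φ.toF (cls (hp a T' a5)) = h at *
  generalize Φ.toF (cls (hp a y a6)) = h' at *
  generalize Φ.toF (cls (vp T b a7)) = v at *
  generalize Φ.toF (cls (vp x b hb)) = v' at *
  have e2' : h = V * h' * V⁻¹ := eq_mul_inv_of_mul_eq e2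
  have e3' : v = H * v' * H⁻¹ := eq_mul_inv_of_mul_eq e3.symm
  have g1 : p * (h * p⁻¹) = (p * V) * h' * (p * V)⁻¹ := by rw [e2']; group
  have g2 : q * (v * q⁻¹) = (p * V) * v' * (p * V)⁻¹ := by rw [e1, e3']; group
  rw [g1, g2]
  change _ = _
  have : h' * v' = v' * h' := e4
  calc _ = (p * V) * (h' * v') * (p * V)⁻¹ := by group
    _ = _ := by rw [this]; group

end Om
end MF

end

noncomputable section

open scoped unitInterval Topology

namespace MF

/-- straight segment -/
def seg (x y : ℂ) : Path x y where
  toFun s := x + (s : ℝ) * (y - x)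
  continuous_toFun := by fun_prop
  source' := by simp
  target' := by simp

/-- arc in polar coordinates -/
def arc (c : ℂ) (R : C(ℝ, ℝ)) (a b : ℝ) (x y : ℂ) (hx : x = c + R a * Complex.exp (a * Complex.I))
    (hy : y = c + R b * Complex.exp (b * Complex.I)) : Path x y where
  toFun s := c + R (a + s * (b - a)) * Complex.exp ((a + s * (b - a) : ℝ) * Complex.I)
  continuous_toFun := by fun_prop
  source' := by simp [hx]
  target' := by simp [hy]

lemma arc_apply (c : ℂ) (R : C(ℝ, ℝ)) (a b : ℝ) (x y : ℂ) (hx : x = c + R a * Complex.exp (a * Complex.I))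
    (hy : y = c + R b * Complex.exp (b * Complex.I)) (hab : a ≤ b) (s : I) :
    ∃ t, a ≤ t ∧ t ≤ b ∧ arc c R a b x y hx hy s = c + R t * Complex.exp (t * Complex.I) :=
  ⟨a + s * (b - a), by nlinarith [s.2.1], by nlinarith [s.2.2], rfl⟩

lemma polar_re (r t : ℝ) : ((r : ℂ) * Complex.exp (t * Complex.I)).re = r * Real.cos t := by
  rw [Complex.re_ofReal_mul, Complex.exp_ofReal_mul_I_re]
lemma polar_im (r t : ℝ) : ((r : ℂ) * Complex.exp (t * Complex.I)).im = r * Real.sin t := by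
  rw [Complex.im_ofReal_mul, Complex.exp_ofReal_mul_I_im]
lemma polar_norm (r t : ℝ) (hr : 0 ≤ r) : ‖(r : ℂ) * Complex.exp (t * Complex.I)‖ = r := by
  rw [norm_mul, Complex.norm_exp_ofReal_mul_I, mul_one, Complex.norm_real, Real.norm_of_nonneg hr]

/-- constant radius -/
def Rc (r : ℝ) : C(ℝ, ℝ) := ⟨fun _ => r, continuous_const⟩
/-- dipping radius -/
def Rd (la : ℝ) : C(ℝ, ℝ) := ⟨fun t => 2 * la - 3 / 2 * la * Real.cos t, by fun_prop⟩

@[simp] lemma Rc_apply (r t : ℝ) : Rc r t = r := rfl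
@[simp] lemma Rd_apply (la t : ℝ) : Rd la t = 2 * la - 3 / 2 * la * Real.cos t := rfl

lemma exp_pi2 : Complex.exp (((Real.pi / 2 : ℝ) : ℂ) * Complex.I) = Complex.I := by
  apply Complex.ext
  · rw [Complex.exp_ofReal_mul_I_re]; simp
  · rw [Complex.exp_ofReal_mul_I_im]; simp
lemma exp_npi2 : Complex.exp (((-(Real.pi / 2) : ℝ) : ℂ) * Complex.I) = -Complex.I := by
  apply Complex.ext
  · rw [Complex.exp_ofReal_mul_I_re]; simp
  · rw [Complex.exp_ofReal_mul_I_im]; simp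
lemma exp_npi : Complex.exp (((-Real.pi : ℝ) : ℂ) * Complex.I) = -1 := by
  apply Complex.ext
  · rw [Complex.exp_ofReal_mul_I_re]; simp
  · rw [Complex.exp_ofReal_mul_I_im]; simp

/-- small loop around `c` based at `c + la` -/
def aL (c : ℂ) (la : ℝ) : Path (c + la) (c + la) :=
  arc c (Rc la) 0 (2 * Real.pi) _ _ (by simp) (by simp)
/-- first quarter -/
def q1 (c : ℂ) (la : ℝ) : Path (c - 2 * la) (c - 2 * la * Complex.I) :=
  arc c (Rc (2 * la)) (-Real.pi) (-(Real.pi / 2)) _ _ (by rw [exp_npi]; simp; ring) (by rw [exp_npi2]; simp; ring)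
/-- big middle -/
def qm (c : ℂ) (la : ℝ) : Path (c - 2 * la * Complex.I) (c + 2 * la * Complex.I) :=
  arc c (Rc (2 * la)) (-(Real.pi / 2)) (Real.pi / 2) _ _ (by rw [exp_npi2]; simp; ring) (by rw [exp_pi2]; simp)
/-- dipping middle -/
def qd (c : ℂ) (la : ℝ) : Path (c - 2 * la * Complex.I) (c + 2 * la * Complex.I) :=
  arc c (Rd la) (-(Real.pi / 2)) (Real.pi / 2) _ _ (by rw [exp_npi2]; simp; ring) (by rw [exp_pi2]; simp)
/-- last quarter -/
def q2 (c : ℂ) (la : ℝ) : Path (c + 2 * la * Complex.I) (c - 2 * la) :=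
  arc c (Rc (2 * la)) (Real.pi / 2) Real.pi _ _ (by rw [exp_pi2]; simp) (by simp; ring)

/-- big loop -/
def cL (c : ℂ) (la : ℝ) : Path (c - 2 * la) (c - 2 * la) := (q1 c la).trans ((qm c la).trans (q2 c la))
/-- dipping loop -/
def bL (c : ℂ) (la : ℝ) : Path (c - 2 * la) (c - 2 * la) := (q1 c la).trans ((qd c la).trans (q2 c la))

lemma aL_apply (c : ℂ) {la : ℝ} (h : 0 < la) (s : I) : ∃ X, aL c la s = c + X ∧ ‖X‖ = la := by
  obtain ⟨t, -, -, e⟩ := arc_apply c (Rc la) 0 (2 * Real.pi) (c + la) (c + la) (by simp) (by simp) (by positivity) s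
  exact ⟨_, e, polar_norm _ _ h.le⟩

lemma q1_apply (c : ℂ) {la : ℝ} (h : 0 < la) (s : I) : ∃ X, q1 c la s = c - X ∧ ‖X‖ = 2 * la ∧ 0 ≤ X.re := by
  obtain ⟨t, t1, t2, e⟩ := arc_apply c (Rc (2 * la)) (-Real.pi) (-(Real.pi / 2)) (c - 2 * la) (c - 2 * la * Complex.I)
    (by rw [exp_npi]; simp; ring) (by rw [exp_npi2]; simp; ring) (by linarith [Real.pi_pos]) s
  refine ⟨_, e.trans (sub_neg_eq_add _ _).symm, ?_, ?_⟩
  · rw [norm_neg, Rc_apply, polar_norm _ _ (by positivity)]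
  · rw [Complex.neg_re, polar_re, Rc_apply]
    have : Real.cos t ≤ 0 := by
      rw [← Real.cos_neg]
      exact Real.cos_nonpos_of_pi_div_two_le_of_le (by linarith) (by linarith)
    nlinarith

lemma q2_apply (c : ℂ) {la : ℝ} (h : 0 < la) (s : I) : ∃ X, q2 c la s = c - X ∧ ‖X‖ = 2 * la ∧ 0 ≤ X.re := by
  obtain ⟨t, t1, t2, e⟩ := arc_apply c (Rc (2 * la)) (Real.pi / 2) Real.pi (c + 2 * la * Complex.I) (c - 2 * la)
    (by rw [exp_pi2]; simp) (by simp; ring) (by linarith [Real.pi_pos]) s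
  refine ⟨_, e.trans (sub_neg_eq_add _ _).symm, ?_, ?_⟩
  · rw [norm_neg, Rc_apply, polar_norm _ _ (by positivity)]
  · rw [Complex.neg_re, polar_re, Rc_apply]
    have : Real.cos t ≤ 0 :=
      Real.cos_nonpos_of_pi_div_two_le_of_le (by linarith) (by linarith)
    nlinarith

lemma qm_apply (c : ℂ) {la : ℝ} (h : 0 < la) (s : I) : ∃ X, qm c la s = c - X ∧ ‖X‖ = 2 * la ∧ X.re ≤ 0 := by
  obtain ⟨t, t1, t2, e⟩ := arc_apply c (Rc (2 * la)) (-(Real.pi / 2)) (Real.pi / 2) (c - 2 * la * Complex.I) (c + 2 * la * Complex.I)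
    (by rw [exp_npi2]; simp; ring) (by rw [exp_pi2]; simp) (by linarith [Real.pi_pos]) s
  refine ⟨_, e.trans (sub_neg_eq_add _ _).symm, ?_, ?_⟩
  · rw [norm_neg, Rc_apply, polar_norm _ _ (by positivity)]
  · rw [Complex.neg_re, polar_re, Rc_apply]
    have : 0 ≤ Real.cos t :=
      Real.cos_nonneg_of_neg_pi_div_two_le_of_le (by linarith) (by linarith)
    nlinarith

lemma qd_apply (c : ℂ) {la : ℝ} (h : 0 < la) (s : I) : ∃ X, qd c la s = c - X ∧ X ≠ 0 ∧ ‖X‖ ≤ 2 * la ∧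
    X.re ≤ 0 ∧ - (2 / 3 * la) ≤ X.re := by
  obtain ⟨t, t1, t2, e⟩ := arc_apply c (Rd la) (-(Real.pi / 2)) (Real.pi / 2) (c - 2 * la * Complex.I) (c + 2 * la * Complex.I)
    (by rw [exp_npi2]; simp; ring) (by rw [exp_pi2]; simp) (by linarith [Real.pi_pos]) s
  have h1 : 0 ≤ Real.cos t :=
    Real.cos_nonneg_of_neg_pi_div_two_le_of_le (by linarith) (by linarith)
  have h2 := Real.cos_le_one t
  have h3 : 0 < Rd la t := by rw [Rd_apply]; nlinarith
  refine ⟨_, e.trans (sub_neg_eq_add _ _).symm, ?_, ?_, ?_, ?_⟩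
  · rw [← norm_pos_iff, norm_neg, polar_norm _ _ h3.le]; exact h3
  · rw [norm_neg, polar_norm _ _ h3.le, Rd_apply]; nlinarith
  · rw [Complex.neg_re, polar_re]; nlinarith
  · rw [Complex.neg_re, polar_re, Rd_apply]
    nlinarith [mul_nonneg h.le (sq_nonneg (Real.cos t - 2 / 3))]

lemma cL_apply (c : ℂ) {la : ℝ} (h : 0 < la) : ∀ s, ∃ X, cL c la s = c - X ∧ ‖X‖ = 2 * la := by
  refine forall_trans_iff (P := fun x => ∃ X, x = c - X ∧ ‖X‖ = 2 * la) (fun s => ?_)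
    (forall_trans_iff (P := fun x => ∃ X, x = c - X ∧ ‖X‖ = 2 * la) (fun s => ?_) (fun s => ?_))
  · obtain ⟨X, h1, h2, -⟩ := q1_apply c h s; exact ⟨X, h1, h2⟩
  · obtain ⟨X, h1, h2, -⟩ := qm_apply c h s; exact ⟨X, h1, h2⟩
  · obtain ⟨X, h1, h2, -⟩ := q2_apply c h s; exact ⟨X, h1, h2⟩

lemma bL_apply (c : ℂ) {la : ℝ} (h : 0 < la) : ∀ s, ∃ X, bL c la s = c - X ∧ X ≠ 0 ∧ ‖X‖ ≤ 2 * la ∧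
    - (2 / 3 * la) ≤ X.re := by
  refine forall_trans_iff (P := fun x => ∃ X, x = c - X ∧ X ≠ 0 ∧ ‖X‖ ≤ 2 * la ∧ - (2 / 3 * la) ≤ X.re) (fun s => ?_)
    (forall_trans_iff (P := fun x => ∃ X, x = c - X ∧ X ≠ 0 ∧ ‖X‖ ≤ 2 * la ∧ - (2 / 3 * la) ≤ X.re) (fun s => ?_) (fun s => ?_))
  · obtain ⟨X, h1, h2, h3⟩ := q1_apply c h s
    exact ⟨X, h1, norm_pos_iff.1 (by rw [h2]; positivity), h2.le, by linarith⟩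
  · obtain ⟨X, h1, h2, h3, -, h4⟩ := qd_apply c h s; exact ⟨X, h1, h2, h3, h4⟩
  · obtain ⟨X, h1, h2, h3⟩ := q2_apply c h s
    exact ⟨X, h1, norm_pos_iff.1 (by rw [h2]; positivity), h2.le, by linarith⟩

section PP
variable {ι κ : Type*}

/-- parameters in sufficiently general position -/
structure PP (u : ι → ℂ) (w : κ → ℂ) (ep la T : ℝ) : Prop where
  ep0 : 0 < ep
  ep1 : ep ≤ 1
  la0 : 0 < la
  hu : ∀ i k, i ≠ k → ep * (u k - u i).re + 20 * la < |(u k - u i).im|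
  hw : ∀ i k, i ≠ k → ep * (w k - w i).re + 20 * la < |(w k - w i).im|
  ht : ∀ i j k l, (i, j) ≠ (k, l) → ep * (u k - w l - (u i - w j)).re + 20 * la < |(u k - w l - (u i - w j)).im|
  hTu : ∀ i, |(u i).im| + 10 * la ≤ ep * (T - (u i).re)
  hTw : ∀ j, |(w j).im| + 10 * la ≤ ep * (T + (w j).re)
  hT : ∀ i j, 3 * (‖u i‖ + ‖w j‖) + 10 * la ≤ T

variable {u : ι → ℂ} {w : κ → ℂ} {ep la T : ℝ} (h : PP u w ep la T)
include h

lemma PP.okk (i : ι) (j : κ) {X Y : ℂ} (hX : X ≠ 0) (hY : Y ≠ 0) (hXY : X + Y ≠ 0)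
    (nX : |X.im| ≤ ep * X.re + 8 * la) (nY : |Y.im| ≤ ep * Y.re + 8 * la) : Ok u w (u i + X) (w j - Y) := by
  have := h.la0
  refine ⟨fun k hk => ?_, fun k hk => ?_, fun k l hk => ?_⟩
  · have e : X = u k - u i := by rw [← hk]; ring
    by_cases hik : i = k
    · subst hik; apply hX; rw [e, sub_self]
    · have := h.hu i k hik
      rw [← e] at this; linarith
  · have e : Y = w j - w k := by rw [← hk]; ring
    by_cases hik : k = j
    · subst hik; apply hY; rw [e, sub_self]
    · have := h.hw k j hik
      rw [← e] at this; linarith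
  · have e : X + Y = u k - w l - (u i - w j) := by rw [← hk]; ring
    by_cases hik : (i, j) = (k, l)
    · simp only [Prod.mk.injEq] at hik
      obtain ⟨rfl, rfl⟩ := hik; apply hXY; rw [e, sub_self]
    · have h1 := h.ht i j k l hik
      rw [← e, Complex.add_re, Complex.add_im] at h1
      have := abs_add_le X.im Y.im
      nlinarith

lemma PP.ball_nar {X : ℂ} (hX : ‖X‖ ≤ 2 * la) : |X.im| ≤ ep * X.re + 8 * la := by
  have h1 := (Complex.abs_im_le_norm X).trans hX
  have h2 := (abs_le.1 ((Complex.abs_re_le_norm X).trans hX)).1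
  nlinarith [h.ep0, h.ep1, h.la0]

lemma PP.segA (i : ι) (s : I) : ∃ X, seg T (u i + la) s = u i + X ∧ la ≤ X.re ∧ |X.im| ≤ ep * X.re + 8 * la ∧
    (u i + X).re ≤ T := by
  have h0 := h.hTu i
  have h1 := h.la0
  have h2 := h.ep0
  have h3 := h.ep1
  have s0 := s.2.1
  have s1 := s.2.2
  have h4 : 10 * la ≤ T - (u i).re := by nlinarith [abs_nonneg (u i).im]
  refine ⟨((1 - s : ℝ) : ℂ) * (T - u i) + (s : ℝ) * (la : ℂ), ?_, ?_, ?_, ?_⟩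
  · simp only [seg, Path.coe_mk_mk]; push_cast; ring
  · simp; nlinarith
  · have e1 : (((1 - s : ℝ) : ℂ) * (T - u i) + (s : ℝ) * (la : ℂ)).im = (1 - s) * (-(u i).im) := by
      rw [Complex.add_im, Complex.im_ofReal_mul, Complex.im_ofReal_mul]; simp
    have e2 : (((1 - s : ℝ) : ℂ) * (T - u i) + (s : ℝ) * (la : ℂ)).re = (1 - s) * (T - (u i).re) + s * la := by
      rw [Complex.add_re, Complex.re_ofReal_mul, Complex.re_ofReal_mul]; simp
    rw [e1, e2, abs_mul, abs_neg, abs_of_nonneg (by linarith)]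
    nlinarith [mul_nonneg h2.le (mul_nonneg s0 h1.le)]
  · rw [Complex.add_re, Complex.add_re, Complex.re_ofReal_mul, Complex.re_ofReal_mul]
    simp
    nlinarith

lemma PP.segB (j : κ) (s : I) : ∃ X, seg (-T) (w j - 2 * la) s = w j - X ∧ 2 * la ≤ X.re ∧ |X.im| ≤ ep * X.re + 8 * la ∧
    -T ≤ (w j - X).re := by
  have h0 := h.hTw j
  have h1 := h.la0
  have h2 := h.ep0
  have h3 := h.ep1
  have s0 := s.2.1
  have s1 := s.2.2
  have h4 : 10 * la ≤ T + (w j).re := by nlinarith [abs_nonneg (w j).im]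
  have e1 : (((1 - s : ℝ) : ℂ) * (T + w j) + (s : ℝ) * ((2 * la : ℝ) : ℂ)).im = (1 - s) * ((w j).im) := by
    rw [Complex.add_im, Complex.im_ofReal_mul, Complex.im_ofReal_mul, Complex.ofReal_im]; simp
  have e2 : (((1 - s : ℝ) : ℂ) * (T + w j) + (s : ℝ) * ((2 * la : ℝ) : ℂ)).re = (1 - s) * (T + (w j).re) + s * (2 * la) := by
    rw [Complex.add_re, Complex.re_ofReal_mul, Complex.re_ofReal_mul, Complex.ofReal_re]; simp
  refine ⟨((1 - s : ℝ) : ℂ) * (T + w j) + (s : ℝ) * ((2 * la : ℝ) : ℂ), ?_, ?_, ?_, ?_⟩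
  · simp only [seg, Path.coe_mk_mk]; push_cast; ring
  · rw [e2]; nlinarith
  · rw [e1, e2, abs_mul, abs_of_nonneg (by linarith)]
    nlinarith [mul_nonneg h2.le (mul_nonneg s0 h1.le)]
  · rw [Complex.sub_re, e2]
    nlinarith

omit h in
lemma ne0_of_re {X : ℂ} (h : 0 < X.re) : X ≠ 0 := by rintro rfl; simp at h

lemma PP.H1 (i : ι) (j : κ) (s t : I) : Ok u w (seg T (u i + la) s) (seg (-T) (w j - 2 * la) t) := by
  obtain ⟨X, e, h1, h2, -⟩ := h.segA i s
  obtain ⟨Y, e', h1', h2', -⟩ := h.segB j t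
  have := h.la0
  rw [e, e']
  exact h.okk i j (ne0_of_re (by linarith)) (ne0_of_re (by linarith)) (ne0_of_re (by rw [Complex.add_re]; linarith)) h2 h2'

omit h in
lemma ne0_of_norm {X Y : ℂ} (hh : ‖X‖ < ‖Y‖) : X + Y ≠ 0 := by
  intro h0
  rw [eq_neg_of_add_eq_zero_left h0, norm_neg] at hh
  exact lt_irrefl _ hh

lemma PP.H2 (i : ι) (j : κ) (s t : I) : Ok u w (aL (u i) la s) (seg (-T) (w j - 2 * la) t) := by
  have := h.la0
  obtain ⟨X, e, h1⟩ := aL_apply (u i) this s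
  obtain ⟨Y, e', h1', h2', -⟩ := h.segB j t
  rw [e, e']
  refine h.okk i j (norm_pos_iff.1 (by linarith)) (ne0_of_re (by linarith)) (ne0_of_norm ?_)
    (h.ball_nar (by linarith)) h2'
  have := (abs_le.1 (Complex.abs_re_le_norm Y)).2
  linarith

lemma PP.H3 (i : ι) (j : κ) (s t : I) : Ok u w (seg T (u i + la) s) (bL (w j) la t) := by
  have := h.la0
  obtain ⟨X, e, h1, h2, -⟩ := h.segA i s
  obtain ⟨Y, e', h0', h1', h2'⟩ := bL_apply (w j) this t
  rw [e, e']
  exact h.okk i j (ne0_of_re (by linarith)) h0' (ne0_of_re (by rw [Complex.add_re]; linarith)) h2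
    (h.ball_nar h1')

lemma PP.H4 (i : ι) (j : κ) (s t : I) : Ok u w (aL (u i) la s) (cL (w j) la t) := by
  have := h.la0
  obtain ⟨X, e, h1⟩ := aL_apply (u i) this s
  obtain ⟨Y, e', h1'⟩ := cL_apply (w j) this t
  rw [e, e']
  exact h.okk i j (norm_pos_iff.1 (by linarith)) (norm_pos_iff.1 (by linarith)) (ne0_of_norm (by linarith))
    (h.ball_nar (by linarith)) (h.ball_nar (by linarith))

/-- cone condition for the middle pieces -/
lemma PP.cone (j l : κ) {X : ℂ} (hX : X ≠ 0) (hn : ‖X‖ ≤ 2 * la) (hr : X.re ≤ 0) :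
    ep * (w l - (w j - X)).re < |(w l - (w j - X)).im| := by
  have e : w l - (w j - X) = (w l - w j) + X := by ring
  rw [e]
  have h0 := h.ep0
  have h1 := h.ep1
  have h2 := h.la0
  by_cases hl : j = l
  · subst hl
    rw [sub_self, zero_add]
    by_contra hc
    push Not at hc
    have h3 : X.im = 0 := abs_eq_zero.1 (le_antisymm (hc.trans (by nlinarith)) (abs_nonneg _))
    have h4 : X.re = 0 := by rw [h3, abs_zero] at hc; nlinarith
    exact hX (Complex.ext h4 h3)
  · have h3 := h.hw j l hl
    rw [Complex.add_re, Complex.add_im]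
    have h4 := (Complex.abs_im_le_norm X).trans hn
    have h5 := abs_sub_abs_le_abs_sub (w l - w j).im (-X.im)
    rw [sub_neg_eq_add, abs_neg] at h5
    nlinarith
end PP
end MF

end

noncomputable section

open scoped unitInterval Topology

namespace MF

section fl
variable {K : Type*} {P : K → ℂ} {x0 x1 x2 : ℂ}

/-- lift of a shifted path to the punctured plane -/
def fl (c : ℂ) (f : Path x0 x1) (h : ∀ s k, f s + c ≠ P k) (x y : Fib P) (hx : x.1 = x0 + c) (hy : y.1 = x1 + c) :
    Path x y where
  toFun s := ⟨f s + c, h s⟩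
  continuous_toFun := by apply Continuous.subtype_mk; fun_prop
  source' := Subtype.ext (by simp [hx])
  target' := Subtype.ext (by simp [hy])

lemma fl_trans (c : ℂ) (f : Path x0 x1) (g : Path x1 x2) (hf : ∀ s k, f s + c ≠ P k) (hg : ∀ s k, g s + c ≠ P k)
    (h : ∀ s k, f.trans g s + c ≠ P k)
    (x y z : Fib P) (hx : x.1 = x0 + c) (hy : y.1 = x1 + c) (hz : z.1 = x2 + c) :
    cls (fl c (f.trans g) h x z hx hz) = cls (fl c f hf x y hx hy) ⬝ cls (fl c g hg y z hy hz) := by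
  rw [← cls_trans]
  congr 1
  apply Path.ext; funext s
  apply Subtype.ext
  change f.trans g s + c = _
  rw [Path.trans_apply, Path.trans_apply]
  split_ifs <;> rfl

lemma wnd_las (c : ℂ) (f : Path x0 x1) (g : Path x1 x1) (hf : ∀ s k, f s + c ≠ P k) (hg : ∀ s k, g s + c ≠ P k)
    (h : ∀ s k, las f g s + c ≠ P k)
    (x y : Fib P) (hx : x.1 = x0 + c) (hy : y.1 = x1 + c) (k : K) :
    wnd (fbf P k) (fbf_ne P k) (cls (fl c (las f g) h x x hx hx)) =
      wnd (fbf P k) (fbf_ne P k) (cls (fl c g hg y y hy hy)) := by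
  have hfs : ∀ s k, f.symm s + c ≠ P k := fun s k => hf _ k
  have hgf : ∀ s k, g.trans f.symm s + c ≠ P k := forall_trans_iff (P := fun x => ∀ k, x + c ≠ P k) hg hfs
  rw [fl_trans c f _ hf hgf h x y x hx hy hx, fl_trans c g _ hg hfs hgf y y x hy hy hx, wnd_trans, wnd_trans]
  have : cls (fl c f.symm hfs y x hy hx) = (cls (fl c f hf x y hx hy)).symm := rfl
  rw [this, wnd_symm]; ring

lemma wnd_arc (c ctr : ℂ) (R : C(ℝ, ℝ)) (hR : ∀ t, 0 < R t) (a b : ℝ) (hx hy) (h) (x y : Fib P)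
    (hx' : x.1 = x0 + c) (hy' : y.1 = x1 + c) (k : K) (hk : P k = ctr + c) :
    wnd (fbf P k) (fbf_ne P k) (cls (fl c (arc ctr R a b x0 x1 hx hy) h x y hx' hy')) =
      (Real.log (R b) + b * Complex.I) - (Real.log (R a) + a * Complex.I) := by
  rw [wnd_cls (fbf P k) (fbf_ne P k) _
    (fun s => Real.log (R (a + s * (b - a))) + (a + s * (b - a) : ℝ) * Complex.I) ?_ ?_]
  · simp
  · apply Continuous.add
    · apply Complex.continuous_ofReal.comp
      apply Continuous.log
      · fun_prop
      · intro s; exact (hR _).ne'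
    · fun_prop
  · intro s
    rw [Complex.exp_add, ← Complex.ofReal_exp, Real.exp_log (hR _)]
    change _ = (arc ctr R a b x0 x1 hx hy s + c) - P k
    rw [hk]
    simp [arc]
end fl

lemma wnd_aL {K : Type*} {P : K → ℂ} (c ctr : ℂ) {la : ℝ} (hla : 0 < la) (h) (x : Fib P) (hx) (hx')
    (k : K) (hk : P k = ctr + c) : wnd (fbf P k) (fbf_ne P k) (cls (fl c (aL ctr la) h x x hx hx')) = 2 * Real.pi * Complex.I := by
  refine (wnd_arc c ctr (Rc la) (fun _ => hla) 0 (2 * Real.pi) _ _ h _ _ _ _ k hk).trans ?_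
  simp

lemma wnd_bL {K : Type*} {P : K → ℂ} (c ctr : ℂ) {la : ℝ} (hla : 0 < la) (h : ∀ s k, bL ctr la s + c ≠ P k) (x : Fib P) (hx) (hx')
    (k : K) (hk : P k = ctr + c) : wnd (fbf P k) (fbf_ne P k) (cls (fl c (bL ctr la) h x x hx hx')) = 2 * Real.pi * Complex.I := by
  have hs : ∀ (s : I) (k : K), q1 ctr la s + c ≠ P k ∧ qd ctr la s + c ≠ P k ∧ q2 ctr la s + c ≠ P k := by
    have e1 : ∀ (s : I) , ∃ t, bL ctr la t = q1 ctr la s := by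
      intro s
      have : q1 ctr la s ∈ Set.range (bL ctr la) := by
        rw [bL, Path.trans_range]; exact Or.inl ⟨s, rfl⟩
      exact this
    have e2 : ∀ (s : I) , ∃ t, bL ctr la t = qd ctr la s := by
      intro s
      have : qd ctr la s ∈ Set.range (bL ctr la) := by
        rw [bL, Path.trans_range, Path.trans_range]; exact Or.inr (Or.inl ⟨s, rfl⟩)
      exact this
    have e3 : ∀ (s : I) , ∃ t, bL ctr la t = q2 ctr la s := by
      intro s
      have : q2 ctr la s ∈ Set.range (bL ctr la) := by
        rw [bL, Path.trans_range, Path.trans_range]; exact Or.inr (Or.inr ⟨s, rfl⟩)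
      exact this
    intro s k
    obtain ⟨t1, h1⟩ := e1 s
    obtain ⟨t2, h2⟩ := e2 s
    obtain ⟨t3, h3⟩ := e3 s
    rw [← h1, ← h2, ← h3]
    exact ⟨h _ _, h _ _, h _ _⟩
  have g1 := fun s k => (hs s k).1
  have g2 := fun s k => (hs s k).2.1
  have g3 := fun s k => (hs s k).2.2
  have g4 : ∀ s k, (qd ctr la).trans (q2 ctr la) s + c ≠ P k :=
    forall_trans_iff (P := fun x => ∀ k, x + c ≠ P k) g2 g3
  let y1 : Fib P := ⟨ctr - 2 * la * Complex.I + c, by simpa using g2 0⟩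
  let y2 : Fib P := ⟨ctr + 2 * la * Complex.I + c, by simpa using g3 0⟩
  have e := fl_trans c (q1 ctr la) ((qd ctr la).trans (q2 ctr la)) g1 g4 h x y1 x hx rfl hx'
  have e' := fl_trans c (qd ctr la) (q2 ctr la) g2 g3 g4 y1 y2 x rfl rfl hx'
  have e'' := congrArg (wnd (fbf P k) (fbf_ne P k)) e
  rw [e', wnd_trans, wnd_trans] at e''
  refine Eq.trans e'' ?_
  have w1 := wnd_arc c ctr (Rc (2 * la)) (fun _ => by simpa using hla) _ _ _ _ g1 x y1 hx rfl k hk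
  have w2 := wnd_arc c ctr (Rd la) (fun t => by rw [Rd_apply]; nlinarith [Real.cos_le_one t]) _ _ _ _ g2 y1 y2 rfl rfl k hk
  have w3 := wnd_arc c ctr (Rc (2 * la)) (fun _ => by simpa using hla) _ _ _ _ g3 y2 x rfl hx' k hk
  refine (congrArg₂ (· + ·) w1 (congrArg₂ (· + ·) w2 w3)).trans ?_
  simp
  ring

section PP
variable {ι κ : Type*} {u : ι → ℂ} {w : κ → ℂ} {ep la T : ℝ} (h : PP u w ep la T)

/-- x-lasso -/
abbrev alp (u : ι → ℂ) (la T : ℝ) (i : ι) : Path (T : ℂ) T := las (seg T (u i + la)) (aL (u i) la)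
/-- y-lasso -/
abbrev bet (w : κ → ℂ) (la T : ℝ) (j : κ) : Path (-T : ℂ) (-T) := las (seg (-T) (w j - 2 * la)) (bL (w j) la)

/-- vertical paths in the cone region only matter through their endpoints -/
def H5 {A : Type*} [Group A] (Φ : Coc (Om u w) A) (ep la : ℝ) : Prop :=
  ∀ (i : ι) {y0 y1 : ℂ} (η η' : Path y0 y1) (hη : ∀ s, Ok u w (u i + la) (η s)) (hη' : ∀ s, Ok u w (u i + la) (η' s)),
    (∀ s l, ep * (w l - η s).re < |(w l - η s).im|) → (∀ s l, ep * (w l - η' s).re < |(w l - η' s).im|) →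
    Φ.toF (cls (vp _ η hη)) = Φ.toF (cls (vp _ η' hη'))

include h

lemma PP.okA (j : κ) (i : ι) : ∀ s, Ok u w (alp u la T i s) (-T) :=
  forall_las (P := fun x => Ok u w x (-T)) (fun s => by simpa using h.H1 i j s 0) (fun s => by simpa using h.H2 i j s 0)

lemma PP.okB (i : ι) (j : κ) : ∀ s, Ok u w T (bet w la T j s) :=
  forall_las (P := fun x => Ok u w T x) (fun s => by simpa using h.H1 i j 0 s) (fun s => by simpa using h.H3 i j 0 s)

lemma PP.comm {A : Type*} [Group A] (Φ : Coc (Om u w) A) (h5 : H5 Φ ep la) (i : ι) (j : κ) :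
    Commute (Φ.toF (cls (hp (alp u la T i) (-T) (h.okA j i)))) (Φ.toF (cls (vp T (bet w la T j) (h.okB i j)))) := by
  have hla := h.la0
  have ob : ∀ s, Ok u w (u i + la) (bL (w j) la s) := fun s => by simpa using h.H3 i j 1 s
  have oC : ∀ s, Ok u w (u i + la) (cL (w j) la s) := fun s => by simpa using h.H4 i j 0 s
  refine comm_abs Φ _ _ _ _ (cL (w j) la) (h.H1 i j) (h.H2 i j) (h.H3 i j) (h.H4 i j) ob oC ?_ _ _
  have hX : Ok u w (u i + la) (u i - 0 - (u i - w j) - 2 * la) := by simpa using ob 0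
  have kk : ∀ Y : ℂ, Y ≠ 0 → ‖Y‖ ≤ 2 * la → (la : ℂ) + Y ≠ 0 → Ok u w (u i + la) (w j - Y) := by
    intro Y h1 h2 h3
    have hl : ‖(la : ℂ)‖ = la := by rw [Complex.norm_real, Real.norm_of_nonneg hla.le]
    exact h.okk i j (by exact_mod_cast hla.ne') h1 h3 (h.ball_nar (by rw [hl]; linarith)) (h.ball_nar h2)
  have n2 : ∀ Y : ℂ, ‖Y‖ = 2 * la → Ok u w (u i + la) (w j - Y) := by
    intro Y h1
    have hl : ‖(la : ℂ)‖ = la := by rw [Complex.norm_real, Real.norm_of_nonneg hla.le]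
    exact kk Y (norm_pos_iff.1 (by linarith)) h1.le (ne0_of_norm (by rw [hl]; linarith))
  have o1 : ∀ s, Ok u w (u i + la) (q1 (w j) la s) := fun s => by
    obtain ⟨Y, e, h1, -⟩ := q1_apply (w j) hla s
    rw [e]; exact n2 _ h1
  have o2 : ∀ s, Ok u w (u i + la) (q2 (w j) la s) := fun s => by
    obtain ⟨Y, e, h1, -⟩ := q2_apply (w j) hla s
    rw [e]; exact n2 _ h1
  have om : ∀ s, Ok u w (u i + la) (qm (w j) la s) := fun s => by
    obtain ⟨Y, e, h1, -⟩ := qm_apply (w j) hla s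
    rw [e]; exact n2 _ h1
  have od : ∀ s, Ok u w (u i + la) (qd (w j) la s) := fun s => by
    obtain ⟨Y, e, h0, h1, -, h2⟩ := qd_apply (w j) hla s
    rw [e]
    exact kk Y h0 h1 (ne0_of_re (by rw [Complex.add_re, Complex.ofReal_re]; linarith))
  have om2 := forall_trans_iff (P := fun y => Ok u w (u i + la) y) om o2
  have od2 := forall_trans_iff (P := fun y => Ok u w (u i + la) y) od o2
  have e1 := vp_trans (u i + la) (q1 (w j) la) _ o1 om2
  have e2 := vp_trans (u i + la) (q1 (w j) la) _ o1 od2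
  rw [vp_trans (u i + la) (qm (w j) la) (q2 (w j) la) om o2] at e1
  rw [vp_trans (u i + la) (qd (w j) la) (q2 (w j) la) od o2] at e2
  refine (congrArg Φ.toF e1).trans (Eq.trans ?_ (congrArg Φ.toF e2).symm)
  rw [Φ.map_t, Φ.map_t, Φ.map_t, Φ.map_t, h5 i (qm (w j) la) (qd (w j) la) om od]
  · intro s l
    obtain ⟨Y, e, h1, h2⟩ := qm_apply (w j) hla s
    rw [e]
    exact h.cone j l (norm_pos_iff.1 (by linarith)) h1.le h2
  · intro s l
    obtain ⟨Y, e, h0, h1, h2, -⟩ := qd_apply (w j) hla s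
    rw [e]
    exact h.cone j l h0 h1 h2
end PP
end MF

end

noncomputable section

open scoped unitInterval Topology

namespace MF

/-- conclusion of `gen_dir` -/
def GD {K : Type*} (P : K → ℂ) (X0 : ℂ) (r : ℝ) : Prop :=
  ∀ (x₀ : Fib P) (_ : x₀.1 = X0) (a : K → Path x₀ x₀),
      (∀ k s, (a k s).1 ∈ convexHull ℝ ({X0} ∪ Metric.ball (P k) r)) →
      (∀ k, wnd (fbf P k) (fbf_ne P k) (cls (a k)) = 2 * Real.pi * Complex.I) →
      Subgroup.closure (Set.range fun k => (cls (a k) : Lp x₀)) = ⊤ ∧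
      ∀ k k', k ≠ k' → wnd (fbf P k') (fbf_ne P k') (cls (a k)) = 0

lemma pm_base {X Y A : Type*} [TopologicalSpace X] [TopologicalSpace Y] [Group A] (Φ : Coc Y A) (f : C(X, Y)) {x : X} {x' : Y}
    (hx : x' = f x) (q : Lp x) : Φ.toF (Lp.map f rfl q) = Φ.toF (pm f q hx hx) := by
  subst hx; rfl

section PP
variable {ι κ : Type*} {u : ι → ℂ} {w : κ → ℂ} {ep la T : ℝ} (h : PP u w ep la T)
include h

lemma PP.uT (i : ι) [Nonempty κ] : 3 * ‖u i‖ + 10 * la ≤ T := by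
  obtain ⟨j⟩ := ‹Nonempty κ›
  have := h.hT i j
  linarith [norm_nonneg (w j)]
lemma PP.wT (j : κ) [Nonempty ι] : 3 * ‖w j‖ + 10 * la ≤ T := by
  obtain ⟨i⟩ := ‹Nonempty ι›
  have := h.hT i j
  linarith [norm_nonneg (u i)]

lemma PP.alp_rng [Nonempty κ] (i : ι) : ∀ s, (u i).re - la ≤ (alp u la T i s).re ∧ (alp u la T i s).re ≤ T := by
  have hla := h.la0
  have hu := h.uT i
  have hre := abs_le.1 (Complex.abs_re_le_norm (u i))
  refine forall_las (P := fun x : ℂ => (u i).re - la ≤ x.re ∧ x.re ≤ T) (fun s => ?_) (fun s => ?_)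
  · obtain ⟨X, e, h1, h2, h3⟩ := h.segA i s
    rw [e]
    refine ⟨?_, h3⟩
    rw [Complex.add_re]; linarith
  · obtain ⟨X, e, h1⟩ := aL_apply (u i) hla s
    rw [e, Complex.add_re]
    have := abs_le.1 (Complex.abs_re_le_norm X)
    constructor <;> linarith [norm_nonneg (u i)]

lemma PP.bet_rng [Nonempty ι] (j : κ) : ∀ s, -T ≤ (bet w la T j s).re ∧ (bet w la T j s).re ≤ (w j).re + 2 * la := by
  have hla := h.la0
  have hu := h.wT j
  have hre := abs_le.1 (Complex.abs_re_le_norm (w j))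
  refine forall_las (P := fun x : ℂ => -T ≤ x.re ∧ x.re ≤ (w j).re + 2 * la) (fun s => ?_) (fun s => ?_)
  · obtain ⟨X, e, h1, h2, h3⟩ := h.segB j s
    rw [e]
    refine ⟨h3, ?_⟩
    rw [Complex.sub_re]; linarith
  · obtain ⟨X, e, h0, h1, -⟩ := bL_apply (w j) hla s
    rw [e, Complex.sub_re]
    have := abs_le.1 (Complex.abs_re_le_norm X)
    constructor <;> linarith [norm_nonneg (w j)]

lemma PP.okA6 [Nonempty ι] [Nonempty κ] (i : ι) (s t : I) :
    Ok u w (alp u la T i s) (-T + (t : ℝ) * (alp u la T i s - T)) := by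
  obtain ⟨j0⟩ := ‹Nonempty κ›
  have hla := h.la0
  have t0 := t.2.1
  have t1 := t.2.2
  haveI : Nonempty κ := ⟨j0⟩
  obtain ⟨r1, r2⟩ := h.alp_rng i s
  have hi := h.uT i
  have hre := abs_le.1 (Complex.abs_re_le_norm (u i))
  refine ⟨(h.okA j0 i s).1, fun l e => ?_, fun k l e => ?_⟩
  · have e' := congrArg Complex.re e
    rw [Complex.add_re, Complex.re_ofReal_mul, Complex.neg_re, Complex.sub_re, Complex.ofReal_re] at e'
    have := h.wT l
    have h3 := abs_le.1 (Complex.abs_re_le_norm (w l))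
    nlinarith [norm_nonneg (w l)]
  · have e' := congrArg Complex.re e
    rw [Complex.sub_re, Complex.add_re, Complex.re_ofReal_mul, Complex.neg_re, Complex.sub_re, Complex.ofReal_re,
      Complex.sub_re] at e'
    have h1 := h.wT l
    have h3 := abs_le.1 (Complex.abs_re_le_norm (w l))
    have h2 := h.hT k l
    have h4 := abs_le.1 (Complex.abs_re_le_norm (u k))
    have : -(T / 3) ≤ (alp u la T i s).re := by linarith
    nlinarith [norm_nonneg (w l), norm_nonneg (u k), norm_nonneg (u i)]

lemma PP.okB7 [Nonempty ι] [Nonempty κ] (j : κ) (s t : I) :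
    Ok u w (T + (t : ℝ) * (bet w la T j s + T)) (bet w la T j s) := by
  obtain ⟨i0⟩ := ‹Nonempty ι›
  have hla := h.la0
  have t0 := t.2.1
  have t1 := t.2.2
  haveI : Nonempty ι := ⟨i0⟩
  obtain ⟨r1, r2⟩ := h.bet_rng j s
  have hi := h.wT j
  have hre := abs_le.1 (Complex.abs_re_le_norm (w j))
  refine ⟨fun l e => ?_, (h.okB i0 j s).2.1, fun k l e => ?_⟩
  · have e' := congrArg Complex.re e
    rw [Complex.add_re, Complex.re_ofReal_mul, Complex.add_re, Complex.ofReal_re] at e'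
    have := h.uT l
    have h3 := abs_le.1 (Complex.abs_re_le_norm (u l))
    nlinarith [norm_nonneg (u l)]
  · have e' := congrArg Complex.re e
    rw [Complex.sub_re, Complex.add_re, Complex.re_ofReal_mul, Complex.add_re, Complex.ofReal_re,
      Complex.sub_re] at e'
    have h1 := h.wT l
    have h3 := abs_le.1 (Complex.abs_re_le_norm (w l))
    have h2 := h.hT k l
    have h4 := abs_le.1 (Complex.abs_re_le_norm (u k))
    have : (bet w la T j s).re ≤ T / 3 := by linarith
    nlinarith [norm_nonneg (w l), norm_nonneg (u k), norm_nonneg (w j)]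

theorem PP.gens [Nonempty ι] [Nonempty κ] (P : ι ⊕ κ → ℂ) (hPl : ∀ i, P (Sum.inl i) = u i)
    (hPr : ∀ j, P (Sum.inr j) = w j + 2 * T) (r : ℝ) (hr : GD P T r) (hlr : 4 * la < r)
    (phi : C(Fib P, Om u w)) (hphi : ∀ x, (phi x).1 = (x.1, x.1 - 2 * T))
    {A : Type*} [Group A] (Φ : Coc (Om u w) A) (h5 : H5 Φ ep la) :
    ∃ (x₀ : Fib P) (g : ι ⊕ κ → Lp x₀), Subgroup.closure (Set.range g) = ⊤ ∧
      (∀ k, wnd (fbf P k) (fbf_ne P k) (g k) = 2 * Real.pi * Complex.I) ∧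
      (∀ k k', k ≠ k' → wnd (fbf P k') (fbf_ne P k') (g k) = 0) ∧
      ∀ i j, Commute (Φ.toF (Lp.map phi rfl (g (Sum.inl i)))) (Φ.toF (Lp.map phi rfl (g (Sum.inr j)))) := by
  have hla := h.la0
  have okP : ∀ x, Ok u w x (x - 2 * T) → ∀ k, x ≠ P k := by
    rintro x ⟨h1, h2, -⟩ (i | j)
    · rw [hPl]; exact h1 i
    · rw [hPr]; intro e; apply h2 j; rw [e]; ring
  have avA : ∀ i s k, alp u la T i s + 0 ≠ P k := fun i s k => by
    rw [add_zero]
    apply okP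
    have := h.okA6 i s 1
    convert this using 1
    simp; ring
  have avB : ∀ j s k, bet w la T j s + 2 * T ≠ P k := fun j s k => by
    apply okP
    have := h.okB7 j s 1
    convert this using 1
    · simp; ring
    · ring
  have hx₀ : ∀ k, (T : ℂ) ≠ P k := fun k => by
    obtain ⟨i⟩ := ‹Nonempty ι›
    simpa using avA i 0 k
  let x₀ : Fib P := ⟨T, hx₀⟩
  let fa : ι → Path x₀ x₀ := fun i => fl 0 (alp u la T i) (avA i) x₀ x₀ (by simp [x₀]) (by simp [x₀])
  let fb : κ → Path x₀ x₀ := fun j => fl (2 * T) (bet w la T j) (avB j) x₀ x₀ (by simp only [x₀]; ring) (by simp only [x₀]; ring)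
  let a : ι ⊕ κ → Path x₀ x₀ := Sum.elim fa fb
  have hw : ∀ k, wnd (fbf P k) (fbf_ne P k) (cls (a k)) = 2 * Real.pi * Complex.I := by
    rintro (i | j)
    · have g1 : ∀ s k, seg (T : ℂ) (u i + la) s + 0 ≠ P k := by
        intro s k
        have : seg (T : ℂ) (u i + la) s ∈ Set.range (alp u la T i) := by
          unfold alp las; rw [Path.trans_range]; exact Or.inl ⟨s, rfl⟩
        obtain ⟨t, ht⟩ := this
        rw [← ht]; exact avA i t k
      have g2 : ∀ s k, aL (u i) la s + 0 ≠ P k := by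
        intro s k
        have : aL (u i) la s ∈ Set.range (alp u la T i) := by
          unfold alp las; rw [Path.trans_range, Path.trans_range]; exact Or.inr (Or.inl ⟨s, rfl⟩)
        obtain ⟨t, ht⟩ := this
        rw [← ht]; exact avA i t k
      have e1 := wnd_las 0 _ _ g1 g2 (avA i) x₀ ⟨u i + la + 0, by simpa using g2 0⟩ (by simp [x₀]) rfl (Sum.inl i)
      refine e1.trans ?_
      exact wnd_aL 0 (u i) hla _ _ _ _ _ (by rw [hPl, add_zero])
    · have g1 : ∀ s k, seg (-T : ℂ) (w j - 2 * la) s + 2 * T ≠ P k := by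
        intro s k
        have : seg (-T : ℂ) (w j - 2 * la) s ∈ Set.range (bet w la T j) := by
          unfold bet las; rw [Path.trans_range]; exact Or.inl ⟨s, rfl⟩
        obtain ⟨t, ht⟩ := this
        rw [← ht]; exact avB j t k
      have g2 : ∀ s k, bL (w j) la s + 2 * T ≠ P k := by
        intro s k
        have : bL (w j) la s ∈ Set.range (bet w la T j) := by
          unfold bet las; rw [Path.trans_range, Path.trans_range]; exact Or.inr (Or.inl ⟨s, rfl⟩)
        obtain ⟨t, ht⟩ := this
        rw [← ht]; exact avB j t k
      have e1 := wnd_las (2 * T) _ _ g1 g2 (avB j) x₀ ⟨w j - 2 * la + 2 * T, by simpa using g2 0⟩ (by simp only [x₀]; ring) rfl (Sum.inr j)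
      refine e1.trans ?_
      exact wnd_bL (2 * T) (w j) hla _ _ _ _ _ (by rw [hPr])
  have hhull : ∀ k s, (a k s).1 ∈ convexHull ℝ ({(T : ℂ)} ∪ Metric.ball (P k) r) := by
    have hT : ∀ k, (T : ℂ) ∈ convexHull ℝ ({(T : ℂ)} ∪ Metric.ball (P k) r) := fun k =>
      subset_convexHull _ _ (Or.inl rfl)
    have hB : ∀ k x, ‖x - P k‖ ≤ 2 * la → x ∈ convexHull ℝ ({(T : ℂ)} ∪ Metric.ball (P k) r) := fun k x hx =>
      subset_convexHull _ _ (Or.inr (by rw [Metric.mem_ball, dist_eq_norm]; linarith))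
    have hS : ∀ k x (s : I), ‖x - P k‖ ≤ 2 * la → (T : ℂ) + (s : ℝ) * (x - T) ∈ convexHull ℝ ({(T : ℂ)} ∪ Metric.ball (P k) r) := by
      intro k x s hx
      have := (convex_convexHull ℝ ({(T : ℂ)} ∪ Metric.ball (P k) r)).add_smul_sub_mem (hT k) (hB k x hx) s.2
      simpa using this
    have hl : ‖(la : ℂ)‖ = la := by rw [Complex.norm_real, Real.norm_of_nonneg hla.le]
    rintro (i | j)
    · refine forall_las (P := fun x => x + 0 ∈ convexHull ℝ ({(T : ℂ)} ∪ Metric.ball (P (Sum.inl i)) r)) (fun s => ?_) (fun s => ?_)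
      · rw [add_zero]
        apply hS
        rw [hPl, add_sub_cancel_left, hl]; linarith
      · rw [add_zero]
        apply hB
        obtain ⟨X, e, h1⟩ := aL_apply (u i) hla s
        rw [e, hPl, add_sub_cancel_left]; linarith
    · refine forall_las (P := fun x => x + 2 * T ∈ convexHull ℝ ({(T : ℂ)} ∪ Metric.ball (P (Sum.inr j)) r)) (fun s => ?_) (fun s => ?_)
      · have := hS (Sum.inr j) (w j - 2 * la + 2 * T) s (by
          rw [hPr]
          have : w j - 2 * la + 2 * T - (w j + 2 * T) = -(2 * la) := by ring
          rw [this, norm_neg, norm_mul, hl]; simp)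
        convert this using 1
        simp only [seg, Path.coe_mk_mk]; ring
      · apply hB
        obtain ⟨X, e, h0, h1, -⟩ := bL_apply (w j) hla s
        rw [e, hPr]
        have : w j - X + 2 * T - (w j + 2 * T) = -X := by ring
        rw [this, norm_neg]; exact h1
  obtain ⟨c1, c2⟩ := hr x₀ rfl a hhull hw
  refine ⟨x₀, fun k => cls (a k), c1, hw, c2, fun i j => ?_⟩
  have hb : (⟨(T, -T), by simpa using h.okA j i 0⟩ : Om u w) = phi x₀ := by
    apply Subtype.ext
    rw [hphi]
    simp only [x₀, Prod.mk.injEq, true_and]; ring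
  rw [pm_base Φ phi hb, pm_base Φ phi hb]
  have e1 : pm phi (cls (a (Sum.inl i))) hb hb = cls (hp (alp u la T i) (-T) (h.okA j i)) := by
    rw [pm_cls]
    symm
    refine homot (fun p => ⟨(alp u la T i p.1, -T + (p.2 : ℝ) * (alp u la T i p.1 - T)), h.okA6 i p.1 p.2⟩) ?_ _ _ ?_ ?_ ?_ ?_
    · apply Continuous.subtype_mk; fun_prop
    · intro t; apply Subtype.ext; simp [hp]
    · intro t; apply Subtype.ext
      change _ = (phi (a (Sum.inl i) t)).1
      rw [hphi]
      change _ = (alp u la T i t + 0, alp u la T i t + 0 - 2 * T)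
      simp; ring
    · intro t; apply Subtype.ext; simp
    · intro t; apply Subtype.ext; simp
  have e2 : pm phi (cls (a (Sum.inr j))) hb hb = cls (vp T (bet w la T j) (h.okB i j)) := by
    rw [pm_cls]
    symm
    refine homot (fun p => ⟨(T + (p.2 : ℝ) * (bet w la T j p.1 + T), bet w la T j p.1), h.okB7 j p.1 p.2⟩) ?_ _ _ ?_ ?_ ?_ ?_
    · apply Continuous.subtype_mk; fun_prop
    · intro t; apply Subtype.ext; simp [vp]
    · intro t; apply Subtype.ext
      change _ = (phi (a (Sum.inr j) t)).1
      rw [hphi]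
      change _ = (bet w la T j t + 2 * T, bet w la T j t + 2 * T - 2 * T)
      simp; ring
    · intro t; apply Subtype.ext; simp
    · intro t; apply Subtype.ext; simp
  rw [e1, e2]
  exact h.comm Φ h5 i j
end PP
end MF

end

noncomputable section

open scoped unitInterval Topology

namespace MF

open Filter in
/-- existence of the parameters -/
lemma params {ι κ : Type*} [Finite ι] [Finite κ] [Nonempty ι] [Nonempty κ] (u : ι → ℂ) (w : κ → ℂ)
    (hu : ∀ i k, i ≠ k → (u k - u i).im ≠ 0) (hw : ∀ i k, i ≠ k → (w k - w i).im ≠ 0)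
    (ht : ∀ i j k l, (i, j) ≠ (k, l) → (u k - w l - (u i - w j)).im ≠ 0) :
    ∃ ep la T r : ℝ, PP u w ep la T ∧ GD (Sum.elim u (fun j => w j + 2 * T)) T r ∧ 4 * la < r := by
  have key : ∀ v : ℂ, v.im ≠ 0 → ∀ᶠ ep : ℝ in 𝓝[>] 0, ep * v.re + ep < |v.im| := by
    intro v hv
    apply Filter.Eventually.filter_mono nhdsWithin_le_nhds
    have : ContinuousAt (fun ep : ℝ => ep * v.re + ep) 0 := by fun_prop
    apply this.eventually_lt continuousAt_const
    simpa using hv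
  have e1 : ∀ᶠ ep : ℝ in 𝓝[>] 0, ∀ i k, i ≠ k → ep * (u k - u i).re + ep < |(u k - u i).im| := by
    simp only [eventually_all]
    exact fun i k h => key _ (hu i k h)
  have e2 : ∀ᶠ ep : ℝ in 𝓝[>] 0, ∀ i k, i ≠ k → ep * (w k - w i).re + ep < |(w k - w i).im| := by
    simp only [eventually_all]
    exact fun i k h => key _ (hw i k h)
  have e3 : ∀ᶠ ep : ℝ in 𝓝[>] 0, ∀ i j k l, (i, j) ≠ (k, l) →
      ep * (u k - w l - (u i - w j)).re + ep < |(u k - w l - (u i - w j)).im| := by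
    simp only [eventually_all]
    exact fun i j k l h => key _ (ht i j k l h)
  have e4 : ∀ᶠ ep : ℝ in 𝓝[>] 0, ep < 1 :=
    Filter.Eventually.filter_mono nhdsWithin_le_nhds (eventually_lt_nhds one_pos)
  have e5 : ∀ᶠ ep : ℝ in 𝓝[>] 0, 0 < ep := self_mem_nhdsWithin
  obtain ⟨ep, h1, h2, h3, h4, h5⟩ := (e1.and (e2.and (e3.and (e4.and e5)))).exists
  have lin : ∀ a b : ℝ, ∀ᶠ T : ℝ in atTop, a ≤ ep * (T + b) := by
    intro a b
    filter_upwards [eventually_ge_atTop (a / ep - b)] with T hT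
    have : a / ep ≤ T + b := by linarith
    rw [div_le_iff₀ h5] at this
    linarith
  have f1 : ∀ᶠ T : ℝ in atTop, ∀ i, |(u i).im| + 10 ≤ ep * (T + -(u i).re) := by
    simp only [eventually_all]; exact fun i => lin _ _
  have f2 : ∀ᶠ T : ℝ in atTop, ∀ i, |(w i).im| + 10 ≤ ep * (T + (w i).re) := by
    simp only [eventually_all]; exact fun i => lin _ _
  have f3 : ∀ᶠ T : ℝ in atTop, ∀ i j, 3 * (‖u i‖ + ‖w j‖) + 10 ≤ T := by
    simp only [eventually_all]; exact fun i j => eventually_ge_atTop _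
  have ne : ∀ a b c : ℝ, a ≠ 0 → ∀ᶠ T : ℝ in atTop, T * a ≠ b + c * 0 := by
    intro a b c ha
    filter_upwards [eventually_gt_atTop (b / a)] with T hT e
    rw [mul_zero, add_zero] at e
    rw [← e, mul_div_cancel_right₀ _ ha] at hT
    exact lt_irrefl _ hT
  have f4 : ∀ᶠ T : ℝ in atTop, ∀ i k, i ≠ k →
      T * (u k - u i).im ≠ ((u k).im * (u i).re - (u i).im * (u k).re) + 0 * 0 := by
    simp only [eventually_all]; exact fun i k h => ne _ _ _ (hu i k h)
  have f5 : ∀ᶠ T : ℝ in atTop, ∀ i k, i ≠ k →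
      T * (w k - w i).im ≠ -((w k).im * (w i).re - (w i).im * (w k).re) + 0 * 0 := by
    simp only [eventually_all]; exact fun i k h => ne _ _ _ (hw i k h)
  obtain ⟨T, g1, g2, g3, g4, g5⟩ := (f1.and (f2.and (f3.and (f4.and f5)))).exists
  obtain ⟨i0⟩ := ‹Nonempty ι›
  obtain ⟨j0⟩ := ‹Nonempty κ›
  have su : ∀ i, (u i).re < T := fun i => by
    have := g3 i j0
    have := Complex.re_le_norm (u i)
    have := norm_nonneg (u i)
    have := norm_nonneg (w j0)
    linarith
  have sw : ∀ j, 0 < (w j).re + T := fun j => by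
    have := g3 i0 j
    have := Complex.abs_re_le_norm (w j)
    have := neg_abs_le (w j).re
    have := norm_nonneg (u i0)
    have := norm_nonneg (w j)
    linarith
  obtain ⟨r, hr, hG⟩ := gen_dir (K := ι ⊕ κ) (Sum.elim u (fun j => w j + 2 * T)) (T : ℂ) (by
      rintro (i | j) e
      · have := congrArg Complex.re e
        simp at this; linarith [su i]
      · have := congrArg Complex.re e
        simp at this; linarith [sw j]) (by
      rintro (i | j) (k | l) hne s hs e
      · have e1 := congrArg Complex.re e
        have e2 := congrArg Complex.im e
        simp at e1 e2
        apply g4 i k (fun h => hne (by rw [h]))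
        have : (u i).im * ((u k).re - T) = (u k).im * ((u i).re - T) := by rw [e1, e2]; ring
        simp only [Complex.sub_im]; linarith
      · have e1 := congrArg Complex.re e
        simp at e1
        have := su i
        have := mul_pos hs (sw l)
        nlinarith
      · have e1 := congrArg Complex.re e
        simp at e1
        have := sw j
        have := mul_pos hs (sub_pos.2 (su k))
        nlinarith
      · have e1 := congrArg Complex.re e
        have e2 := congrArg Complex.im e
        simp at e1 e2
        apply g5 j l (fun h => hne (by rw [h]))
        have : (w j).im * ((w l).re + 2 * T - T) = (w l).im * ((w j).re + 2 * T - T) := by rw [e1, e2]; ring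
        simp only [Complex.sub_im]; linarith)
  have hla : 0 < min (ep / 20) (r / 5) := by positivity
  refine ⟨ep, min (ep / 20) (r / 5), T, r, ?_, hG, ?_⟩
  · have l1 : min (ep / 20) (r / 5) ≤ ep / 20 := min_le_left _ _
    refine ⟨h5, h4.le, hla, fun i k h => ?_, fun i k h => ?_, fun i j k l h => ?_, fun i => ?_, fun i => ?_, fun i j => ?_⟩
    · linarith [h1 i k h]
    · linarith [h2 i k h]
    · linarith [h3 i j k l h]
    · have := g1 i; rw [← sub_eq_add_neg] at this; linarith
    · linarith [g2 i]
    · linarith [g3 i j]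
  · have l1 : min (ep / 20) (r / 5) ≤ r / 5 := min_le_right _ _
    linarith

end MF

end

noncomputable section

open scoped unitInterval Topology

namespace MF

section good
variable {B K : Type*} [TopologicalSpace B] {z : B → K → ℂ} (S : Sect z)

/-- the straight segment to the section avoids the strands -/
def Sect.good (a : Tot z) : Prop := ∀ (t : I) (k : K), a.1.2 + (t : ℝ) * (S.S a.1.1 - a.1.2) ≠ z a.1.1 k

/-- straight path to the section -/
def Sect.stp (a : Tot z) (h : S.good a) : Path a (S.map a.1.1) where
  toFun t := ⟨(a.1.1, a.1.2 + (t : ℝ) * (S.S a.1.1 - a.1.2)), h t⟩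
  continuous_toFun := by apply Continuous.subtype_mk; fun_prop
  source' := by apply Subtype.ext; simp
  target' := by apply Subtype.ext; simp [Sect.map]

open Classical in
/-- value of the straight path -/
def Sect.E {A : Type*} [Group A] (Φ : Coc (Tot z) A) (a : Tot z) : A :=
  if h : S.good a then Φ.toF (cls (S.stp a h)) else 1

lemma Sect.good_path {A : Type*} [Group A] (Φ : Coc (Tot z) A) (hΦ : ∀ {b b'} (P : PQ b b'), Φ.toF (S.im P) = 1)
    {a b : Tot z} (p : Path a b) (hp : ∀ s, S.good (p s)) : Φ.toF (cls p) = S.E Φ a * (S.E Φ b)⁻¹ := by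
  have ha : S.good a := by simpa using hp 0
  have hb : S.good b := by simpa using hp 1
  have hc : Continuous fun x : Tot z => x.1.1 := by fun_prop
  have h := square (X := Tot z) (fun st => ⟨((p st.1).1.1, (p st.1).1.2 + (st.2 : ℝ) * (S.S (p st.1).1.1 - (p st.1).1.2)), hp st.1 st.2⟩)
    (by apply Continuous.subtype_mk; fun_prop) p (S.stp b hb) (S.stp a ha) (((p.map hc)).map S.map.continuous)
    (fun t => by apply Subtype.ext; simp) (fun t => by apply Subtype.ext; simp [Sect.stp])
    (fun t => by apply Subtype.ext; simp [Sect.stp]) (fun t => by apply Subtype.ext; simp; rfl)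
  have h2 := congrArg Φ.toF h
  rw [Φ.map_t, Φ.map_t] at h2
  have h3 : Φ.toF (cls (((p.map hc)).map S.map.continuous)) = 1 := hΦ (cls (p.map hc))
  rw [h3, mul_one] at h2
  rw [Sect.E, Sect.E, dif_pos ha, dif_pos hb, ← h2]
  simp
end good

/-- restriction of a cocycle along a map -/
def Coc.comap {X Y A : Type*} [TopologicalSpace X] [TopologicalSpace Y] [Group A] (Φ : Coc Y A) (f : C(X, Y)) : Coc X A where
  toF p := Φ.toF (pm f p rfl rfl)
  map_t p q := by rw [pm_trans f p q rfl rfl rfl, Φ.map_t]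

section lines
variable {ι κ : Type*} (u μ : ι → ℂ) (w ν : κ → ℂ)
/-- the family of strands -/
def Zf : ℂ × ℂ → ι ⊕ κ → ℂ := fun b => Sum.elim (fun i => u i + μ i * b.2) (fun j => w j + ν j * b.2 + b.1)

lemma Zf_cont : Continuous (Zf u μ w ν) := by
  apply continuous_pi
  rintro (i | j)
  · simp only [Zf, Sum.elim_inl]; fun_prop
  · simp only [Zf, Sum.elim_inr]; fun_prop

/-- genericity of the second coordinate -/
def Sep : Prop := ∀ Y i j, u i + μ i * Y = w j + ν j * Y →
  (∀ i' j', u i' + μ i' * Y = w j' + ν j' * Y → i' = i ∧ j' = j) ∧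
  (∀ i' i'', i' ≠ i'' → u i' + μ i' * Y ≠ u i'' + μ i'' * Y) ∧
  (∀ i' i'', i' ≠ i'' → w i' + ν i' * Y ≠ w i'' + ν i'' * Y)

variable {u μ w ν}
lemma exists_lines [Finite ι] [Finite κ] (hμν : ∀ i j, μ i ≠ ν j) (hsep : Sep u μ w ν)
    (hu : Function.Injective u) (hw : Function.Injective w) :
    ∃ L : Set (ℂ × ℂ), L.Finite ∧ (∀ t y, (∀ l ∈ L, y ≠ l.1 + l.2 * t) → Function.Injective (Zf u μ w ν (t, y))) ∧
      (∀ l ∈ L, ∀ l' ∈ L, l.1 = l'.1 → l = l') ∧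
      (∀ t, (∀ i j, t ≠ u i - w j) → ∀ l ∈ L, 0 ≠ l.1 + l.2 * t) := by
  let l1 : ι × κ → ℂ × ℂ := fun p => ((u p.1 - w p.2) / (ν p.2 - μ p.1), -1 / (ν p.2 - μ p.1))
  let l2 : ι × ι → ℂ × ℂ := fun p => (-(u p.1 - u p.2) / (μ p.1 - μ p.2), 0)
  let l3 : κ × κ → ℂ × ℂ := fun p => (-(w p.1 - w p.2) / (ν p.1 - ν p.2), 0)
  have e1 : ∀ i j t y, y = (l1 (i, j)).1 + (l1 (i, j)).2 * t ↔ u i + μ i * y = w j + ν j * y + t := by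
    intro i j t y
    have : ν j - μ i ≠ 0 := sub_ne_zero.2 (hμν i j).symm
    simp only [l1]
    field_simp
    constructor <;> intro h <;> linear_combination -h
  have e2 : ∀ i j t y, μ i ≠ μ j → (y = (l2 (i, j)).1 + (l2 (i, j)).2 * t ↔ u i + μ i * y = u j + μ j * y) := by
    intro i j t y h
    have : μ i - μ j ≠ 0 := sub_ne_zero.2 h
    simp only [l2, zero_mul, add_zero]
    field_simp
    constructor <;> intro h <;> linear_combination h
  have e3 : ∀ i j t y, ν i ≠ ν j → (y = (l3 (i, j)).1 + (l3 (i, j)).2 * t ↔ w i + ν i * y = w j + ν j * y) := by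
    intro i j t y h
    have : ν i - ν j ≠ 0 := sub_ne_zero.2 h
    simp only [l3, zero_mul, add_zero]
    field_simp
    constructor <;> intro h <;> linear_combination h
  refine ⟨Set.range l1 ∪ (l2 '' {p | μ p.1 ≠ μ p.2} ∪ l3 '' {p | ν p.1 ≠ ν p.2}), ?_, ?_, ?_, ?_⟩
  · exact (Set.finite_range _).union ((Set.toFinite _).union (Set.toFinite _))
  · intro t y h
    have f1 : ∀ i j, u i + μ i * y ≠ w j + ν j * y + t := fun i j e =>
      h _ (Or.inl ⟨(i, j), rfl⟩) ((e1 i j t y).2 e)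
    have f2 : ∀ i j, u i + μ i * y = u j + μ j * y → i = j := fun i j e => by
      by_cases hm : μ i = μ j
      · apply hu; rw [hm] at e; exact add_right_cancel e
      · exact absurd ((e2 i j t y hm).2 e) (h _ (Or.inr (Or.inl ⟨(i, j), hm, rfl⟩)))
    have f3 : ∀ i j, w i + ν i * y = w j + ν j * y → i = j := fun i j e => by
      by_cases hm : ν i = ν j
      · apply hw; rw [hm] at e; exact add_right_cancel e
      · exact absurd ((e3 i j t y hm).2 e) (h _ (Or.inr (Or.inr ⟨(i, j), hm, rfl⟩)))
    rintro (i | i) (j | j) e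
    · rw [f2 i j e]
    · exact absurd e (f1 i j)
    · exact absurd e.symm (f1 j i)
    · rw [f3 i j (add_right_cancel e)]
  · have key : ∀ i j, ∀ l' ∈ Set.range l1 ∪ (l2 '' {p | μ p.1 ≠ μ p.2} ∪ l3 '' {p | ν p.1 ≠ ν p.2}),
        (l1 (i, j)).1 = l'.1 → l1 (i, j) = l' := by
      intro i j l' hl' e
      have h0 := (e1 i j 0 (l1 (i, j)).1).1 (by simp)
      rw [add_zero] at h0
      obtain ⟨s1, s2, s3⟩ := hsep _ i j h0
      rcases hl' with ⟨⟨i', j'⟩, rfl⟩ | ⟨⟨i', j'⟩, hm, rfl⟩ | ⟨⟨i', j'⟩, hm, rfl⟩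
      · have h1 := (e1 i' j' 0 (l1 (i', j')).1).1 (by simp)
        rw [add_zero, ← e] at h1
        obtain ⟨rfl, rfl⟩ := s1 _ _ h1
        rfl
      · have h1 := (e2 i' j' 0 (l2 (i', j')).1 hm).1 (by simp)
        rw [← e] at h1
        exact absurd h1 (s2 _ _ (fun h => hm (by simp [h])))
      · have h1 := (e3 i' j' 0 (l3 (i', j')).1 hm).1 (by simp)
        rw [← e] at h1
        exact absurd h1 (s3 _ _ (fun h => hm (by simp [h])))
    intro l hl l' hl' e
    rcases hl with ⟨⟨i, j⟩, rfl⟩ | hl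
    · exact key _ _ _ hl' e
    rcases hl' with ⟨⟨i, j⟩, rfl⟩ | hl'
    · exact (key _ _ _ (Or.inr hl) e.symm).symm
    have z : ∀ l ∈ (l2 '' {p | μ p.1 ≠ μ p.2} ∪ l3 '' {p | ν p.1 ≠ ν p.2}), l.2 = 0 := by
      rintro l (⟨p, -, rfl⟩ | ⟨p, -, rfl⟩) <;> rfl
    exact Prod.ext e ((z _ hl).trans (z _ hl').symm)
  · rintro t h l (⟨⟨i, j⟩, rfl⟩ | ⟨⟨i', j'⟩, hm, rfl⟩ | ⟨⟨i', j'⟩, hm, rfl⟩) e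
    · have := (e1 i j t 0).1 e
      apply h i j
      linear_combination -this
    · have := (e2 i' j' t 0 hm).1 e
      simp only [mul_zero, add_zero] at this
      exact hm (by simp [hu this])
    · have := (e3 i' j' t 0 hm).1 e
      simp only [mul_zero, add_zero] at this
      exact hm (by simp [hw this])

end lines

end MF

end

noncomputable section

open scoped unitInterval Topology

namespace MF

section thmG
variable {ι κ : Type*} [Fintype ι] [Fintype κ] [Nonempty ι] [Nonempty κ] {u μ : ι → ℂ} {w ν : κ → ℂ}

/-- a big section of a finite family -/
def bigS {B K : Type*} [TopologicalSpace B] [Fintype K] (z : B → K → ℂ) (hz : Continuous z) (Λ : ℝ) (hΛ : 0 < Λ) : Sect z where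
  S := ⟨fun b => ((Λ + ∑ k, ‖z b k‖ : ℝ) : ℂ), by fun_prop⟩
  ne b k h := by
    have h1 := congrArg norm h
    change ‖((Λ + ∑ k, ‖z b k‖ : ℝ) : ℂ)‖ = _ at h1
    have h2 : ‖z b k‖ ≤ ∑ k, ‖z b k‖ := Finset.single_le_sum (f := fun k => ‖z b k‖) (fun _ _ => norm_nonneg _) (Finset.mem_univ k)
    have h3 := norm_nonneg (z b k)
    rw [Complex.norm_real, Real.norm_of_nonneg (by linarith)] at h1
    linarith

theorem thmG (hμν : ∀ i j, μ i ≠ ν j) (hsep : Sep u μ w ν)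
    (hu : ∀ i k, i ≠ k → (u k - u i).im ≠ 0) (hw : ∀ i k, i ≠ k → (w k - w i).im ≠ 0)
    (ht : ∀ i j k l, (i, j) ≠ (k, l) → (u k - w l - (u i - w j)).im ≠ 0)
    (h0 : Continuous (z0 (Zf u μ w ν))) :
    ∃ (x₀ : Tot (z0 (Zf u μ w ν))) (g : ι ⊕ κ → Lp x₀), Subgroup.closure (Set.range g) = ⊤ ∧
      (∀ k, tw h0 k (g k) = 2 * Real.pi * Complex.I) ∧ (∀ k k', k ≠ k' → tw h0 k' (g k) = 0) ∧
      ∀ i j, Commute (g (Sum.inl i)) (g (Sum.inr j)) := by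
  classical
  have hui : Function.Injective u := fun i k e => by
    by_contra hne; exact hu i k hne (by simp [e])
  have hwi : Function.Injective w := fun i k e => by
    by_contra hne; exact hw i k hne (by simp [e])
  obtain ⟨Ls, hLf, hL1, hL2, hL3⟩ := exists_lines hμν hsep hui hwi
  haveI : Fintype Ls := hLf.fintype
  obtain ⟨ep, la, T, r, hP, hG, hr⟩ := params u w hu hw ht
  let Z := Zf u μ w ν
  have hZ : Continuous Z := Zf_cont _ _ _ _
  let zz : ℂ → Ls → ℂ := fun t l => l.1.1 + l.1.2 * t
  have hzz : Continuous zz := by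
    apply continuous_pi; intro l; simp only [zz]; fun_prop
  have hzz0 : Function.Injective (zz 0) := by
    intro l l' e
    simp only [zz, mul_zero, add_zero] at e
    exact Subtype.ext (hL2 _ l.2 _ l'.2 e)
  have hzzb : {t | ¬ Function.Injective (zz t)}.Countable := by
    apply (Set.countable_range (fun p : Ls × Ls => (p.2.1.1 - p.1.1.1) / (p.1.1.2 - p.2.1.2))).mono
    intro t ht
    rw [Set.mem_setOf_eq, Function.not_injective_iff] at ht
    obtain ⟨l, l', e, hne⟩ := ht
    simp only [zz] at e
    have h2 : l.1.2 - l'.1.2 ≠ 0 := by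
      intro h
      have h' := sub_eq_zero.1 h
      apply hne
      rw [h'] at e
      exact Subtype.ext (hL2 _ l.2 _ l'.2 (add_right_cancel e))
    refine ⟨(l, l'), ?_⟩
    simp only
    rw [div_eq_iff h2]
    linear_combination -e
  have hinj : ∀ b : Tot zz, Function.Injective (Z b.1) := fun b => hL1 b.1.1 b.1.2 (fun l hl => b.2 ⟨l, hl⟩)
  have hZb : {y | ¬ Function.Injective (Z (0, y))}.Countable := by
    apply (Set.countable_range (fun l : Ls => l.1.1)).mono
    intro y hy
    by_contra hn
    apply hy
    apply hL1
    intro l hl e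
    exact hn ⟨⟨l, hl⟩, by simpa using e.symm⟩
  obtain ⟨Λ, hΛ0, hΛ⟩ : ∃ Λ : ℝ, 0 < Λ ∧ ∀ i, |(u i).im| ≤ ep * (Λ - (u i).re - la) := by
    have := (Filter.eventually_all (ι := ι) (l := Filter.atTop) (p := fun i (Λ : ℝ) => |(u i).im| / ep + (u i).re + la ≤ Λ)).2
      (fun i => Filter.eventually_ge_atTop _)
    obtain ⟨Λ, h1, h2⟩ := (this.and (Filter.eventually_gt_atTop 0)).exists
    refine ⟨Λ, h2, fun i => ?_⟩
    have := h1 i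
    have h3 : |(u i).im| / ep ≤ Λ - (u i).re - la := by linarith
    rw [div_le_iff₀ hP.ep0] at h3
    linarith
  let S : Sect Z := bigS Z hZ Λ hΛ0
  let Sl : Sect zz := bigS zz hzz 1 one_pos
  obtain ⟨Φ, hΦ1, hΦ2, hΦ3⟩ := thmR hzz hzzb hzz0 Sl hZ hinj hZb S
  have hb : ∀ t, (∀ i j, t ≠ u i - w j) → ∀ l : Ls, (0 : ℂ) ≠ zz t l := fun t h l => hL3 t h l l.2
  have hok : ∀ x y, Ok u w x y → ∀ k, x ≠ Z (x - y, 0) k := by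
    rintro x y ⟨h1, h2, -⟩ (i | j) e
    · simp only [Z, Zf, Sum.elim_inl, mul_zero, add_zero] at e; exact h1 i e
    · simp only [Z, Zf, Sum.elim_inr, mul_zero, add_zero] at e; apply h2 j; linear_combination e
  let jO : C(Om u w, Tot (zB zz Z)) := ⟨fun p => ⟨(⟨(p.1.1 - p.1.2, 0), hb _ p.2.2.2⟩, p.1.1), hok _ _ p.2⟩, by
    apply Continuous.subtype_mk
    refine Continuous.prodMk ?_ (by fun_prop)
    apply Continuous.subtype_mk; fun_prop⟩
  have hT2 : ∀ i j, (2 * T : ℂ) ≠ u i - w j := by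
    intro i j e
    have h1 := congrArg Complex.re e
    simp at h1
    have := hP.hT i j
    have := hP.la0
    have := Complex.re_le_norm (u i)
    have := Complex.abs_re_le_norm (w j)
    have := neg_abs_le (w j).re
    have := norm_nonneg (u i)
    have := norm_nonneg (w j)
    linarith
  let b0 : Tot zz := ⟨(2 * T, 0), hb _ hT2⟩
  let P : ι ⊕ κ → ℂ := Z (2 * T, 0)
  have hPP : P = Sum.elim u (fun j => w j + 2 * T) := by
    funext k
    rcases k with i | j <;> simp [P, Z, Zf]
  have hPl : ∀ i, P (Sum.inl i) = u i := fun i => by rw [hPP]; rfl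
  have hPr : ∀ j, P (Sum.inr j) = w j + 2 * T := fun i => by rw [hPP]; rfl
  let phi : C(Fib P, Om u w) := ⟨fun x => ⟨(x.1, x.1 - 2 * T), by
      refine ⟨fun i => ?_, fun j => ?_, fun i j => ?_⟩
      · rw [← hPl]; exact x.2 _
      · intro e; apply x.2 (Sum.inr j); rw [hPr]; simp only at e; linear_combination e
      · simpa using hT2 i j⟩, by apply Continuous.subtype_mk; fun_prop⟩
  have h5 : H5 (Φ.comap jO) ep la := by
    have key : ∀ (i : ι) {y0 y1 : ℂ} (η : Path y0 y1) (hη : ∀ s, Ok u w (u i + la) (η s)),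
        (∀ s l, ep * (w l - η s).re < |(w l - η s).im|) →
        (Φ.comap jO).toF (cls (vp _ η hη)) = (SB zz S).E Φ (jO ⟨(u i + la, y0), by simpa using hη 0⟩) *
          ((SB zz S).E Φ (jO ⟨(u i + la, y1), by simpa using hη 1⟩))⁻¹ := by
      intro i y0 y1 η hη hc
      refine (SB zz S).good_path Φ hΦ1 ((vp _ η hη).map jO.continuous) ?_
      intro s t
      obtain ⟨M, hM, hMS⟩ : ∃ M : ℝ, Λ ≤ M ∧ (SB zz S).S (jO (vp _ η hη s)).1.1 = M :=
        ⟨_, le_add_of_nonneg_right (Finset.sum_nonneg fun _ _ => norm_nonneg _), rfl⟩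
      have hv : |((t : ℝ) * ((M : ℂ) - (u i + la))).im| ≤ ep * ((t : ℝ) * ((M : ℂ) - (u i + la))).re := by
        simp [abs_mul]
        rw [abs_of_nonneg t.2.1]
        have h1 := hΛ i
        have h2 := mul_le_mul_of_nonneg_left hM hP.ep0.le
        have h3 : |(u i).im| ≤ ep * (M - ((u i).re + la)) := by linarith
        have := mul_le_mul_of_nonneg_left h3 t.2.1
        linarith
      have hla := hP.la0
      have hep := hP.ep0
      rintro (k | l) e
      · have e' : (u i + la) + (t : ℝ) * ((SB zz S).S (jO (vp _ η hη s)).1.1 - (u i + la)) = Z (u i + la - η s, 0) (Sum.inl k) := e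
        rw [hMS] at e'
        simp only [Z, Zf, Sum.elim_inl, mul_zero, add_zero] at e'
        have e2 : (t : ℝ) * ((M : ℂ) - (u i + la)) = u k - u i - la := by linear_combination e'
        rw [e2] at hv
        by_cases hik : i = k
        · subst hik
          simp at hv
          nlinarith
        · have := hP.hu i k hik
          simp at hv this
          nlinarith
      · have e' : (u i + la) + (t : ℝ) * ((SB zz S).S (jO (vp _ η hη s)).1.1 - (u i + la)) = Z (u i + la - η s, 0) (Sum.inr l) := e
        rw [hMS] at e'
        simp only [Z, Zf, Sum.elim_inr, mul_zero, add_zero] at e'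
        have e2 : (t : ℝ) * ((M : ℂ) - (u i + la)) = w l - η s := by linear_combination e'
        rw [e2] at hv
        exact absurd (hc s l) (not_lt.2 hv)
    intro i y0 y1 η η' hη hη' hc hc'
    rw [key i η hη hc, key i η' hη' hc']
  obtain ⟨x₀, g, g1, g2, g3, g4⟩ := hP.gens P hPl hPr r (hPP ▸ hG) hr phi (fun _ => rfl) (Φ.comap jO) h5
  have hx : inc (zB zz Z) b0 x₀ = jO (phi x₀) := by
    apply Subtype.ext
    refine Prod.ext (Subtype.ext (Prod.ext ?_ rfl)) rfl
    change (2 * T : ℂ) = x₀.1 - (x₀.1 - 2 * T)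
    ring
  have hcomp : ∀ ℓ : Lp x₀, (Φ.comap jO).toF (Lp.map phi rfl ℓ) = Φ.toF (Lp.map (inc (zB zz Z) b0) rfl ℓ) := by
    intro ℓ
    have e1 : (Φ.comap jO).toF (Lp.map phi rfl ℓ) = Φ.toF (Lp.map (jO.comp phi) rfl ℓ) := by
      change Φ.toF (pm jO (pm phi ℓ rfl rfl) rfl rfl) = _
      rw [pm_pm]; rfl
    rw [e1, pm_base Φ (jO.comp phi) (x' := inc (zB zz Z) b0 x₀) hx]
    rw [pm_congr (jO.comp phi) (inc (zB zz Z) b0)]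
    · rfl
    · intro x
      apply Subtype.ext
      refine Prod.ext (Subtype.ext (Prod.ext ?_ rfl)) rfl
      change x.1 - (x.1 - 2 * T) = (2 * T : ℂ)
      ring
  let fh : Lp x₀ →* Lp ((S0 S).map (Sl.S 0)) := (Φ.hom (inc (zB zz Z) b0 x₀)).comp (Lp.map (inc (zB zz Z) b0) rfl)
  have hfh : ∀ ℓ, fh ℓ = Φ.toF (Lp.map (inc (zB zz Z) b0) rfl ℓ) := fun ℓ => rfl
  refine ⟨(S0 S).map (Sl.S 0), fun k => fh (g k), ?_, fun k => ?_, fun k k' hk => ?_, fun i j => ?_⟩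
  · have : Function.Surjective fh := hΦ2 b0 x₀
    rw [← MonoidHom.range_eq_top] at this
    rw [← this, MonoidHom.range_eq_map, ← g1, MonoidHom.map_closure, ← Set.range_comp]
    rfl
  · exact (hΦ3 b0 x₀ (g k) k h0).trans (g2 k)
  · exact (hΦ3 b0 x₀ (g k) k' h0).trans (g3 k k' hk)
  · have := g4 i j
    rw [hcomp, hcomp] at this
    exact this
end thmG

end MF

end

noncomputable section

open scoped unitInterval Topology

namespace MF

section alg
variable {G P : Type*} [Group G] [Group P] (ρ : P →* G)

lemma alg1 {J : Type*} [Fintype J] [DecidableEq J] (f : J → G) (b0 : G) (hc : ∀ i, Commute (f i) b0) (V : G → J → ℤ)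
    (hV : ∀ x y, V (x * y) = V x + V y) (hf : ∀ i, V (f i) = Pi.single i 1) (d : J → P)
    (hd : ∀ i, ρ (d i) = f i * b0⁻¹) (a : G) (ha : a ∈ Subgroup.closure (Set.range f)) :
    Commute a b0 ∧ ∃ h : P, ρ h = a * b0 ^ (- ∑ i, V a i) ∧ Abelianization.of h = ∏ i, Abelianization.of (d i) ^ V a i := by
  have hV1 : V 1 = 0 := by simpa using hV 1 1
  have hVi : ∀ x, V x⁻¹ = - V x := fun x => by
    have := hV x x⁻¹
    rw [mul_inv_cancel, hV1] at this
    exact eq_neg_of_add_eq_zero_right this.symm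
  induction ha using Subgroup.closure_induction with
  | mem x hx =>
    obtain ⟨i, rfl⟩ := hx
    refine ⟨hc i, d i, ?_, ?_⟩
    · rw [hd, hf]; simp
    · rw [hf, Finset.prod_eq_single i] <;> simp +contextual [Pi.single_apply]
  | one => exact ⟨Commute.one_left _, 1, by simp [hV1], by simp [hV1]⟩
  | mul x y _ _ hx hy =>
    obtain ⟨cx, h, h1, h2⟩ := hx
    obtain ⟨cy, h', h1', h2'⟩ := hy
    refine ⟨cx.mul_left cy, h * h', ?_, ?_⟩
    · rw [map_mul, h1, h1', hV]
      simp only [Pi.add_apply, Finset.sum_add_distrib, neg_add, zpow_add]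
      have := (cy.zpow_right (-∑ i, V x i)).eq
      rw [mul_assoc, ← mul_assoc _ y, ← this]
      simp only [mul_assoc]
    · rw [map_mul, h2, h2', hV, ← Finset.prod_mul_distrib]
      exact Finset.prod_congr rfl fun i _ => by rw [Pi.add_apply, zpow_add]
  | inv x _ hx =>
    obtain ⟨cx, h, h1, h2⟩ := hx
    refine ⟨cx.inv_left, h⁻¹, ?_, ?_⟩
    · rw [map_inv, h1, hVi, mul_inv_rev]
      simp only [Pi.neg_apply, Finset.sum_neg_distrib, neg_neg, ← zpow_neg]
      exact ((cx.inv_left).zpow_right _).eq.symm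
    · rw [map_inv, h2, hVi, ← Finset.prod_inv_distrib]
      exact Finset.prod_congr rfl fun i _ => by rw [Pi.neg_apply, zpow_neg]

theorem alg {ι κ : Type*} [Fintype ι] [Fintype κ] [DecidableEq ι] [DecidableEq κ] [Nonempty ι] [Nonempty κ] (g : ι ⊕ κ → G)
    (hg : Subgroup.closure (Set.range g) = ⊤) (hcomm : ∀ i j, Commute (g (Sum.inl i)) (g (Sum.inr j)))
    (W : G → ι ⊕ κ → ℤ) (hW : ∀ x y, W (x * y) = W x + W y) (hWg : ∀ k, W (g k) = Pi.single k 1)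
    (hρ : Function.Injective ρ) (N : ℤ) (hN : N ≠ 0) (hr : ∀ x, x ∈ ρ.range ↔ N ∣ ∑ k, W x k) :
    Nonempty (Additive (Abelianization P) ≃+ (ι ⊕ κ → ℤ)) := by
  have hV1 : W 1 = 0 := by simpa using hW 1 1
  have hVi : ∀ x, W x⁻¹ = - W x := fun x => by
    have := hW x x⁻¹
    rw [mul_inv_cancel, hV1] at this
    exact eq_neg_of_add_eq_zero_right this.symm
  let fa : ι → G := fun i => g (Sum.inl i)
  let fb : κ → G := fun j => g (Sum.inr j)
  let A := Subgroup.closure (Set.range fa)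
  let B := Subgroup.closure (Set.range fb)
  have hAB : ∀ a ∈ A, ∀ b ∈ B, Commute a b := by
    have h1 : A ≤ Subgroup.centralizer (Set.range fb) := by
      rw [Subgroup.closure_le]
      rintro _ ⟨i, rfl⟩
      rw [SetLike.mem_coe, Subgroup.mem_centralizer_iff]
      rintro _ ⟨j, rfl⟩
      exact (hcomm i j).eq.symm
    have h2 : B ≤ Subgroup.centralizer A := by
      rw [Subgroup.closure_le]
      rintro _ ⟨j, rfl⟩
      rw [SetLike.mem_coe, Subgroup.mem_centralizer_iff]
      intro a ha
      exact (Subgroup.mem_centralizer_iff.1 (h1 ha) _ ⟨j, rfl⟩).symm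
    intro a ha b hb
    exact Subgroup.mem_centralizer_iff.1 (h2 hb) a ha
  have hdec : ∀ x : G, ∃ a ∈ A, ∃ b ∈ B, x = a * b := by
    intro x
    have hx : x ∈ Subgroup.closure (Set.range g) := by rw [hg]; trivial
    induction hx using Subgroup.closure_induction with
    | mem x hx =>
      obtain ⟨i | j, rfl⟩ := hx
      · exact ⟨_, Subgroup.subset_closure ⟨i, rfl⟩, 1, one_mem _, (mul_one _).symm⟩
      · exact ⟨1, one_mem _, _, Subgroup.subset_closure ⟨j, rfl⟩, (one_mul _).symm⟩
    | one => exact ⟨1, one_mem _, 1, one_mem _, (one_mul _).symm⟩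
    | mul x y _ _ hx hy =>
      obtain ⟨a, ha, b, hb, rfl⟩ := hx
      obtain ⟨a', ha', b', hb', rfl⟩ := hy
      refine ⟨a * a', mul_mem ha ha', b * b', mul_mem hb hb', ?_⟩
      have := (hAB a' ha' b hb).eq
      rw [mul_assoc a b, ← mul_assoc b a', ← this]
      simp only [mul_assoc]
    | inv x _ hx =>
      obtain ⟨a, ha, b, hb, rfl⟩ := hx
      refine ⟨a⁻¹, inv_mem ha, b⁻¹, inv_mem hb, ?_⟩
      rw [(hAB a ha b hb).eq, mul_inv_rev]
  have hA0 : ∀ a ∈ A, ∀ j, W a (Sum.inr j) = 0 := by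
    intro a ha j
    induction ha using Subgroup.closure_induction with
    | mem x hx =>
      obtain ⟨i, rfl⟩ := hx
      simp only [fa]; rw [hWg]; simp
    | one => rw [hV1]; rfl
    | mul x y _ _ hx hy => rw [hW, Pi.add_apply, hx, hy, add_zero]
    | inv x _ hx => rw [hVi, Pi.neg_apply, hx, neg_zero]
  have hB0 : ∀ a ∈ B, ∀ j, W a (Sum.inl j) = 0 := by
    intro a ha j
    induction ha using Subgroup.closure_induction with
    | mem x hx =>
      obtain ⟨i, rfl⟩ := hx
      simp only [fb]; rw [hWg]; simp
    | one => rw [hV1]; rfl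
    | mul x y _ _ hx hy => rw [hW, Pi.add_apply, hx, hy, add_zero]
    | inv x _ hx => rw [hVi, Pi.neg_apply, hx, neg_zero]
  have hsing : ∀ k, ∑ l, (Pi.single k 1 : ι ⊕ κ → ℤ) l = 1 := fun k => by
    rw [Finset.sum_eq_single k] <;> simp +contextual [Pi.single_apply]
  have hd : ∀ k l, ∃ d : P, ρ d = g k * (g l)⁻¹ := fun k l => by
    have : g k * (g l)⁻¹ ∈ ρ.range := by
      rw [hr, hW, hVi, hWg, hWg]
      simp only [Pi.add_apply, Pi.neg_apply, Finset.sum_add_distrib, Finset.sum_neg_distrib, hsing]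
      simp
    exact this
  choose d hd using hd
  obtain ⟨i0⟩ := ‹Nonempty ι›
  obtain ⟨j0⟩ := ‹Nonempty κ›
  have hker : ∀ x : P, W (ρ x) = 0 → Abelianization.of x = 1 := by
    intro x hx
    obtain ⟨a, ha, b, hb, e⟩ := hdec (ρ x)
    rw [e, hW] at hx
    have ha0 : ∀ i, W a (Sum.inl i) = 0 := fun i => by
      have := congrFun hx (Sum.inl i)
      rw [Pi.add_apply, hB0 b hb, add_zero] at this; exact this
    have hb0 : ∀ i, W b (Sum.inr i) = 0 := fun i => by
      have := congrFun hx (Sum.inr i)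
      rw [Pi.add_apply, hA0 a ha, zero_add] at this; exact this
    obtain ⟨-, h, h1, h2⟩ := alg1 ρ fa (g (Sum.inr j0)) (fun i => hcomm i j0) (fun x i => W x (Sum.inl i))
      (fun x y => by rw [hW]; rfl) (fun i => by funext k; simp only [fa, hWg]; simp [Pi.single_apply]) (fun i => d (Sum.inl i) (Sum.inr j0))
      (fun i => hd _ _) a ha
    obtain ⟨-, h', h1', h2'⟩ := alg1 ρ fb (g (Sum.inl i0)) (fun i => (hcomm i0 i).symm) (fun x i => W x (Sum.inr i))
      (fun x y => by rw [hW]; rfl) (fun i => by funext k; simp only [fb, hWg]; simp [Pi.single_apply]) (fun i => d (Sum.inr i) (Sum.inl i0))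
      (fun i => hd _ _) b hb
    simp only [ha0, hb0, Finset.sum_const_zero, neg_zero, zpow_zero, mul_one, Finset.prod_const_one] at h1 h2 h1' h2'
    have : x = h * h' := hρ (by rw [map_mul, h1, h1', e])
    rw [this, map_mul, h2, h2', one_mul]
  have hm : ∀ x : P, ∃ m : ℤ, ∑ k, W (ρ x) k = N * m := fun x => (hr _).1 ⟨x, rfl⟩
  choose m hm using hm
  let k0 : ι ⊕ κ := Sum.inl i0
  let θ : P →* Multiplicative (ι ⊕ κ → ℤ) := MonoidHom.mk' (fun x => Multiplicative.ofAdd (Function.update (W (ρ x)) k0 (m x))) (by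
    intro x y
    rw [← ofAdd_add]
    congr 1
    funext k
    by_cases hk : k = k0
    · subst hk
      simp only [Function.update_self, Pi.add_apply]
      apply mul_left_cancel₀ hN
      rw [mul_add, ← hm, ← hm, ← hm, map_mul, hW]
      simp only [Pi.add_apply, Finset.sum_add_distrib]
    · simp [Function.update_of_ne hk, hW])
  have hθ : ∀ x, θ x = Multiplicative.ofAdd (Function.update (W (ρ x)) k0 (m x)) := fun _ => rfl
  have hupd : ∀ (v : ι ⊕ κ → ℤ) c, ∑ k, Function.update v k0 c k = c + ∑ k ∈ Finset.univ.erase k0, v k := by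
    intro v c
    rw [← Finset.add_sum_erase _ _ (Finset.mem_univ k0), Function.update_self]
    congr 1
    exact Finset.sum_congr rfl fun k hk => Function.update_of_ne (Finset.ne_of_mem_erase hk) _ _
  have hθk : ∀ x, θ x = 1 → W (ρ x) = 0 := by
    intro x hx
    rw [hθ, ofAdd_eq_one] at hx
    have h1 : ∀ k, k ≠ k0 → W (ρ x) k = 0 := fun k hk => by
      have := congrFun hx k
      rwa [Function.update_of_ne hk] at this
    have h2 : m x = 0 := by
      have := congrFun hx k0
      rwa [Function.update_self] at this
    have h3 := hm x
    rw [← Finset.add_sum_erase _ _ (Finset.mem_univ k0), Finset.sum_eq_zero (s := Finset.univ.erase k0)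
      (fun k hk => h1 k (Finset.ne_of_mem_erase hk)), h2] at h3
    funext k
    by_cases hk : k = k0
    · rw [hk]; simpa using h3
    · exact h1 k hk
  have hWs : ∀ v : ι ⊕ κ → ℤ, ∃ x, W x = v := by
    intro v
    let H : AddSubgroup (ι ⊕ κ → ℤ) := AddSubgroup.mk ⟨⟨Set.range W, by
      rintro _ _ ⟨x, rfl⟩ ⟨y, rfl⟩; exact ⟨x * y, hW _ _⟩⟩, ⟨1, hV1⟩⟩ (by
      rintro _ ⟨x, rfl⟩; exact ⟨x⁻¹, hVi _⟩)
    have : v ∈ H := by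
      rw [← Finset.univ_sum_single v]
      apply sum_mem
      intro k _
      have h1 : Pi.single k (v k) = v k • (Pi.single k 1 : ι ⊕ κ → ℤ) := by
        rw [← Pi.single_smul]; simp
      rw [h1]
      exact zsmul_mem (show Pi.single k 1 ∈ H from ⟨g k, hWg k⟩) _
    exact this
  have hθs : Function.Surjective θ := by
    intro v
    let v' : ι ⊕ κ → ℤ := v.toAdd
    obtain ⟨y, hy⟩ := hWs (Function.update v' k0 (N * v' k0 - ∑ k ∈ Finset.univ.erase k0, v' k))
    have hy2 : ∑ k, W y k = N * v' k0 := by rw [hy, hupd]; ring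
    obtain ⟨x, rfl⟩ := (hr y).2 ⟨_, hy2⟩
    refine ⟨x, ?_⟩
    have h2 : m x = v' k0 := mul_left_cancel₀ hN (by rw [← hm, hy2])
    rw [hθ, h2, hy]
    change Multiplicative.ofAdd _ = Multiplicative.ofAdd v'
    congr 1
    funext k
    by_cases hk : k = k0
    · subst hk; simp
    · simp [Function.update_of_ne hk]
  let Θ : Abelianization P →* Multiplicative (ι ⊕ κ → ℤ) := Abelianization.lift θ
  have hΘ : ∀ x, Θ (Abelianization.of x) = θ x := fun x => Abelianization.lift_apply_of _ _
  have hbij : Function.Bijective Θ := by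
    constructor
    · rw [injective_iff_map_eq_one]
      intro y hy
      obtain ⟨x, rfl⟩ := QuotientGroup.mk_surjective y
      exact hker x (hθk x ((hΘ x).symm.trans hy))
    · intro v
      obtain ⟨x, hx⟩ := hθs v
      exact ⟨Abelianization.of x, (hΘ x).trans hx⟩
  exact ⟨AddEquiv.toMultiplicativeRight.symm (MulEquiv.ofBijective Θ hbij)⟩
end alg

end MF

end

noncomputable section

open scoped unitInterval Topology

namespace MF

section cover
variable {X E : Type*} [TopologicalSpace X] [TopologicalSpace E] (g : C(X, ℂ)) (hg : ∀ x, g x ≠ 0) (N : ℕ) (hN : N ≠ 0)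
  (pi : C(E, X)) (ze : C(E, ℂ)) (h1 : ∀ e, ze e ^ N * g (pi e) = 1)
  (mk : C({p : X × ℂ // p.2 ^ N * g p.1 = 1}, E)) (h2 : ∀ e, mk ⟨(pi e, ze e), h1 e⟩ = e) (h3 : ∀ p, pi (mk p) = p.1.1)

include hg hN h1 h2 in
lemma cover_inj (e0 : E) : Function.Injective (Lp.map pi (rfl : pi e0 = pi e0)) := by
  have hNc : (N : ℂ) ≠ 0 := Nat.cast_ne_zero.2 hN
  rw [injective_iff_map_eq_one]
  intro q hq
  obtain ⟨γ, rfl⟩ := cls_surj q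
  have hq' : cls (γ.map pi.continuous) = cls (Path.refl (pi e0)) := hq
  obtain ⟨H⟩ : (γ.map pi.continuous).Homotopic (Path.refl (pi e0)) := Quotient.exact hq'
  have hze : ∀ e, ze e ≠ 0 := fun e h => by
    have := h1 e; rw [h, zero_pow hN, zero_mul] at this; exact zero_ne_one this
  obtain ⟨lam, hlam, hl⟩ := exists_lift ze hze γ
  obtain ⟨L, hL, hLe⟩ := loglift2 (fun a => g (H (a.2, a.1))) (by fun_prop) (fun a => hg _)
  have hH0 : ∀ s, H (0, s) = pi (γ s) := fun s => by simp
  have hc : ∀ s, N * lam s + L (s, 0) = N * lam 0 + L (0, 0) := by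
    intro s
    have := log_unique (A := I) (L := fun s => N * lam s + L (s, 0)) (L' := fun _ => 0) (by fun_prop) (by fun_prop)
      (fun s => by rw [Complex.exp_zero, Complex.exp_add, Complex.exp_nat_mul, hl, hLe]; simp only [hH0]; exact h1 _) s 0
    simpa using this
  set c := N * lam 0 + L (0, 0) with hcdef
  have hec : Complex.exp c = 1 := by
    rw [hcdef, Complex.exp_add, Complex.exp_nat_mul, hl, hLe]; simp only [hH0]; exact h1 _
  have hmem : ∀ a : I × I, Complex.exp ((c - L a) / N) ^ N * g (H (a.2, a.1)) = 1 := by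
    intro a
    rw [← Complex.exp_nat_mul, mul_div_cancel₀ _ hNc, Complex.exp_sub, hec, hLe]
    exact div_mul_cancel₀ _ (hg _)
  have hmk : ∀ (x : X) (z : ℂ) (h : z ^ N * g x = 1) (e : E), x = pi e → z = ze e → mk ⟨(x, z), h⟩ = e := by
    rintro x z h e rfl rfl; exact h2 e
  have hb0 : ∀ t, L (0, t) = L (0, 0) := fun t => by
    have := log_unique (A := I) (L := fun t => L (0, t)) (L' := fun _ => L (0, 0)) (by fun_prop) (by fun_prop)
      (fun s => by rw [hLe, hLe]; simp) t 0
    simpa [sub_eq_zero] using this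
  have hb1 : ∀ t, L (1, t) = L (1, 0) := fun t => by
    have := log_unique (A := I) (L := fun t => L (1, t)) (L' := fun _ => L (1, 0)) (by fun_prop) (by fun_prop)
      (fun s => by rw [hLe, hLe]; simp) t 0
    simpa [sub_eq_zero] using this
  have ht : ∀ s, L (s, 1) = L (0, 1) := fun s => by
    have := log_unique (A := I) (L := fun s => L (s, 1)) (L' := fun _ => L (0, 1)) (by fun_prop) (by fun_prop)
      (fun s => by rw [hLe, hLe]; simp) s 0
    simpa [sub_eq_zero] using this
  have hz : ∀ s, Complex.exp ((c - L (s, 0)) / N) = ze (γ s) := fun s => by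
    rw [← hc s, add_sub_cancel_right, mul_div_cancel_left₀ _ hNc, hl]
  have hz0 : Complex.exp ((c - L (0, 0)) / N) = ze e0 := by rw [hz]; simp
  have hz1 : Complex.exp ((c - L (1, 0)) / N) = ze e0 := by rw [hz]; simp
  have : cls γ = cls (Path.refl e0) := by
    refine homot (fun a => mk ⟨(H (a.2, a.1), Complex.exp ((c - L a) / N)), hmem a⟩) ?_ γ (Path.refl e0) ?_ ?_ ?_ ?_
    · apply mk.continuous.comp
      apply Continuous.subtype_mk; fun_prop
    · intro t; exact hmk _ _ _ _ (by simp) (hz t)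
    · intro t; refine hmk _ _ _ _ (by simp) ?_
      simp only [Path.refl_apply]; rw [ht, hb0, hz0]
    · intro t; refine hmk _ _ _ _ (by simp) ?_
      rw [hb0, hz0]
    · intro t; refine hmk _ _ _ _ (by simp) ?_
      rw [hb1, hz1]
  exact this.trans cls_refl

include hN h1 h2 h3 in
lemma cover_range (e0 : E) (q : Lp (pi e0)) : q ∈ (Lp.map pi (rfl : pi e0 = pi e0)).range ↔
    ∃ m : ℤ, wnd g hg q = N * m * (2 * Real.pi * Complex.I) := by
  have hNc : (N : ℂ) ≠ 0 := Nat.cast_ne_zero.2 hN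
  have hze : ∀ e, ze e ≠ 0 := fun e h => by
    have := h1 e; rw [h, zero_pow hN, zero_mul] at this; exact zero_ne_one this
  constructor
  · rintro ⟨p, rfl⟩
    obtain ⟨m, hm⟩ := wnd_int ze hze p
    refine ⟨-m, ?_⟩
    obtain ⟨γ, rfl⟩ := cls_surj p
    obtain ⟨lam, hlam, hl⟩ := exists_lift ze hze γ
    rw [wnd_cls ze hze γ lam hlam hl] at hm
    have : wnd g hg (Lp.map pi (rfl : pi e0 = pi e0) (cls γ)) = -(N * lam 1) - -(N * lam 0) := by
      refine wnd_cls g hg (γ.map pi.continuous) (fun s => -(N * lam s)) (by fun_prop) (fun s => ?_)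
      rw [Complex.exp_neg, Complex.exp_nat_mul, hl]
      exact inv_eq_of_mul_eq_one_right (h1 _)
    rw [this]
    push_cast
    linear_combination -(N : ℂ) * hm
  · rintro ⟨m, hm⟩
    obtain ⟨γ, rfl⟩ := cls_surj q
    obtain ⟨L, hL, hLe⟩ := exists_lift g hg γ
    rw [wnd_cls g hg γ L hL hLe] at hm
    have hmem : ∀ s : I, (ze e0 * Complex.exp ((L 0 - L s) / N)) ^ N * g (γ s) = 1 := by
      intro s
      have h0 : g (pi e0) = Complex.exp (L 0) := by rw [hLe]; simp
      rw [mul_pow, ← Complex.exp_nat_mul, mul_div_cancel₀ _ hNc, Complex.exp_sub, ← h0, ← hLe, mul_assoc,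
        div_mul_cancel₀ _ (Complex.exp_ne_zero _)]
      exact h1 e0
    have hmk : ∀ (x : X) (z : ℂ) (h : z ^ N * g x = 1) (e : E), x = pi e → z = ze e → mk ⟨(x, z), h⟩ = e := by
      rintro x z h e rfl rfl; exact h2 e
    let δ : Path e0 e0 := 
      { toFun := fun s => mk ⟨(γ s, ze e0 * Complex.exp ((L 0 - L s) / N)), hmem s⟩
        continuous_toFun := by
          apply mk.continuous.comp
          apply Continuous.subtype_mk; fun_prop
        source' := by apply hmk <;> simp
        target' := by
          apply hmk
          · simp
          · have : (L 0 - L 1) / N = (-m : ℤ) * (2 * Real.pi * Complex.I) := by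
              rw [div_eq_iff hNc]; push_cast; linear_combination -hm
            rw [this, Complex.exp_int_mul_two_pi_mul_I, mul_one] }
    refine ⟨cls δ, ?_⟩
    change cls (δ.map pi.continuous) = cls γ
    congr 1
    apply Path.ext
    funext s
    exact h3 _
end cover

end MF

end

noncomputable section

open scoped unitInterval Topology

namespace MF

/-- change of base point -/
def cj {X : Type*} [TopologicalSpace X] {x y : X} (c : PQ x y) : Lp x →* Lp y :=
  MonoidHom.mk' (fun q => (c.symm ⬝ q ⬝ c : PQ y y)) (by
    intro p q
    rw [Lp.mul_def, Lp.mul_def]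
    simp only [t_assoc]
    rw [t_symm_assoc])

lemma cj_surj {X : Type*} [TopologicalSpace X] {x y : X} (c : PQ x y) : Function.Surjective (cj c) := by
  intro q
  refine ⟨(c ⬝ q ⬝ c.symm : PQ x x), ?_⟩
  change c.symm ⬝ (c ⬝ q ⬝ c.symm) ⬝ c = q
  simp only [t_assoc, symm_t_assoc, symm_t, t_refl]

lemma wnd_prod {X K : Type*} [TopologicalSpace X] [Fintype K] (f : K → C(X, ℂ)) (hf : ∀ k x, f k x ≠ 0) (c0 : ℂ) (hc0 : c0 ≠ 0)
    (g : C(X, ℂ)) (hg : ∀ x, g x ≠ 0) (h : ∀ x, g x = c0 * ∏ k, f k x) {x y : X} (q : PQ x y) :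
    wnd g hg q = ∑ k, wnd (f k) (hf k) q := by
  obtain ⟨γ, rfl⟩ := cls_surj q
  have := fun k => exists_lift (f k) (hf k) γ
  choose L hL hLe using this
  rw [wnd_cls g hg γ (fun s => Complex.log c0 + ∑ k, L k s) (by fun_prop)
    (fun s => by rw [Complex.exp_add, Complex.exp_log hc0, Complex.exp_sum, h]; simp only [hLe])]
  rw [add_sub_add_left_eq_sub, ← Finset.sum_sub_distrib]
  exact Finset.sum_congr rfl fun k _ => (wnd_cls (f k) (hf k) γ (L k) (hL k) (hLe k)).symm

section
variable {ι κ : Type*} [Fintype ι] [Fintype κ] [Nonempty ι] [Nonempty κ] {u μ : ι → ℂ} {w ν : κ → ℂ}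

theorem thmM (hμν : ∀ i j, μ i ≠ ν j) (hsep : Sep u μ w ν)
    (hu : ∀ i k, i ≠ k → (u k - u i).im ≠ 0) (hw : ∀ i k, i ≠ k → (w k - w i).im ≠ 0)
    (ht : ∀ i j k l, (i, j) ≠ (k, l) → (u k - w l - (u i - w j)).im ≠ 0)
    (h0 : Continuous (z0 (Zf u μ w ν))) {E : Type*} [TopologicalSpace E]
    (g : C(Tot (z0 (Zf u μ w ν)), ℂ)) (hg : ∀ x, g x ≠ 0) (c0 : ℂ) (hc0 : c0 ≠ 0)
    (hgp : ∀ x, g x = c0 * ∏ k, tof h0 k x) (N : ℕ) (hN : N ≠ 0)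
    (pi : C(E, Tot (z0 (Zf u μ w ν)))) (ze : C(E, ℂ)) (h1 : ∀ e, ze e ^ N * g (pi e) = 1)
    (mk : C({p : Tot (z0 (Zf u μ w ν)) × ℂ // p.2 ^ N * g p.1 = 1}, E)) (h2 : ∀ e, mk ⟨(pi e, ze e), h1 e⟩ = e)
    (h3 : ∀ p, pi (mk p) = p.1.1) (e0 : E) :
    Nonempty (Additive (Abelianization (FundamentalGroup E e0)) ≃+ (ι ⊕ κ → ℤ)) := by
  classical
  obtain ⟨x₀, a, a1, a2, a3, a4⟩ := thmG hμν hsep hu hw ht h0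
  let S := bigS (z0 (Zf u μ w ν)) h0 1 one_pos
  obtain ⟨c⟩ : Nonempty (PQ x₀ (pi e0)) := by
    obtain ⟨p⟩ := tot_path S 0 x₀ ⟨cls (PathConnectedSpace.somePath _ _)⟩
    obtain ⟨q⟩ := tot_path S 0 (pi e0) ⟨cls (PathConnectedSpace.somePath _ _)⟩
    exact ⟨p.symm ⬝ q⟩
  have h2pi : (2 * Real.pi * Complex.I : ℂ) ≠ 0 := Complex.two_pi_I_ne_zero
  have hWex : ∀ (q : Lp (pi e0)) (k : ι ⊕ κ), ∃ m : ℤ, tw h0 k q = m * (2 * Real.pi * Complex.I) := fun q k => wnd_int _ _ q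
  choose W hW using hWex
  have inj : ∀ m m' : ℤ, (m : ℂ) * (2 * Real.pi * Complex.I) = m' * (2 * Real.pi * Complex.I) → m = m' := fun m m' h => by
    exact_mod_cast mul_right_cancel₀ h2pi h
  have htc : ∀ (q : Lp x₀) k, tw h0 k (cj c q) = tw h0 k q := by
    intro q k
    change tw h0 k (c.symm ⬝ q ⬝ c) = _
    rw [tw_trans, tw_trans, tw_symm]; ring
  obtain ⟨Θ⟩ := alg (Lp.map pi (rfl : pi e0 = pi e0)) (fun k => cj c (a k)) (by
      have := cj_surj c
      rw [← MonoidHom.range_eq_top] at this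
      rw [← this, MonoidHom.range_eq_map, ← a1, MonoidHom.map_closure, ← Set.range_comp]
      rfl) (fun i j => (a4 i j).map _) W (by
      intro x y
      funext k
      apply inj
      rw [← hW, Pi.add_apply]
      push_cast
      rw [add_mul, ← hW, ← hW]
      exact wnd_mul _ _ _ _) (by
      intro k
      funext l
      apply inj
      rw [← hW, htc]
      by_cases hkl : k = l
      · subst hkl; rw [a2]; simp
      · rw [a3 _ _ hkl, Pi.single_eq_of_ne (Ne.symm hkl)]; simp)
    (cover_inj g hg N hN pi ze h1 mk h2 e0) (N : ℤ) (by exact_mod_cast hN) (by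
      intro x
      rw [cover_range g hg N hN pi ze h1 mk h2 h3 e0]
      have : wnd g hg x = ((∑ k, W x k : ℤ) : ℂ) * (2 * Real.pi * Complex.I) := by
        rw [wnd_prod (fun k => tof h0 k) (fun k => tof_ne h0 k) c0 hc0 g hg hgp]
        push_cast
        rw [Finset.sum_mul]
        exact Finset.sum_congr rfl fun k _ => hW x k
      rw [this]
      constructor
      · rintro ⟨m, hm⟩
        exact ⟨m, inj _ _ (by rw [hm]; push_cast; ring)⟩
      · rintro ⟨m, hm⟩
        exact ⟨m, by rw [hm]; push_cast; ring⟩)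
  exact ⟨(MulEquiv.toAdditive (fgEquiv e0).abelianizationCongr).trans Θ⟩
end

end MF

end

noncomputable section

open scoped unitInterval Topology

namespace MF

lemma avoid {J : Type*} [Countable J] (bad : J → Set ℂ) (h : ∀ j, (bad j).Subsingleton) : ∃ z, ∀ j, z ∉ bad j := by
  have hc : (⋃ j, bad j).Countable := Set.countable_iUnion fun j => (h j).countable
  obtain ⟨z, hz⟩ := (hc.dense_compl ℝ).nonempty
  exact ⟨z, fun j hj => hz (Set.mem_iUnion.2 ⟨j, hj⟩)⟩

lemma avoidR {J : Type*} [Countable J] (bad : J → Set ℝ) (h : ∀ j, (bad j).Subsingleton) : ∃ z, ∀ j, z ∉ bad j := by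
  have hc : (⋃ j, bad j).Countable := Set.countable_iUnion fun j => (h j).countable
  obtain ⟨z, hz⟩ := (hc.dense_compl ℝ).nonempty
  exact ⟨z, fun j hj => hz (Set.mem_iUnion.2 ⟨j, hj⟩)⟩

lemma line_uniq {p q c p' q' c' : ℂ} (h' : ¬(p' = 0 ∧ q' = 0)) (hne : ∀ t : ℂ, ![p, q, c] ≠ t • ![p', q', c'])
    {x y x' y' : ℂ} (h1 : p * x + q * y + c = 0) (h2 : p' * x + q' * y + c' = 0)
    (h3 : p * x' + q * y' + c = 0) (h4 : p' * x' + q' * y' + c' = 0) : x = x' ∧ y = y' := by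
  by_contra hcon
  have hdet : p * q' = p' * q := by
    have e1 : (p * q' - p' * q) * (x - x') = 0 := by linear_combination q' * (h1 - h3) - q * (h2 - h4)
    have e2 : (p * q' - p' * q) * (y - y') = 0 := by linear_combination p * (h2 - h4) - p' * (h1 - h3)
    by_contra hd
    have hd' := sub_ne_zero.2 hd
    exact hcon ⟨sub_eq_zero.1 ((mul_eq_zero.1 e1).resolve_left hd'), sub_eq_zero.1 ((mul_eq_zero.1 e2).resolve_left hd')⟩
  by_cases hp : p' = 0
  · have hq : q' ≠ 0 := fun h => h' ⟨hp, h⟩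
    have hp0 : p = 0 := by
      rw [hp, zero_mul] at hdet; exact (mul_eq_zero.1 hdet).resolve_right hq
    apply hne (q / q')
    have : c = q / q' * c' := by
      rw [div_mul_eq_mul_div, eq_div_iff hq]
      rw [hp0] at h1; rw [hp] at h2
      linear_combination q' * h1 - q * h2
    simp [hp, hp0, hq, ← this]
  · apply hne (p / p')
    have e1 : c = p / p' * c' := by
      rw [div_mul_eq_mul_div, eq_div_iff hp]
      linear_combination p' * h1 - p * h2 + y * hdet
    have e2 : q = p / p' * q' := by
      rw [div_mul_eq_mul_div, eq_div_iff hp]; linear_combination -hdet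
    simp [hp, ← e1, ← e2]

lemma det_uniq {p q c p' q' c' : ℂ} (hd : p * q' - q * p' ≠ 0)
    {x y x' y' : ℂ} (h1 : p * x + q * y + c = 0) (h2 : p' * x + q' * y + c' = 0)
    (h3 : p * x' + q * y' + c = 0) (h4 : p' * x' + q' * y' + c' = 0) : x = x' ∧ y = y' := by
  have e1 : (p * q' - q * p') * (x - x') = 0 := by linear_combination q' * (h1 - h3) - q * (h2 - h4)
  have e2 : (p * q' - q * p') * (y - y') = 0 := by linear_combination p * (h2 - h4) - p' * (h1 - h3)
  exact ⟨sub_eq_zero.1 ((mul_eq_zero.1 e1).resolve_left hd), sub_eq_zero.1 ((mul_eq_zero.1 e2).resolve_left hd)⟩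

/-- slope -/
def mf {J : Type*} (p q : J → ℂ) (k o : ℂ) : J → ℂ := fun i => -(o * q i) / (p i + k * q i)
/-- intercept -/
def uf {J : Type*} (p q c : J → ℂ) (k y0 o : ℂ) : J → ℂ := fun i => -(o * (c i + q i * y0)) / (p i + k * q i)

lemma uf_mf {J : Type*} {p q : J → ℂ} (c : J → ℂ) {k : ℂ} (y0 : ℂ) {o : ℂ} (ho : o ≠ 0) {i : J} (hi : p i + k * q i ≠ 0) (X Y : ℂ) :
    p i * (X / o) + q i * (k * (X / o) + Y + y0) + c i = (p i + k * q i) / o * (X - (uf p q c k y0 o i + mf p q k o i * Y)) := by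
  have hD : p i = (p i + k * q i) - k * q i := by ring
  simp only [uf, mf]
  generalize p i + k * q i = D at hi hD ⊢
  rw [hD]
  field_simp
  ring

lemma line_zero {J : Type*} {p q : J → ℂ} (c : J → ℂ) {k : ℂ} (y0 : ℂ) {o : ℂ} (ho : o ≠ 0) {i : J} (hi : p i + k * q i ≠ 0) (X Y : ℂ) :
    X = uf p q c k y0 o i + mf p q k o i * Y ↔ p i * (X / o) + q i * (k * (X / o) + Y + y0) + c i = 0 := by
  rw [uf_mf c y0 ho hi, mul_eq_zero, or_iff_right (div_ne_zero hi ho), sub_eq_zero]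

section coords
variable {d₁ d₂ : ℕ} (p q c : Fin d₁ → ℂ) (r s e : Fin d₂ → ℂ)
    (hα : ∀ i, ¬(p i = 0 ∧ q i = 0))
    (hβ : ∀ j, ¬(r j = 0 ∧ s j = 0))
    (hαdist : ∀ i i' : Fin d₁, i ≠ i' → ∀ t : ℂ,
      ![p i, q i, c i] ≠ t • ![p i', q i', c i'])
    (hβdist : ∀ j j' : Fin d₂, j ≠ j' → ∀ t : ℂ,
      ![r j, s j, e j] ≠ t • ![r j', s j', e j'])
    (htransverse : ∀ (i : Fin d₁) (j : Fin d₂), p i * s j - q i * r j ≠ 0)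
    (mpt : Fin d₁ → Fin d₂ → ℂ × ℂ)
    (hmpt : ∀ i j, p i * (mpt i j).1 + q i * (mpt i j).2 + c i = 0 ∧
                   r j * (mpt i j).1 + s j * (mpt i j).2 + e j = 0)
    (hmdist : Function.Injective fun ij : Fin d₁ × Fin d₂ => mpt ij.1 ij.2)

lemma dir_sub {a b : ℂ} (h : ¬(a = 0 ∧ b = 0)) : {k : ℂ | a + k * b = 0}.Subsingleton := by
  intro k hk k' hk'
  have h1 : a + k * b = 0 := hk
  have h2 : a + k' * b = 0 := hk'
  have hb : b ≠ 0 := fun hb => h ⟨by simpa [hb] using h1, hb⟩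
  exact mul_right_cancel₀ hb (by linear_combination h1 - h2)

lemma sep_sub {m m' : ℂ × ℂ} (h : m ≠ m') : {k : ℂ | m.2 - k * m.1 = m'.2 - k * m'.1}.Subsingleton := by
  intro k hk k' hk'
  have h1 : m.2 - k * m.1 = m'.2 - k * m'.1 := hk
  have h2 : m.2 - k' * m.1 = m'.2 - k' * m'.1 := hk'
  have hb : m.1 - m'.1 ≠ 0 := fun hb => h (Prod.ext (sub_eq_zero.1 hb) (by
    have := sub_eq_zero.1 hb
    rw [this] at h1; linear_combination h1))
  exact mul_right_cancel₀ hb (by linear_combination h2 - h1)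

include hα hβ hαdist hβdist htransverse hmpt hmdist in
lemma exists_k : ∃ k : ℂ, (∀ i, p i + k * q i ≠ 0) ∧ (∀ j, r j + k * s j ≠ 0) ∧
    (∀ i j i' j', (i, j) ≠ (i', j') → (mpt i j).2 - k * (mpt i j).1 ≠ (mpt i' j').2 - k * (mpt i' j').1) ∧
    (∀ i i' a b, i ≠ i' → ∀ x y, p i * x + q i * y + c i = 0 → p i' * x + q i' * y + c i' = 0 →
      (mpt a b).2 - k * (mpt a b).1 ≠ y - k * x) ∧
    (∀ i i' a b, i ≠ i' → ∀ x y, r i * x + s i * y + e i = 0 → r i' * x + s i' * y + e i' = 0 →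
      (mpt a b).2 - k * (mpt a b).1 ≠ y - k * x) := by
  obtain ⟨k, hk⟩ := avoid (J := Fin d₁ ⊕ Fin d₂ ⊕ {x : (Fin d₁ × Fin d₂) × (Fin d₁ × Fin d₂) // x.1 ≠ x.2} ⊕
      ({x : Fin d₁ × Fin d₁ // x.1 ≠ x.2} × (Fin d₁ × Fin d₂)) ⊕ ({x : Fin d₂ × Fin d₂ // x.1 ≠ x.2} × (Fin d₁ × Fin d₂)))
    (Sum.elim (fun i => {k | p i + k * q i = 0}) (Sum.elim (fun j => {k | r j + k * s j = 0})
      (Sum.elim (fun x => {k | (mpt x.1.1.1 x.1.1.2).2 - k * (mpt x.1.1.1 x.1.1.2).1 = (mpt x.1.2.1 x.1.2.2).2 - k * (mpt x.1.2.1 x.1.2.2).1})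
      (Sum.elim (fun z => {k | ∃ x y, p z.1.1.1 * x + q z.1.1.1 * y + c z.1.1.1 = 0 ∧ p z.1.1.2 * x + q z.1.1.2 * y + c z.1.1.2 = 0 ∧
          (mpt z.2.1 z.2.2).2 - k * (mpt z.2.1 z.2.2).1 = y - k * x})
        (fun z => {k | ∃ x y, r z.1.1.1 * x + s z.1.1.1 * y + e z.1.1.1 = 0 ∧ r z.1.1.2 * x + s z.1.1.2 * y + e z.1.1.2 = 0 ∧
          (mpt z.2.1 z.2.2).2 - k * (mpt z.2.1 z.2.2).1 = y - k * x}))))) (by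
      rintro (i | j | ⟨x, hx⟩ | ⟨⟨⟨i, i'⟩, hi⟩, a, b⟩ | ⟨⟨⟨i, i'⟩, hi⟩, a, b⟩)
      · exact dir_sub (hα i)
      · exact dir_sub (hβ j)
      · exact sep_sub (fun h => hx (hmdist h))
      · rintro k ⟨x, y, h1, h2, h3⟩ k' ⟨x', y', h1', h2', h3'⟩
        obtain ⟨rfl, rfl⟩ := line_uniq (hα _) (hαdist i i' hi) h1 h2 h1' h2'
        refine sep_sub (m := mpt a b) (m' := (x, y)) ?_ h3 h3'
        intro hm
        have : ∀ z, p z * x + q z * y + c z = 0 → z = a := by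
          intro z hz
          by_contra hza
          obtain ⟨g1, g2⟩ := hmpt a b
          rw [hm] at g1 g2
          obtain ⟨f1, f2⟩ := hmpt z b
          have hzb := det_uniq (htransverse z b) f1 f2 hz g2
          apply hza
          have h5 : mpt z b = mpt a b := by rw [hm]; exact Prod.ext hzb.1 hzb.2
          exact congrArg Prod.fst (@hmdist (z, b) (a, b) h5)
        exact hi ((this _ h1).trans (this _ h2).symm)
      · rintro k ⟨x, y, h1, h2, h3⟩ k' ⟨x', y', h1', h2', h3'⟩
        obtain ⟨rfl, rfl⟩ := line_uniq (hβ _) (hβdist i i' hi) h1 h2 h1' h2'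
        refine sep_sub (m := mpt a b) (m' := (x, y)) ?_ h3 h3'
        intro hm
        have : ∀ z, r z * x + s z * y + e z = 0 → z = b := by
          intro z hz
          by_contra hza
          obtain ⟨g1, g2⟩ := hmpt a b
          rw [hm] at g1 g2
          obtain ⟨f1, f2⟩ := hmpt a z
          have hzb := det_uniq (htransverse a z) f1 f2 g1 hz
          apply hza
          have h5 : mpt a z = mpt a b := by rw [hm]; exact Prod.ext hzb.1 hzb.2
          exact congrArg Prod.snd (@hmdist (a, z) (a, b) h5)
        exact hi ((this _ h1).trans (this _ h2).symm))
  refine ⟨k, fun i => hk (Sum.inl i), fun j => hk (Sum.inr (Sum.inl j)), fun i j i' j' h =>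
    hk (Sum.inr (Sum.inr (Sum.inl ⟨((i, j), (i', j')), h⟩))), fun i i' a b h x y h1 h2 h3 => 
    hk (Sum.inr (Sum.inr (Sum.inr (Sum.inl (⟨(i, i'), h⟩, (a, b)))))) ⟨x, y, h1, h2, h3⟩, fun i i' a b h x y h1 h2 h3 => 
    hk (Sum.inr (Sum.inr (Sum.inr (Sum.inr (⟨(i, i'), h⟩, (a, b)))))) ⟨x, y, h1, h2, h3⟩⟩

include hα hβ hαdist hβdist htransverse hmpt hmdist in
theorem coords : ∃ k y0 o : ℂ, o ≠ 0 ∧ (∀ i, p i + k * q i ≠ 0) ∧ (∀ j, r j + k * s j ≠ 0) ∧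
    (∀ i j, mf p q k o i ≠ mf r s k o j) ∧
    Sep (uf p q c k y0 o) (mf p q k o) (uf r s e k y0 o) (mf r s k o) ∧
    (∀ i i', i ≠ i' → (uf p q c k y0 o i' - uf p q c k y0 o i).im ≠ 0) ∧
    (∀ i i', i ≠ i' → (uf r s e k y0 o i' - uf r s e k y0 o i).im ≠ 0) ∧
    (∀ i j i' j', (i, j) ≠ (i', j') → (uf p q c k y0 o i' - uf r s e k y0 o j' - (uf p q c k y0 o i - uf r s e k y0 o j)).im ≠ 0) := by
  obtain ⟨k, k1, k2, k3, k4, k5⟩ := exists_k p q c r s e hα hβ hαdist hβdist htransverse mpt hmpt hmdist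
  have one : (1 : ℂ) ≠ 0 := one_ne_zero
  obtain ⟨y0, hy⟩ := avoid (J := {x : Fin d₁ × Fin d₁ // x.1 ≠ x.2} ⊕ {x : Fin d₂ × Fin d₂ // x.1 ≠ x.2} ⊕
      {x : (Fin d₁ × Fin d₂) × (Fin d₁ × Fin d₂) // x.1 ≠ x.2})
    (Sum.elim (fun z => {y | uf p q c k y 1 z.1.1 = uf p q c k y 1 z.1.2}) (Sum.elim
      (fun z => {y | uf r s e k y 1 z.1.1 = uf r s e k y 1 z.1.2})
      (fun z => {y | uf p q c k y 1 z.1.2.1 - uf r s e k y 1 z.1.2.2 = uf p q c k y 1 z.1.1.1 - uf r s e k y 1 z.1.1.2}))) (by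
      have ev : ∀ {n : ℕ} (p q c : Fin n → ℂ) (i : Fin n) (hi : p i + k * q i ≠ 0) (y x : ℂ), x = uf p q c k y 1 i ↔
          p i * x + q i * (k * x + y) + c i = 0 := by
        intro n p q c i hi y x
        have := line_zero c y one hi x 0
        simpa using this
      rintro (⟨⟨i, j⟩, hij⟩ | ⟨⟨i, j⟩, hij⟩ | ⟨⟨⟨i, j⟩, ⟨i', j'⟩⟩, hij⟩)
      · intro y hy y' hy'
        have a1 := (ev p q c i (k1 i) y _).1 rfl
        have a2 := (ev p q c j (k1 j) y (uf p q c k y 1 i)).1 hy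
        have a3 := (ev p q c i (k1 i) y' _).1 rfl
        have a4 := (ev p q c j (k1 j) y' (uf p q c k y' 1 i)).1 hy'
        obtain ⟨b1, b2⟩ := line_uniq (hα _) (hαdist i j hij) a1 a2 a3 a4
        rw [b1] at b2
        exact add_left_cancel b2
      · intro y hy y' hy'
        have a1 := (ev r s e i (k2 i) y _).1 rfl
        have a2 := (ev r s e j (k2 j) y (uf r s e k y 1 i)).1 hy
        have a3 := (ev r s e i (k2 i) y' _).1 rfl
        have a4 := (ev r s e j (k2 j) y' (uf r s e k y' 1 i)).1 hy'
        obtain ⟨b1, b2⟩ := line_uniq (hβ _) (hβdist i j hij) a1 a2 a3 a4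
        rw [b1] at b2
        exact add_left_cancel b2
      · intro y hy y' hy'
        by_contra hne
        have hy1 : uf p q c k y 1 i' - uf r s e k y 1 j' = uf p q c k y 1 i - uf r s e k y 1 j := hy
        have hy2 : uf p q c k y' 1 i' - uf r s e k y' 1 j' = uf p q c k y' 1 i - uf r s e k y' 1 j := hy'
        have lin : ∀ {n : ℕ} (p q c : Fin n → ℂ) (i : Fin n) (y : ℂ), uf p q c k y 1 i = uf p q c k 0 1 i + mf p q k 1 i * y := by
          intro n p q c i y
          simp only [uf, mf]; ring
        rw [lin p q c i, lin p q c i', lin r s e j, lin r s e j'] at hy1 hy2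
        have sl : mf p q k 1 i' - mf r s k 1 j' = mf p q k 1 i - mf r s k 1 j :=
          mul_right_cancel₀ (sub_ne_zero.2 hne) (by linear_combination hy1 - hy2)
        have hz : ∀ z, uf p q c k z 1 i' - uf r s e k z 1 j' = uf p q c k z 1 i - uf r s e k z 1 j := by
          intro z
          rw [lin p q c i, lin p q c i', lin r s e j, lin r s e j']
          linear_combination hy1 + (z - y) * sl
        obtain ⟨m1, m2⟩ := hmpt i j
        let Y := (mpt i j).2 - k * (mpt i j).1
        have c1 := (ev p q c i (k1 i) Y (mpt i j).1).2 (by simp only [Y]; linear_combination m1)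
        have c2 := (ev r s e j (k2 j) Y (mpt i j).1).2 (by simp only [Y]; linear_combination m2)
        have c3 := hz Y
        rw [← c1, ← c2, sub_self, sub_eq_zero] at c3
        have a1 := (ev p q c i' (k1 i') Y _).1 rfl
        have a2 := (ev r s e j' (k2 j') Y _).1 c3
        obtain ⟨n1, n2⟩ := hmpt i' j'
        obtain ⟨b1, b2⟩ := det_uniq (htransverse i' j') n1 n2 a1 a2
        apply k3 i j i' j' hij
        rw [b2, b1]; simp only [Y]; ring)
  have y1 : ∀ i i', i ≠ i' → uf p q c k y0 1 i' - uf p q c k y0 1 i ≠ 0 := fun i i' h =>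
    sub_ne_zero.2 (fun h' => hy (Sum.inl ⟨(i, i'), h⟩) h'.symm)
  have y2 : ∀ i i', i ≠ i' → uf r s e k y0 1 i' - uf r s e k y0 1 i ≠ 0 := fun i i' h =>
    sub_ne_zero.2 (fun h' => hy (Sum.inr (Sum.inl ⟨(i, i'), h⟩)) h'.symm)
  have y3 : ∀ i j i' j', (i, j) ≠ (i', j') → uf p q c k y0 1 i' - uf r s e k y0 1 j' - (uf p q c k y0 1 i - uf r s e k y0 1 j) ≠ 0 :=
    fun i j i' j' h => sub_ne_zero.2 (hy (Sum.inr (Sum.inr ⟨((i, j), (i', j')), h⟩)))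
  have rot : ∀ v : ℂ, v ≠ 0 → {t : ℝ | ((1 + t * Complex.I) * v).im = 0}.Subsingleton := by
    intro v hv t ht t' ht'
    have h1 : ((1 + t * Complex.I) * v).im = 0 := ht
    have h2 : ((1 + t' * Complex.I) * v).im = 0 := ht'
    simp at h1 h2
    have hre : v.re ≠ 0 := fun h => hv (Complex.ext h (by simpa [h] using h1))
    exact mul_right_cancel₀ hre (by linear_combination h1 - h2)
  obtain ⟨t, ht⟩ := avoidR (J := {x : Fin d₁ × Fin d₁ // x.1 ≠ x.2} ⊕ {x : Fin d₂ × Fin d₂ // x.1 ≠ x.2} ⊕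
      {x : (Fin d₁ × Fin d₂) × (Fin d₁ × Fin d₂) // x.1 ≠ x.2})
    (Sum.elim (fun z => {t | ((1 + t * Complex.I) * (uf p q c k y0 1 z.1.2 - uf p q c k y0 1 z.1.1)).im = 0}) (Sum.elim
      (fun z => {t | ((1 + t * Complex.I) * (uf r s e k y0 1 z.1.2 - uf r s e k y0 1 z.1.1)).im = 0})
      (fun z => {t | ((1 + t * Complex.I) * (uf p q c k y0 1 z.1.2.1 - uf r s e k y0 1 z.1.2.2 -
        (uf p q c k y0 1 z.1.1.1 - uf r s e k y0 1 z.1.1.2))).im = 0}))) (by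
      rintro (⟨⟨i, j⟩, hij⟩ | ⟨⟨i, j⟩, hij⟩ | ⟨⟨⟨i, j⟩, ⟨i', j'⟩⟩, hij⟩)
      · exact rot _ (y1 _ _ hij)
      · exact rot _ (y2 _ _ hij)
      · exact rot _ (y3 _ _ _ _ hij))
  let o : ℂ := 1 + t * Complex.I
  have ho : o ≠ 0 := fun h => by
    have := congrArg Complex.re h
    simp [o] at this
  have sc : ∀ {n : ℕ} (p q c : Fin n → ℂ) (i : Fin n), uf p q c k y0 o i = o * uf p q c k y0 1 i := by
    intro n p q c i; simp only [uf]; ring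
  refine ⟨k, y0, o, ho, k1, k2, ?_, ?_, ?_, ?_, ?_⟩
  · intro i j h
    simp only [mf] at h
    rw [div_eq_div_iff (k1 i) (k2 j)] at h
    apply htransverse i j
    exact mul_left_cancel₀ ho (by linear_combination h)
  · intro Y i j h
    have key : ∀ i j, uf p q c k y0 o i + mf p q k o i * Y = uf r s e k y0 o j + mf r s k o j * Y →
        (mpt i j).2 - k * (mpt i j).1 = Y + y0 := by
      intro i j h
      have a1 := (line_zero c y0 ho (k1 i) _ Y).1 rfl
      have a2 := (line_zero e y0 ho (k2 j) _ Y).1 h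
      obtain ⟨n1, n2⟩ := hmpt i j
      obtain ⟨b1, b2⟩ := det_uniq (htransverse i j) n1 n2 a1 a2
      rw [b2, b1]; ring
    have h0 := key i j h
    refine ⟨fun i' j' h' => ?_, fun i' i'' hne h' => ?_, fun i' i'' hne h' => ?_⟩
    · by_contra hcon
      refine k3 i' j' i j (fun h => hcon (Prod.mk.inj h)) ?_
      rw [h0, key i' j' h']
    · have a1 := (line_zero c y0 ho (k1 i') _ Y).1 rfl
      have a2 := (line_zero c y0 ho (k1 i'') _ Y).1 h'
      apply k4 i' i'' i j hne _ _ a1 a2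
      rw [h0]; ring
    · have a1 := (line_zero e y0 ho (k2 i') _ Y).1 rfl
      have a2 := (line_zero e y0 ho (k2 i'') _ Y).1 h'
      apply k5 i' i'' i j hne _ _ a1 a2
      rw [h0]; ring
  · intro i i' h
    rw [sc, sc, ← mul_sub]
    exact ht (Sum.inl ⟨(i, i'), h⟩)
  · intro i i' h
    rw [sc, sc, ← mul_sub]
    exact ht (Sum.inr (Sum.inl ⟨(i, i'), h⟩))
  · intro i j i' j' h
    rw [sc, sc, sc, sc, ← mul_sub, ← mul_sub, ← mul_sub]
    exact ht (Sum.inr (Sum.inr ⟨((i, j), (i', j')), h⟩))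
end coords

end MF

end

open MF

theorem milnor_fiber_homology_of_general_position_union
    (d₁ d₂ : ℕ) (hd₁ : 1 ≤ d₁) (hd₂ : 1 ≤ d₂)
    (p q c : Fin d₁ → ℂ) (r s e : Fin d₂ → ℂ)
    (hα : ∀ i, ¬(p i = 0 ∧ q i = 0))
    (hβ : ∀ j, ¬(r j = 0 ∧ s j = 0))
    (hαdist : ∀ i i' : Fin d₁, i ≠ i' → ∀ t : ℂ,
      ![p i, q i, c i] ≠ t • ![p i', q i', c i'])
    (hβdist : ∀ j j' : Fin d₂, j ≠ j' → ∀ t : ℂ,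
      ![r j, s j, e j] ≠ t • ![r j', s j', e j'])
    (hαβdist : ∀ (i : Fin d₁) (j : Fin d₂), ∀ t : ℂ,
      ![p i, q i, c i] ≠ t • ![r j, s j, e j])
    (htransverse : ∀ (i : Fin d₁) (j : Fin d₂), p i * s j - q i * r j ≠ 0)
    (mpt : Fin d₁ → Fin d₂ → ℂ × ℂ)
    (hmpt : ∀ i j, p i * (mpt i j).1 + q i * (mpt i j).2 + c i = 0 ∧
                   r j * (mpt i j).1 + s j * (mpt i j).2 + e j = 0)
    (hmdist : Function.Injective fun ij : Fin d₁ × Fin d₂ => mpt ij.1 ij.2)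
    (Q : (Fin 3 → ℂ) → ℂ)
    (hQ : ∀ w, Q w = w 2 * (∏ i, (p i * w 0 + q i * w 1 + c i * w 2)) *
                      ∏ j, (r j * w 0 + s j * w 1 + e j * w 2))
    (F : Set (Fin 3 → ℂ)) (hF : F = {w | Q w = 1})
    (w₀ : F) :
    Nonempty (Additive (Abelianization (FundamentalGroup F w₀)) ≃+ (Fin (d₁ + d₂) → ℤ)) := by
  obtain ⟨k, y0, o, ho, k1, k2, hμν, hsep, hu, hw, ht⟩ :=
    coords p q c r s e hα hβ hαdist hβdist htransverse mpt hmpt hmdist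
  have : Nonempty (Fin d₁) := ⟨⟨0, hd₁⟩⟩
  have : Nonempty (Fin d₂) := ⟨⟨0, hd₂⟩⟩
  have h0 : Continuous (z0 (Zf (uf p q c k y0 o) (mf p q k o) (uf r s e k y0 o) (mf r s k o))) := by
    unfold z0
    exact (Zf_cont _ _ _ _).comp (by fun_prop)
  have main := @thmM _ _ _ _ _ _ _ _ _ _ hμν hsep hu hw ht h0 F _
  have zl : ∀ Y i, z0 (Zf (uf p q c k y0 o) (mf p q k o) (uf r s e k y0 o) (mf r s k o)) Y (Sum.inl i) =
    uf p q c k y0 o i + mf p q k o i * Y := fun Y i => rfl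
  have zr : ∀ Y j, z0 (Zf (uf p q c k y0 o) (mf p q k o) (uf r s e k y0 o) (mf r s k o)) Y (Sum.inr j) =
    uf r s e k y0 o j + mf r s k o j * Y := fun Y i => add_zero _
  generalize z0 (Zf (uf p q c k y0 o) (mf p q k o) (uf r s e k y0 o) (mf r s k o)) = z at *
  let c0 : ℂ := (∏ i, (p i + k * q i) / o) * ∏ j, (r j + k * s j) / o
  have hc0 : c0 ≠ 0 := mul_ne_zero (Finset.prod_ne_zero_iff.2 fun i _ => div_ne_zero (k1 i) ho)
    (Finset.prod_ne_zero_iff.2 fun i _ => div_ne_zero (k2 i) ho)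
  have fl : ∀ i X Y ζ, p i * (ζ * (X / o)) + q i * (ζ * (k * (X / o) + Y + y0)) + c i * ζ =
      ζ * ((p i + k * q i) / o * (X - z Y (Sum.inl i))) := by
    intro i X Y ζ
    rw [zl, ← uf_mf c y0 ho (k1 i)]; ring
  have fr : ∀ i X Y ζ, r i * (ζ * (X / o)) + s i * (ζ * (k * (X / o) + Y + y0)) + e i * ζ =
      ζ * ((r i + k * s i) / o * (X - z Y (Sum.inr i))) := by
    intro i X Y ζ
    rw [zr, ← uf_mf e y0 ho (k2 i)]; ring
  have hQv : ∀ X Y ζ, Q ![ζ * (X / o), ζ * (k * (X / o) + Y + y0), ζ] =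
      ζ ^ (d₁ + d₂ + 1) * (c0 * ∏ a, (X - z Y a)) := by
    intro X Y ζ
    rw [hQ]
    simp only [Matrix.cons_val]
    simp only [fl, fr, Finset.prod_mul_distrib, Fintype.prod_sum_type, Finset.prod_const, Finset.card_univ, Fintype.card_fin, c0]
    ring
  have hone : ∀ w : F, Q w.1 = 1 := fun w => (Set.ext_iff.1 hF w.1).1 w.2
  have w2 : ∀ w : F, w.1 2 ≠ 0 := by
    intro w h
    have := hone w
    rw [hQ, h] at this; simp at this
  have wv : ∀ w : F, w.1 = ![w.1 2 * ((o * (w.1 0 / w.1 2)) / o), w.1 2 * (k * ((o * (w.1 0 / w.1 2)) / o) +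
      (w.1 1 / w.1 2 - k * (w.1 0 / w.1 2) - y0) + y0), w.1 2] := by
    intro w
    have h := w2 w
    funext a
    fin_cases a
    · simp; field_simp
    · simp; field_simp; ring
    · simp
  have hq1 : ∀ w : F, w.1 2 ^ (d₁ + d₂ + 1) * (c0 * ∏ a, (o * (w.1 0 / w.1 2) - z (w.1 1 / w.1 2 - k * (w.1 0 / w.1 2) - y0) a)) = 1 := by
    intro w
    rw [← hQv, ← wv, hone]
  let g : C(Tot z, ℂ) := ⟨fun x => c0 * ∏ a, tof h0 a x, by fun_prop⟩
  let pi : C(F, Tot z) := ⟨fun w => ⟨(w.1 1 / w.1 2 - k * (w.1 0 / w.1 2) - y0, o * (w.1 0 / w.1 2)), by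
      intro a h
      have := hq1 w
      rw [Finset.prod_eq_zero (Finset.mem_univ a) (sub_eq_zero.2 h)] at this
      simp at this⟩, by
      apply Continuous.subtype_mk
      have : ∀ i, Continuous fun w : F => w.1 i := fun i => (continuous_apply i).comp continuous_subtype_val
      have d : ∀ i, Continuous fun w : F => w.1 i / w.1 2 := fun i => (this i).div (this 2) w2
      have := d 0
      have := d 1
      fun_prop⟩
  let ze : C(F, ℂ) := ⟨fun w => w.1 2, (continuous_apply 2).comp continuous_subtype_val⟩
  let mk : C({x : Tot z × ℂ // x.2 ^ (d₁ + d₂ + 1) * g x.1 = 1}, F) :=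
    ⟨fun x => ⟨![x.1.2 * (x.1.1.1.2 / o), x.1.2 * (k * (x.1.1.1.2 / o) + x.1.1.1.1 + y0), x.1.2], by
      rw [hF]
      change Q _ = 1
      rw [hQv]
      exact x.2⟩, by
      apply Continuous.subtype_mk
      refine continuous_pi fun a => ?_
      fin_cases a
      · simp; fun_prop
      · simp; fun_prop
      · simp; fun_prop⟩
  obtain ⟨Θ⟩ := main g (fun x => mul_ne_zero hc0 (Finset.prod_ne_zero_iff.2 fun a _ => tof_ne h0 a x)) c0 hc0 (fun x => rfl)
    (d₁ + d₂ + 1) (Nat.succ_ne_zero _) pi ze hq1 mk (fun w => Subtype.ext (wv w).symm) (by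
      rintro ⟨⟨⟨⟨Y, X⟩, hx⟩, ζ⟩, h⟩
      have hζ : ζ ≠ 0 := by
        rintro rfl
        simp at h
      apply Subtype.ext
      refine Prod.ext ?_ ?_
      · simp [pi, mk]; field_simp; ring
      · simp [pi, mk]; field_simp) w₀
  exact ⟨Θ.trans (LinearEquiv.funCongrLeft ℤ ℤ finSumFinEquiv.symm).toAddEquiv⟩
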